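/- arXiv:2312.09904 — 3 statements merged into one kernel-verified Lean document; each statement's English description precedes it below -/
import Mathlib

section
/- Let F be a field and let Ω be a tree quiver such that there is no infinite sequence of indecomposable FLEI representations of Ω over F connected by morphisms each of which is nonzero and not an isomorphism. Then every representation V of Ω is an internal direct sum of a family of indecomposable FLEI subrepresentations (i.e. there is a family (W_j)_{j∈J} of indecomposable FLEI subrepresentations of V such that at every vertex i the spaces W_j(i) are independent and sum to V(i)); moreover, given two such decompositions of V there is a bijection between the two index sets matching each summand to an isomorphic summand. -/
/-- A quiver: a set of vertices, a set of arrows, with source and target maps. -/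
structure Quiv : Type 1 where
  V : Type
  A : Type
  s : A → V
  t : A → V

/-- A representation of a quiver over a field `F`. -/
structure QRep (F : Type) [Field F] (Q : Quiv) : Type 1 where
  M : Q.V → Type
  [acg : ∀ i, AddCommGroup (M i)]
  [mod : ∀ i, Module F (M i)]
  map : ∀ a : Q.A, M (Q.s a) →ₗ[F] M (Q.t a)

attribute [instance] QRep.acg QRep.mod

namespace QRep

variable {F : Type} [Field F] {Q : Quiv}

/-- A representation is nonzero if some vertex space has a nonzero vector. -/
def Nonzero (V : QRep F Q) : Prop := ∃ i, ∃ x : V.M i, x ≠ 0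

/-- A morphism of representations. -/
structure Hom (V W : QRep F Q) : Type where
  app : ∀ i, V.M i →ₗ[F] W.M i
  comm : ∀ a : Q.A, (W.map a).comp (app (Q.s a)) = (app (Q.t a)).comp (V.map a)

/-- A morphism is an isomorphism iff it is bijective at each vertex. -/
def Hom.IsIso {V W : QRep F Q} (f : Hom V W) : Prop := ∀ i, Function.Bijective (f.app i)

/-- Two representations are isomorphic. -/
def Iso (V W : QRep F Q) : Prop := ∃ f : Hom V W, f.IsIso

/-- The (external) direct sum of two representations. -/
def dsum (V W : QRep F Q) : QRep F Q where
  M i := V.M i × W.M i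
  map a := (V.map a).prodMap (W.map a)

/-- A representation is indecomposable if it is nonzero and not isomorphic to a direct
sum of two nonzero representations. -/
def Indec (V : QRep F Q) : Prop :=
  V.Nonzero ∧ ∀ A B : QRep F Q, A.Nonzero → B.Nonzero → ¬ Iso V (dsum A B)

/-- FLEI: locally finite-dimensional, and all but finitely many arrow maps are
isomorphisms. -/
def IsFLEI (V : QRep F Q) : Prop :=
  (∀ i, FiniteDimensional F (V.M i)) ∧ {a : Q.A | ¬ Function.Bijective (V.map a)}.Finite

end QRep

/-- A subrepresentation: a subspace at each vertex, stable under the arrow maps. -/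
structure Subrep {F : Type} [Field F] {Q : Quiv} (V : QRep F Q) : Type where
  S : ∀ i, Submodule F (V.M i)
  stable : ∀ a : Q.A, ∀ x ∈ S (Q.s a), V.map a x ∈ S (Q.t a)

namespace Subrep

variable {F : Type} [Field F] {Q : Quiv} {V : QRep F Q}

/-- A subrepresentation, viewed as a representation in its own right. -/
def toRep (W : Subrep V) : QRep F Q where
  M i := ↥(W.S i)
  map a := (V.map a).restrict (W.stable a)

/-- The quotient of a representation by a subrepresentation. -/
def quot (W : Subrep V) : QRep F Q where
  M i := V.M i ⧸ W.S i
  map a := Submodule.mapQ _ _ (V.map a) (fun x hx => W.stable a x hx)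

end Subrep
/-- Adjacency in the underlying graph of a quiver. -/
def Quiv.Adj (Q : Quiv) (i j : Q.V) : Prop :=
  ∃ a : Q.A, (Q.s a = i ∧ Q.t a = j) ∨ (Q.s a = j ∧ Q.t a = i)

/-- The underlying graph is connected. -/
def Quiv.Connected (Q : Quiv) : Prop :=
  ∀ i j : Q.V, Relation.ReflTransGen Q.Adj i j

/-- Source of an oriented edge-traversal (arrow plus direction of traversal). -/
def Quiv.esrc (Q : Quiv) (p : Q.A × Bool) : Q.V := if p.2 then Q.s p.1 else Q.t p.1

/-- Target of an oriented edge-traversal. -/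
def Quiv.etgt (Q : Quiv) (p : Q.A × Bool) : Q.V := if p.2 then Q.t p.1 else Q.s p.1

/-- `e 0, …, e (n-1)` is a cycle: a closed walk of positive length in the underlying
graph traversing no edge twice. -/
def Quiv.IsCycle (Q : Quiv) (n : ℕ) (e : ℕ → Q.A × Bool) : Prop :=
  0 < n ∧ (∀ k < n, Q.etgt (e k) = Q.esrc (e ((k + 1) % n))) ∧
    (∀ j < n, ∀ k < n, (e j).1 = (e k).1 → j = k)

/-- The quiver has no cycles in its underlying graph. -/
def Quiv.NoCycles (Q : Quiv) : Prop := ¬ ∃ (n : ℕ) (e : ℕ → Q.A × Bool), Q.IsCycle n e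

/-- A tree quiver: connected underlying graph with no cycles. -/
def Quiv.IsTree (Q : Quiv) : Prop := Q.Connected ∧ Q.NoCycles
namespace QRep

variable {F : Type} [Field F] {Q : Quiv}

/-- A morphism is nonzero if it is nonzero at some vertex. -/
def Hom.Nonzero {V W : QRep F Q} (f : Hom V W) : Prop := ∃ i, f.app i ≠ 0

/-- A morphism is injective if it is injective at every vertex. -/
def Hom.Injective {V W : QRep F Q} (f : Hom V W) : Prop :=
  ∀ i, Function.Injective (f.app i)

/-- A morphism is surjective if it is surjective at every vertex. -/
def Hom.Surjective {V W : QRep F Q} (f : Hom V W) : Prop :=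
  ∀ i, Function.Surjective (f.app i)

end QRep
/-- A family of subrepresentations is an internal direct sum decomposition if at each
vertex the subspaces are independent and sum to the whole space. -/
def IsDecomp {F : Type} [Field F] {Q : Quiv} {V : QRep F Q} {ι : Type}
    (W : ι → Subrep V) : Prop :=
  (∀ i : Q.V, ∀ j : ι, Disjoint ((W j).S i) (⨆ (k : ι) (_ : k ≠ j), (W k).S i)) ∧
  (∀ i : Q.V, (⨆ j : ι, (W j).S i) = ⊤)

namespace Quiv

/-- Adjacency in the underlying graph with the arrow `a` removed. -/
def AdjOff (Q : Quiv) (a : Q.A) (u w : Q.V) : Prop :=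
  ∃ b : Q.A, b ≠ a ∧ ((Q.s b = u ∧ Q.t b = w) ∨ (Q.s b = w ∧ Q.t b = u))

variable {Q : Quiv}

theorem AdjOff.symm {a : Q.A} {u w : Q.V} (h : Q.AdjOff a u w) : Q.AdjOff a w u := by
  obtain ⟨b, hb, h⟩ := h
  exact ⟨b, hb, h.symm⟩

theorem reflTransGen_adjOff_symm {a : Q.A} {u w : Q.V}
    (h : Relation.ReflTransGen (Q.AdjOff a) u w) : Relation.ReflTransGen (Q.AdjOff a) w u := by
  induction h with
  | refl => exact .refl
  | tail _ hbc ih => exact ih.head hbc.symm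

/-- Removing an arrow from a quiver without cycles disconnects its endpoints. -/
theorem NoCycles.not_reflTransGen (h : Q.NoCycles) (a : Q.A) :
    ¬ Relation.ReflTransGen (Q.AdjOff a) (Q.t a) (Q.s a) := by
  classical
  intro hr
  let G : SimpleGraph Q.V :=
    { Adj := fun u w => u ≠ w ∧ Q.AdjOff a u w
      symm := ⟨fun u w huw => ⟨huw.1.symm, huw.2.symm⟩⟩
      loopless := ⟨fun u hu => hu.1 rfl⟩ }
  have hreach : G.Reachable (Q.t a) (Q.s a) := by
    generalize Q.s a = w at hr
    induction hr with
    | refl => exact SimpleGraph.Reachable.refl _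
    | @tail b c _ hbc ih =>
      by_cases hne : b = c
      · exact hne ▸ ih
      · exact ih.trans (SimpleGraph.Adj.reachable (G := G) ⟨hne, hbc⟩)
  obtain ⟨p, hp⟩ := hreach.exists_isPath
  have hinj := hp.getVert_injOn
  set n := p.length with hn
  have key : ∀ k, k < n → ∃ e : Q.A × Bool, e.1 ≠ a ∧ Q.esrc e = p.getVert k ∧
      Q.etgt e = p.getVert (k + 1) := by
    intro k hk
    obtain ⟨_, b, hb, h1 | h1⟩ := p.adj_getVert_succ hk
    · exact ⟨(b, true), hb, h1.1, h1.2⟩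
    · exact ⟨(b, false), hb, h1.2, h1.1⟩
  have : Nonempty (Q.A × Bool) := ⟨(a, true)⟩
  choose! e he using key
  let e' : ℕ → Q.A × Bool := fun k => if k < n then e k else (a, true)
  have hsrc : ∀ k, k ≤ n → Q.esrc (e' k) = p.getVert k := by
    intro k hk
    by_cases h1 : k < n
    · simp only [e', h1, if_true, (he k h1).2.1]
    · obtain rfl : k = n := by omega
      simp [e', esrc, hn]
  refine h ⟨n + 1, e', by omega, ?_, ?_⟩
  · intro k hk
    by_cases h1 : k < n
    · rw [Nat.mod_eq_of_lt (by omega), hsrc _ (by omega)]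
      simp only [e', h1, if_true, (he k h1).2.2]
    · obtain rfl : k = n := by omega
      rw [Nat.mod_self, hsrc _ (by omega)]
      simp [e', etgt]
  · intro j hj k hk hjk
    by_cases h1 : j < n <;> by_cases h2 : k < n
    · simp only [e', h1, h2, if_true] at hjk
      obtain ⟨-, a1, a2⟩ := he j h1
      obtain ⟨-, b1, b2⟩ := he k h2
      have hor : (Q.esrc (e j) = Q.esrc (e k) ∧ Q.etgt (e j) = Q.etgt (e k)) ∨
          (Q.esrc (e j) = Q.etgt (e k) ∧ Q.etgt (e j) = Q.esrc (e k)) := by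
        unfold esrc etgt
        rw [hjk]
        cases (e j).2 <;> cases (e k).2 <;> simp
      rw [a1, a2, b1, b2] at hor
      rcases hor with hor | hor
      · exact hinj (show j ≤ n by omega) (show k ≤ n by omega) hor.1
      · have q1 := hinj (show j ≤ n by omega) (show k + 1 ≤ n by omega) hor.1
        have q2 := hinj (show j + 1 ≤ n by omega) (show k ≤ n by omega) hor.2
        omega
    · simp only [e', h1, h2, if_true, if_false] at hjk
      exact absurd hjk (he j h1).1
    · simp only [e', h1, h2, if_true, if_false] at hjk
      exact absurd hjk.symm (he k h2).1
    · omega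

/-- The vertex `j` is the end of a directed path starting at `i`. -/
def Reach (Q : Quiv) : Q.V → Q.V → Prop :=
  Relation.ReflTransGen (fun u w => ∃ a : Q.A, Q.s a = u ∧ Q.t a = w)

theorem Reach.step {i : Q.V} (a : Q.A) (h : Q.Reach i (Q.s a)) : Q.Reach i (Q.t a) :=
  Relation.ReflTransGen.tail h ⟨a, rfl, rfl⟩

theorem Reach.adjOff_or {i k : Q.V} (h : Q.Reach i k) (a : Q.A) :
    Relation.ReflTransGen (Q.AdjOff a) i k ∨ Q.Reach (Q.t a) k := by
  induction h with
  | refl => exact Or.inl .refl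
  | @tail u w _ huw ih =>
    obtain ⟨b, rfl, rfl⟩ := huw
    rcases ih with ih | ih
    · by_cases hba : b = a
      · subst hba
        exact Or.inr .refl
      · exact Or.inl (ih.tail ⟨b, hba, Or.inl ⟨rfl, rfl⟩⟩)
    · exact Or.inr ih.step

theorem Reach.adjOff_or_source {i k : Q.V} (h : Q.Reach i k) (a : Q.A) :
    Relation.ReflTransGen (Q.AdjOff a) i k ∨ Relation.ReflTransGen (Q.AdjOff a) i (Q.s a) := by
  induction h with
  | refl => exact Or.inl .refl
  | @tail u w _ huw ih =>
    obtain ⟨b, rfl, rfl⟩ := huw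
    rcases ih with ih | ih
    · by_cases hba : b = a
      · subst hba
        exact Or.inr ih
      · exact Or.inl (ih.tail ⟨b, hba, Or.inl ⟨rfl, rfl⟩⟩)
    · exact Or.inr ih

theorem Reach.adjOff_source {i : Q.V} {a : Q.A} (h : Q.Reach i (Q.s a)) :
    Relation.ReflTransGen (Q.AdjOff a) i (Q.s a) :=
  (h.adjOff_or_source a).elim id id

theorem NoCycles.not_reach (h : Q.NoCycles) (a : Q.A) : ¬ Q.Reach (Q.t a) (Q.s a) :=
  fun hr => h.not_reflTransGen a hr.adjOff_source

/-- In a quiver without cycles the last arrow of a directed path is determined by its ends. -/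
theorem NoCycles.eq_of_reach (h : Q.NoCycles) {i : Q.V} {a b : Q.A} (ha : Q.Reach i (Q.s a))
    (hb : Q.Reach i (Q.s b)) (hab : Q.t a = Q.t b) : a = b := by
  by_contra hne
  rcases hb.adjOff_or a with h1 | h1
  · refine h.not_reflTransGen a (Relation.ReflTransGen.trans ?_
      ((reflTransGen_adjOff_symm h1).trans ha.adjOff_source))
    exact .single ⟨b, Ne.symm hne, Or.inr ⟨rfl, hab.symm⟩⟩
  · rw [hab] at h1
    exact h.not_reach b h1

end Quiv

namespace QRep

variable {F : Type} [Field F] {Q : Quiv}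

namespace Hom

variable {A B C : QRep F Q}

theorem comm_apply (f : Hom A B) (a : Q.A) (x : A.M (Q.s a)) :
    B.map a (f.app _ x) = f.app _ (A.map a x) :=
  LinearMap.congr_fun (f.comm a) x

/-- A morphism from a family of linear maps commuting elementwise with the arrow maps. -/
def mk' (φ : ∀ i, A.M i →ₗ[F] B.M i)
    (h : ∀ (a : Q.A) (x : A.M (Q.s a)), B.map a (φ _ x) = φ _ (A.map a x)) : Hom A B where
  app := φ
  comm a := LinearMap.ext (h a)

/-- The identity morphism. -/
def id (A : QRep F Q) : Hom A A := mk' (fun _ => LinearMap.id) fun _ _ => rfl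

/-- Composition of morphisms. -/
def comp (g : Hom B C) (f : Hom A B) : Hom A C :=
  mk' (fun i => g.app i ∘ₗ f.app i) fun a x => by simp [comm_apply]

@[simp] theorem comp_app (g : Hom B C) (f : Hom A B) (i : Q.V) (x : A.M i) :
    (g.comp f).app i x = g.app i (f.app i x) := rfl

/-- The difference of two morphisms. -/
def sub (f g : Hom A B) : Hom A B :=
  mk' (fun i => f.app i - g.app i) fun a x => by simp [comm_apply]

theorem nonzero_iff (f : Hom A B) : f.Nonzero ↔ ∃ i x, f.app i x ≠ 0 := by
  refine exists_congr fun i => ?_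
  rw [Ne, LinearMap.ext_iff, not_forall]
  rfl

/-- The inverse of an isomorphism. -/
noncomputable def inv (f : Hom A B) (hf : f.IsIso) : Hom B A :=
  mk' (fun i => (LinearEquiv.ofBijective (f.app i) (hf i)).symm.toLinearMap) fun a x => by
    obtain ⟨y, rfl⟩ := (hf _).2 x
    apply (hf _).1
    rw [← comm_apply]
    have h1 : ∀ i (y : A.M i), (LinearEquiv.ofBijective (f.app i) (hf i)).symm (f.app i y) = y :=
      fun i y => (LinearEquiv.ofBijective (f.app i) (hf i)).symm_apply_apply y
    simp only [LinearEquiv.coe_coe]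
    rw [h1, comm_apply, h1]

@[simp] theorem inv_app_app (f : Hom A B) (hf : f.IsIso) (i : Q.V) (x : A.M i) :
    (f.inv hf).app i (f.app i x) = x :=
  (LinearEquiv.ofBijective (f.app i) (hf i)).symm_apply_apply x

@[simp] theorem app_inv_app (f : Hom A B) (hf : f.IsIso) (i : Q.V) (x : B.M i) :
    f.app i ((f.inv hf).app i x) = x :=
  (LinearEquiv.ofBijective (f.app i) (hf i)).apply_symm_apply x

theorem isIso_of_inverse (f : Hom A B) (g : Hom B A) (h1 : ∀ i x, g.app i (f.app i x) = x)
    (h2 : ∀ i x, f.app i (g.app i x) = x) : f.IsIso := fun i =>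
  Function.bijective_iff_has_inverse.2 ⟨g.app i, h1 i, h2 i⟩

theorem isIso_inv (f : Hom A B) (hf : f.IsIso) : (f.inv hf).IsIso :=
  isIso_of_inverse _ f (by simp) (by simp)

theorem IsIso.comp {g : Hom B C} {f : Hom A B} (hg : g.IsIso) (hf : f.IsIso) :
    (g.comp f).IsIso := fun i => (hg i).comp (hf i)

theorem IsIso.nonzero {f : Hom A B} (hf : f.IsIso) (hA : A.Nonzero) : f.Nonzero := by
  obtain ⟨i, x, hx⟩ := hA
  exact f.nonzero_iff.2 ⟨i, x, fun h => hx ((hf i).1 (by simpa using h))⟩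

end Hom

variable {A B C : QRep F Q}

theorem Iso.refl (A : QRep F Q) : Iso A A := ⟨Hom.id A, fun _ => Function.bijective_id⟩

theorem Iso.symm (h : Iso A B) : Iso B A := by
  obtain ⟨f, hf⟩ := h
  exact ⟨f.inv hf, f.isIso_inv hf⟩

theorem Iso.trans (h : Iso A B) (h' : Iso B C) : Iso A C := by
  obtain ⟨f, hf⟩ := h
  obtain ⟨g, hg⟩ := h'
  exact ⟨g.comp f, hg.comp hf⟩

theorem Nonzero.of_iso (h : Iso A B) (hA : A.Nonzero) : B.Nonzero := by
  obtain ⟨f, hf⟩ := h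
  obtain ⟨i, x, hx⟩ := f.nonzero_iff.1 (hf.nonzero hA)
  exact ⟨i, _, hx⟩

theorem Indec.of_iso (h : Iso A B) (hA : A.Indec) : B.Indec :=
  ⟨hA.1.of_iso h, fun X Y hX hY h' => hA.2 X Y hX hY (h.trans h')⟩

theorem bijective_map_of_iso {f : Hom A B} (hf : f.IsIso) (a : Q.A)
    (ha : Function.Bijective (A.map a)) : Function.Bijective (B.map a) := by
  have h1 : B.map a ∘ f.app (Q.s a) = f.app (Q.t a) ∘ A.map a := funext (f.comm_apply a)
  exact (Function.Bijective.of_comp_iff _ (hf _)).1 (h1 ▸ (hf _).comp ha)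

theorem IsFLEI.of_iso (h : Iso A B) (hA : A.IsFLEI) : B.IsFLEI := by
  obtain ⟨f, hf⟩ := h
  refine ⟨fun i => ?_, hA.2.subset fun a ha hb => ha (bijective_map_of_iso hf a hb)⟩
  have := hA.1 i
  exact Module.Finite.of_surjective (f.app i) (hf i).2

namespace Hom

/-- The first projection of a direct sum. -/
def fst (A B : QRep F Q) : Hom (dsum A B) A :=
  mk' (fun i => LinearMap.fst F (A.M i) (B.M i)) fun _ _ => rfl

/-- The second projection of a direct sum. -/
def snd (A B : QRep F Q) : Hom (dsum A B) B :=
  mk' (fun i => LinearMap.snd F (A.M i) (B.M i)) fun _ _ => rfl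

/-- The first inclusion into a direct sum. -/
def inl (A B : QRep F Q) : Hom A (dsum A B) :=
  mk' (fun i => LinearMap.inl F (A.M i) (B.M i)) fun a _ =>
    Prod.ext rfl (map_zero (B.map a))

/-- The second inclusion into a direct sum. -/
def inr (A B : QRep F Q) : Hom B (dsum A B) :=
  mk' (fun i => LinearMap.inr F (A.M i) (B.M i)) fun a _ =>
    Prod.ext (map_zero (A.map a)) rfl

@[simp] theorem fst_inl (i : Q.V) (x : A.M i) : (fst A B).app i ((inl A B).app i x) = x := rfl

@[simp] theorem snd_inr (i : Q.V) (x : B.M i) : (snd A B).app i ((inr A B).app i x) = x := rfl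

@[simp] theorem fst_inr (i : Q.V) (x : B.M i) : (fst A B).app i ((inr A B).app i x) = 0 := rfl

@[simp] theorem snd_inl (i : Q.V) (x : A.M i) : (snd A B).app i ((inl A B).app i x) = 0 := rfl

theorem dsum_ext {i : Q.V} {x y : (dsum A B).M i} (h1 : (fst A B).app i x = (fst A B).app i y)
    (h2 : (snd A B).app i x = (snd A B).app i y) : x = y :=
  Prod.ext h1 h2

end Hom

/-- A nonzero representation whose only idempotent endomorphisms are zero and the identity is
indecomposable. -/
theorem indec_of_idempotent (hA : A.Nonzero)
    (h : ∀ e : Hom A A, (∀ i x, e.app i (e.app i x) = e.app i x) →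
      (∀ i x, e.app i x = 0) ∨ (∀ i x, e.app i x = x)) : A.Indec := by
  refine ⟨hA, fun X Y hX hY ⟨f, hf⟩ => ?_⟩
  let p : Hom (dsum X Y) (dsum X Y) := (Hom.inl X Y).comp (Hom.fst X Y)
  obtain ⟨i, x, hx⟩ := hX
  obtain ⟨j, y, hy⟩ := hY
  rcases h ((f.inv hf).comp (p.comp f)) (fun i x => by simp [p]) with h1 | h1
  · have h2 := congrArg (fun z => (Hom.fst X Y).app i (f.app i z))
      (h1 i ((f.inv hf).app i ((Hom.inl X Y).app i x)))
    simp only [p, Hom.comp_app, Hom.app_inv_app, Hom.fst_inl, map_zero] at h2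
    exact hx h2
  · have h2 := congrArg (fun z => (Hom.snd X Y).app j (f.app j z))
      (h1 j ((f.inv hf).app j ((Hom.inr X Y).app j y)))
    simp only [p, Hom.comp_app, Hom.app_inv_app, Hom.snd_inl, Hom.snd_inr] at h2
    exact hy h2.symm

end QRep

namespace QRep

variable {F : Type} [Field F] {Q : Quiv} {E : Type} [AddCommGroup E] [Module F E]

/-- The representation whose spaces are the subquotients `L v / K v` of a fixed space and whose
maps are induced by the identity. -/
def subquotient (L K : Q.V → Submodule F E) (hL : ∀ a, L (Q.s a) ≤ L (Q.t a))
    (hK : ∀ a, K (Q.s a) ≤ K (Q.t a)) : QRep F Q where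
  M v := ↥(L v) ⧸ (K v).comap (L v).subtype
  map a := Submodule.mapQ _ _ (Submodule.inclusion (hL a)) fun _ hx => hK a hx

section

variable {L K : Q.V → Submodule F E} {hL : ∀ a, L (Q.s a) ≤ L (Q.t a)}
  {hK : ∀ a, K (Q.s a) ≤ K (Q.t a)}

/-- The class of an element of `L v` in `L v / K v`. -/
def subquotientMk (hL : ∀ a, L (Q.s a) ≤ L (Q.t a)) (hK : ∀ a, K (Q.s a) ≤ K (Q.t a)) (v : Q.V) :
    L v →ₗ[F] (subquotient L K hL hK).M v :=
  Submodule.mkQ _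

theorem subquotientMk_surjective (v : Q.V) :
    Function.Surjective (subquotientMk (K := K) hL hK v) :=
  Submodule.mkQ_surjective _

theorem subquotientMk_eq {v : Q.V} {x y : L v} :
    subquotientMk hL hK v x = subquotientMk hL hK v y ↔ (x : E) - y ∈ K v :=
  Submodule.Quotient.eq _

theorem subquotientMk_eq_zero {v : Q.V} {x : L v} :
    subquotientMk hL hK v x = 0 ↔ (x : E) ∈ K v :=
  Submodule.Quotient.mk_eq_zero _

theorem subquotient_map_mk (a : Q.A) (x : E) (hx : x ∈ L (Q.s a)) :
    (subquotient L K hL hK).map a (subquotientMk hL hK _ ⟨x, hx⟩) =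
      subquotientMk hL hK _ ⟨x, hL a hx⟩ := rfl

theorem subquotient_map_bijective {a : Q.A} (h1 : L (Q.s a) = L (Q.t a))
    (h2 : K (Q.s a) = K (Q.t a)) : Function.Bijective ((subquotient L K hL hK).map a) := by
  constructor
  · rw [injective_iff_map_eq_zero]
    intro z hz
    obtain ⟨⟨x, hx⟩, rfl⟩ := subquotientMk_surjective _ z
    rw [subquotient_map_mk, subquotientMk_eq_zero, ← h2] at hz
    exact subquotientMk_eq_zero.2 hz
  · intro z
    obtain ⟨⟨x, hx⟩, rfl⟩ := subquotientMk_surjective _ z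
    exact ⟨subquotientMk hL hK _ ⟨x, h1 ▸ hx⟩, rfl⟩

/-- An endomorphism of the ambient space preserving all `L v` and `K v` induces an endomorphism. -/
def subquotientEnd (hL : ∀ a, L (Q.s a) ≤ L (Q.t a)) (hK : ∀ a, K (Q.s a) ≤ K (Q.t a))
    (φ : E →ₗ[F] E) (h1 : ∀ v, ∀ x ∈ L v, φ x ∈ L v)
    (h2 : ∀ v, ∀ x ∈ K v, φ x ∈ K v) :
    Hom (subquotient L K hL hK) (subquotient L K hL hK) :=
  Hom.mk' (fun v => Submodule.mapQ _ _ (φ.restrict (h1 v)) fun x hx => h2 v x hx) fun a z => by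
    obtain ⟨⟨x, hx⟩, rfl⟩ := subquotientMk_surjective _ z
    rfl

/-- The endomorphism `e` is induced by `φ` at the vertex `v`. -/
def InducedAt (e : Hom (subquotient L K hL hK) (subquotient L K hL hK)) (φ : E →ₗ[F] E)
    (v : Q.V) : Prop :=
  ∀ x y : L v, e.app v (subquotientMk hL hK v x) = subquotientMk hL hK v y → φ x - y ∈ K v

theorem exists_inducedAt (e : Hom (subquotient L K hL hK) (subquotient L K hL hK)) {c : Q.V}
    (h1 : L c = ⊤) (h2 : K c = ⊥) : ∃ φ : E →ₗ[F] E, InducedAt e φ c ∧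
      ((∀ i x, e.app i (e.app i x) = e.app i x) → ∀ x, φ (φ x) = φ x) := by
  let lam : (subquotient L K hL hK).M c →ₗ[F] E :=
    Submodule.liftQ _ (L c).subtype fun x hx => by
      simpa [h2] using hx
  let mu : E →ₗ[F] (subquotient L K hL hK).M c :=
    subquotientMk hL hK c ∘ₗ LinearMap.codRestrict (L c) LinearMap.id fun x => by simp [h1]
  have hlam : ∀ x, lam (subquotientMk hL hK c x) = x := fun _ => rfl
  have hmu : ∀ x : L c, mu x = subquotientMk hL hK c x := fun _ => rfl
  have hml : ∀ z, mu (lam z) = z := by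
    intro z
    obtain ⟨x, rfl⟩ := subquotientMk_surjective _ z
    rw [hlam, hmu]
  refine ⟨lam ∘ₗ e.app c ∘ₗ mu, fun x y hxy => ?_, fun he x => ?_⟩
  · simp [hmu, hxy, hlam]
  · simp [hml, he]

theorem InducedAt.of_eq_source {e : Hom (subquotient L K hL hK) (subquotient L K hL hK)}
    {φ : E →ₗ[F] E} {a : Q.A} (h : InducedAt e φ (Q.t a)) (h2 : K (Q.s a) = K (Q.t a)) :
    InducedAt e φ (Q.s a) := by
  intro x y hxy
  rw [h2]
  refine h ⟨x, hL a x.2⟩ ⟨y, hL a y.2⟩ ?_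
  rw [← subquotient_map_mk a _ x.2, ← Hom.comm_apply, hxy]
  rfl

theorem InducedAt.of_eq_target {e : Hom (subquotient L K hL hK) (subquotient L K hL hK)}
    {φ : E →ₗ[F] E} {a : Q.A} (h : InducedAt e φ (Q.s a)) (h1 : L (Q.s a) = L (Q.t a)) :
    InducedAt e φ (Q.t a) := by
  intro x y hxy
  obtain ⟨⟨z, hz⟩, hz'⟩ := subquotientMk_surjective _
    (e.app _ (subquotientMk hL hK (Q.s a) ⟨x, h1.ge x.2⟩))
  have h3 := h _ _ hz'.symm
  have h4 := congrArg ((subquotient L K hL hK).map a) hz'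
  rw [Hom.comm_apply, subquotient_map_mk, subquotient_map_mk] at h4
  have h5 := h4.trans hxy
  rw [subquotientMk_eq] at h5
  simpa using (K (Q.t a)).add_mem (hK a h3) h5

end

section FourSubspaces

/-- Four subspaces of a four-dimensional space whose algebra of common endomorphisms is the
algebra of dual numbers. -/
def fourSubspaces (F : Type) [Field F] : Fin 4 → Submodule F (Fin 4 → F)
  | 0 => { carrier := {x | x 2 = 0 ∧ x 3 = 0}
           add_mem' := by rintro x y ⟨h1, h2⟩ ⟨h3, h4⟩; simp [h1, h2, h3, h4]
           zero_mem' := by simp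
           smul_mem' := by rintro c x ⟨h1, h2⟩; simp [h1, h2] }
  | 1 => { carrier := {x | x 0 = 0 ∧ x 1 = 0}
           add_mem' := by rintro x y ⟨h1, h2⟩ ⟨h3, h4⟩; simp [h1, h2, h3, h4]
           zero_mem' := by simp
           smul_mem' := by rintro c x ⟨h1, h2⟩; simp [h1, h2] }
  | 2 => { carrier := {x | x 0 = x 2 ∧ x 1 = x 3}
           add_mem' := by rintro x y ⟨h1, h2⟩ ⟨h3, h4⟩; simp [h1, h2, h3, h4]
           zero_mem' := by simp
           smul_mem' := by rintro c x ⟨h1, h2⟩; simp [h1, h2] }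
  | 3 => { carrier := {x | x 2 = x 1 ∧ x 3 = 0}
           add_mem' := by rintro x y ⟨h1, h2⟩ ⟨h3, h4⟩; simp [h1, h2, h3, h4]
           zero_mem' := by simp
           smul_mem' := by rintro c x ⟨h1, h2⟩; simp [h1, h2] }

/-- A nilpotent endomorphism preserving `fourSubspaces`. -/
def fourNilpotent (F : Type) [Field F] : (Fin 4 → F) →ₗ[F] (Fin 4 → F) where
  toFun x := ![x 1, 0, x 3, 0]
  map_add' x y := by ext i; fin_cases i <;> simp
  map_smul' c x := by ext i; fin_cases i <;> simp

theorem fourNilpotent_mem (k : Fin 4) (x : Fin 4 → F) (hx : x ∈ fourSubspaces F k) :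
    fourNilpotent F x ∈ fourSubspaces F k := by
  fin_cases k <;> obtain ⟨h1, h2⟩ := hx <;> constructor <;> simp_all [fourNilpotent]

theorem eq_zero_or_id_of_fourSubspaces (φ : (Fin 4 → F) →ₗ[F] (Fin 4 → F))
    (h : ∀ k, ∀ x ∈ fourSubspaces F k, φ x ∈ fourSubspaces F k) (hφ : ∀ x, φ (φ x) = φ x) :
    φ = 0 ∨ φ = LinearMap.id := by
  have e0 := h 0 (Pi.single 0 1) ⟨by simp, by simp⟩
  have e1 := h 0 (Pi.single 1 1) ⟨by simp, by simp⟩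
  have e2 := h 1 (Pi.single 2 1) ⟨by simp, by simp⟩
  have e3 := h 1 (Pi.single 3 1) ⟨by simp, by simp⟩
  have e02 := h 2 (Pi.single 0 1 + Pi.single 2 1) ⟨by simp, by simp⟩
  have e13 := h 2 (Pi.single 1 1 + Pi.single 3 1) ⟨by simp, by simp⟩
  have f0 := h 3 (Pi.single 0 1) ⟨by simp, by simp⟩
  have f12 := h 3 (Pi.single 1 1 + Pi.single 2 1) ⟨by simp, by simp⟩
  rw [map_add] at e02 e13 f12
  have i0 := hφ (Pi.single 1 1)
  generalize hw0 : φ (Pi.single 0 1) = w0 at *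
  generalize hw1 : φ (Pi.single 1 1) = w1 at *
  generalize hw2 : φ (Pi.single 2 1) = w2 at *
  generalize hw3 : φ (Pi.single 3 1) = w3 at *
  obtain ⟨a1, a2⟩ : w0 2 = 0 ∧ w0 3 = 0 := e0
  obtain ⟨b1, b2⟩ : w1 2 = 0 ∧ w1 3 = 0 := e1
  obtain ⟨c1, c2⟩ : w2 0 = 0 ∧ w2 1 = 0 := e2
  obtain ⟨d1, d2⟩ : w3 0 = 0 ∧ w3 1 = 0 := e3
  obtain ⟨g1, g2⟩ : w0 0 + w2 0 = w0 2 + w2 2 ∧ w0 1 + w2 1 = w0 3 + w2 3 := e02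
  obtain ⟨k1, k2⟩ : w1 0 + w3 0 = w1 2 + w3 2 ∧ w1 1 + w3 1 = w1 3 + w3 3 := e13
  obtain ⟨l1, -⟩ : w0 2 = w0 1 ∧ w0 3 = 0 := f0
  obtain ⟨m1, m2⟩ : w1 2 + w2 2 = w1 1 + w2 1 ∧ w1 3 + w2 3 = 0 := f12
  obtain ⟨p, hp⟩ : ∃ p, w1 1 = p := ⟨_, rfl⟩
  obtain ⟨q, hq⟩ : ∃ q, w1 0 = q := ⟨_, rfl⟩
  have v1 : w1 = q • Pi.single 0 1 + p • Pi.single 1 1 := by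
    ext i; fin_cases i <;> simp [*]
  have v0 : w0 = p • Pi.single 0 1 := by
    ext i; fin_cases i <;> simp <;> grind
  have v2 : w2 = p • Pi.single 2 1 := by
    ext i; fin_cases i <;> simp <;> grind
  have v3 : w3 = q • Pi.single 2 1 + p • Pi.single 3 1 := by
    ext i; fin_cases i <;> simp <;> grind
  clear a1 a2 b1 b2 c1 c2 d1 d2 g1 g2 k1 k2 l1 m1 m2 hp hq h hφ
  subst v0 v1 v2 v3
  rw [map_add, map_smul, map_smul, hw0, hw1] at i0
  have j0 := congrFun i0 0
  have j1 := congrFun i0 1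
  simp at j0 j1
  have hp' : p = 0 ∨ p = 1 := by
    rcases eq_or_ne p 0 with h0 | h0
    · exact Or.inl h0
    · exact Or.inr (mul_left_cancel₀ h0 (by rw [j1, mul_one]))
  have hq0 : q = 0 := by
    rcases hp' with h0 | h0 <;> rw [h0] at j0 <;> simpa using j0.symm
  subst hq0
  rcases hp' with rfl | rfl
  · left
    refine LinearMap.pi_ext' fun i => LinearMap.ext_ring ?_
    fin_cases i <;> simp [hw0, hw1, hw2, hw3]
  · right
    refine LinearMap.pi_ext' fun i => LinearMap.ext_ring ?_
    fin_cases i <;> simp [hw0, hw1, hw2, hw3]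

end FourSubspaces

end QRep

/-- There is no infinite sequence of nonzero non-isomorphisms between indecomposable FLEI
representations. -/
def QRep.NoChain (F : Type) [Field F] (Q : Quiv) : Prop :=
  ¬ ∃ (W : ℕ → QRep F Q) (f : ∀ n : ℕ, QRep.Hom (W n) (W (n + 1))),
    (∀ n, (W n).Indec ∧ (W n).IsFLEI) ∧ (∀ n, (f n).Nonzero ∧ ¬ (f n).IsIso)

namespace QRep.NoChain

variable {F : Type} [Field F] {Q : Quiv}

theorem isIso_of_endo (h : NoChain F Q) {X : QRep F Q} (hX : X.Indec) (hX' : X.IsFLEI)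
    (f : Hom X X) (hf : f.Nonzero) : f.IsIso := by
  by_contra hn
  exact h ⟨fun _ => X, fun _ => f, fun _ => ⟨hX, hX'⟩, fun _ => ⟨hf, hn⟩⟩

theorem isIso_or_isIso (h : NoChain F Q) {X Y : QRep F Q} (hX : X.Indec) (hX' : X.IsFLEI)
    (hY : Y.Indec) (hY' : Y.IsFLEI) (f : Hom X Y) (g : Hom Y X) (hf : f.Nonzero)
    (hg : g.Nonzero) : f.IsIso ∨ g.IsIso := by
  by_contra! hn
  have step : ∀ b : Bool, ∃ φ : Hom (cond b X Y) (cond (!b) X Y), φ.Nonzero ∧ ¬ φ.IsIso := by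
    rintro (_ | _)
    · exact ⟨g, hg, hn.2⟩
    · exact ⟨f, hf, hn.1⟩
  choose φ hφ using step
  let b : ℕ → Bool := fun n => Nat.rec true (fun _ c => !c) n
  refine h ⟨fun n => cond (b n) X Y, fun n => φ (b n), fun n => ?_, fun n => hφ (b n)⟩
  dsimp only
  cases b n
  · exact ⟨hY, hY'⟩
  · exact ⟨hX, hX'⟩

end QRep.NoChain

open QRep in
/-- A connected set of vertices has at most three arrows on its boundary. -/
theorem Quiv.IsTree.boundary_finite {F : Type} [Field F] {Q : Quiv} (hQ : Q.IsTree)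
    (h : NoChain F Q) {C : Set Q.V} {c : Q.V} (hc : c ∈ C)
    (hC : ∀ v ∈ C, Relation.ReflTransGen (fun u w => Q.Adj u w ∧ u ∈ C ∧ w ∈ C) c v) :
    {a : Q.A | (Q.t a ∈ C ∧ Q.s a ∉ C) ∨ (Q.s a ∈ C ∧ Q.t a ∉ C)}.Finite := by
  classical
  by_contra hinf
  rw [← Set.Infinite] at hinf
  let e : Fin 4 → Q.A := fun k => hinf.natEmbedding _ k
  have he : Function.Injective e := fun j k hjk => by
    have h1 := (hinf.natEmbedding _).injective (Subtype.ext hjk)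
    exact Fin.ext h1
  have hb : ∀ k, (Q.t (e k) ∈ C ∧ Q.s (e k) ∉ C) ∨ (Q.s (e k) ∈ C ∧ Q.t (e k) ∉ C) :=
    fun k => (hinf.natEmbedding _ k).2
  let outer : Fin 4 → Q.V := fun k => if Q.s (e k) ∈ C then Q.t (e k) else Q.s (e k)
  let B : Fin 4 → Set Q.V := fun k => {v | Relation.ReflTransGen (Q.AdjOff (e k)) (outer k) v}
  have hBmem : ∀ k (a : Q.A), a ≠ e k → (Q.s a ∈ B k ↔ Q.t a ∈ B k) := fun k a ha =>
    ⟨fun h => h.tail ⟨a, ha, Or.inl ⟨rfl, rfl⟩⟩, fun h => h.tail ⟨a, ha, Or.inr ⟨rfl, rfl⟩⟩⟩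
  have hCe : ∀ v ∈ C, ∀ k, Relation.ReflTransGen (Q.AdjOff (e k)) c v := by
    intro v hv k
    refine (hC v hv).lift id ?_
    rintro u w ⟨⟨a, ha⟩, hu, hw⟩
    refine ⟨a, ?_, ha⟩
    rintro rfl
    rcases ha with ⟨rfl, rfl⟩ | ⟨rfl, rfl⟩ <;> rcases hb k with hb | hb <;> tauto
  have hBC : ∀ k, ∀ v ∈ C, v ∉ B k := by
    intro k v hv hvB
    have h1 := hvB.trans (Quiv.reflTransGen_adjOff_symm (hCe v hv k))
    rcases hb k with hb | hb
    · have h2 := h1.trans (hCe _ hb.1 k)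
      simp only [outer, hb.2, if_false] at h2
      exact hQ.2.not_reflTransGen _ (Quiv.reflTransGen_adjOff_symm h2)
    · have h2 := h1.trans (hCe _ hb.1 k)
      simp only [outer, hb.1, if_true] at h2
      exact hQ.2.not_reflTransGen _ h2
  let U := fourSubspaces F
  let L : Q.V → Submodule F (Fin 4 → F) := fun v =>
    ⨅ k, ⨅ (_ : v ∈ B k ∧ Q.s (e k) ∉ C), U k
  let K : Q.V → Submodule F (Fin 4 → F) := fun v =>
    ⨆ k, ⨆ (_ : v ∈ B k ∧ Q.s (e k) ∈ C), U k
  have hLeq : ∀ a, (∀ k, a = e k → Q.s (e k) ∈ C) → L (Q.s a) = L (Q.t a) := by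
    intro a ha
    refine iInf_congr fun k => ?_
    by_cases hak : a = e k
    · simp [ha k hak]
    · simp only [hBmem k a hak]
  have hKeq : ∀ a, (∀ k, a = e k → Q.s (e k) ∉ C) → K (Q.s a) = K (Q.t a) := by
    intro a ha
    refine iSup_congr fun k => ?_
    by_cases hak : a = e k
    · simp [ha k hak]
    · simp only [hBmem k a hak]
  have hL : ∀ a, L (Q.s a) ≤ L (Q.t a) := by
    intro a
    refine le_iInf fun k => le_iInf fun hk => ?_
    by_cases hak : a = e k
    · subst hak
      exact absurd hk.1 (hBC k _ ((hb k).resolve_right fun h => hk.2 h.1).1)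
    · exact iInf₂_le k (by rwa [hBmem k a hak])
  have hK : ∀ a, K (Q.s a) ≤ K (Q.t a) := by
    intro a
    refine iSup_le fun k => iSup_le fun hk => ?_
    by_cases hak : a = e k
    · subst hak
      exact absurd hk.1 (hBC k _ hk.2)
    · exact le_iSup₂_of_le k (by rwa [← hBmem k a hak]) le_rfl
  have hLC : ∀ v ∈ C, L v = ⊤ := fun v hv => by simp [L, hBC _ v hv]
  have hKC : ∀ v ∈ C, K v = ⊥ := fun v hv => by simp [K, hBC _ v hv]
  let R := subquotient L K hL hK
  have hfd : ∀ i, FiniteDimensional F (R.M i) := fun i =>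
    Module.Finite.of_surjective _ (subquotientMk_surjective (hL := hL) (hK := hK) i)
  have hflei : R.IsFLEI := by
    refine ⟨hfd, (Set.finite_range e).subset fun a ha => ?_⟩
    by_contra hne
    exact ha (subquotient_map_bijective (hLeq a fun k hk => (hne ⟨k, hk.symm⟩).elim)
      (hKeq a fun k hk => (hne ⟨k, hk.symm⟩).elim))
  have houterB : ∀ k l, outer k ∈ B l → l = k := by
    intro k l hkl
    by_contra hne
    have h1 := hBmem l (e k) fun h => hne (he h).symm
    by_cases hs : Q.s (e k) ∈ C
    · simp only [outer, hs, if_true] at hkl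
      exact hBC l _ hs (h1.2 hkl)
    · simp only [outer, hs, if_false] at hkl
      exact hBC l _ ((hb k).resolve_right fun h => hs h.1).1 (h1.1 hkl)
  have hself : ∀ k, outer k ∈ B k := fun k => Relation.ReflTransGen.refl
  have hLout : ∀ k, Q.s (e k) ∉ C → L (outer k) = U k := by
    intro k hk
    refine le_antisymm (iInf₂_le k ⟨hself k, hk⟩) (le_iInf fun l => le_iInf fun hl => ?_)
    rw [houterB k l hl.1]
  have hKout : ∀ k, Q.s (e k) ∈ C → K (outer k) = U k := by
    intro k hk
    refine le_antisymm (iSup_le fun l => iSup_le fun hl => ?_) (le_iSup₂_of_le k ⟨hself k, hk⟩ le_rfl)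
    rw [houterB k l hl.1]
  have hKout' : ∀ k, Q.s (e k) ∉ C → K (outer k) = ⊥ := by
    intro k hk
    refine le_antisymm (iSup_le fun l => iSup_le fun hl => ?_) bot_le
    exact absurd hl.2 (by rwa [houterB k l hl.1])
  have hLout' : ∀ k, Q.s (e k) ∈ C → L (outer k) = ⊤ := by
    intro k hk
    refine le_antisymm le_top (le_iInf fun l => le_iInf fun hl => ?_)
    exact absurd hk (by rw [← houterB k l hl.1]; exact hl.2)
  have hmk : ∀ (x : Fin 4 → F) (hx : x ∈ L c), subquotientMk hL hK c ⟨x, hx⟩ = 0 ↔ x = 0 := by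
    intro x hx
    rw [subquotientMk_eq_zero, hKC c hc]
    simp
  have hnz : R.Nonzero := by
    refine ⟨c, subquotientMk hL hK c ⟨Pi.single 0 1, by simp [hLC c hc]⟩, ?_⟩
    rw [Ne, hmk]
    intro h0
    simpa using congrFun h0 0
  have hindec : R.Indec := by
    refine indec_of_idempotent hnz fun f hf => ?_
    obtain ⟨φ, hφc, hφ⟩ := exists_inducedAt f (hLC c hc) (hKC c hc)
    have step : ∀ a, (∀ k, a ≠ e k) → (InducedAt f φ (Q.s a) ↔ InducedAt f φ (Q.t a)) :=
      fun a ha => ⟨fun h => h.of_eq_target (hLeq a fun k hk => (ha k hk).elim),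
        fun h => h.of_eq_source (hKeq a fun k hk => (ha k hk).elim)⟩
    have hIC : ∀ v ∈ C, InducedAt f φ v := by
      intro v hv
      induction hC v hv with
      | refl => exact hφc
      | @tail u w _ huw ih =>
        obtain ⟨⟨a, ha⟩, hu, hw⟩ := huw
        have hne : ∀ k, a ≠ e k := by
          rintro k rfl
          rcases ha with ⟨rfl, rfl⟩ | ⟨rfl, rfl⟩ <;> rcases hb k with hb | hb <;> tauto
        have h1 := step a hne
        rcases ha with ⟨rfl, rfl⟩ | ⟨rfl, rfl⟩
        · exact h1.1 (ih hu)
        · exact h1.2 (ih hu)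
    have hIe : ∀ k, InducedAt f φ (Q.s (e k)) ∧ InducedAt f φ (Q.t (e k)) := by
      intro k
      rcases hb k with hb | hb
      · refine ⟨(hIC _ hb.1).of_eq_source (hKeq _ fun l hl => ?_), hIC _ hb.1⟩
        rw [← hl]; exact hb.2
      · refine ⟨hIC _ hb.1, (hIC _ hb.1).of_eq_target (hLeq _ fun l hl => ?_)⟩
        rw [← hl]; exact hb.1
    have hI : ∀ v, InducedAt f φ v := by
      intro v
      induction hQ.1 c v with
      | refl => exact hφc
      | @tail u w _ huw ih =>
        obtain ⟨a, ha⟩ := huw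
        by_cases hne : ∃ k, a = e k
        · obtain ⟨k, rfl⟩ := hne
          rcases ha with ⟨rfl, rfl⟩ | ⟨rfl, rfl⟩
          · exact (hIe k).2
          · exact (hIe k).1
        · push Not at hne
          have h1 := step a hne
          rcases ha with ⟨rfl, rfl⟩ | ⟨rfl, rfl⟩
          · exact h1.1 ih
          · exact h1.2 ih
    have hφU : ∀ k, ∀ x ∈ fourSubspaces F k, φ x ∈ fourSubspaces F k := by
      intro k x hx
      have hIo : InducedAt f φ (outer k) := hI _
      by_cases hs : Q.s (e k) ∈ C
      · have h1 := hIo ⟨x, by rw [hLout' k hs]; trivial⟩ 0 (by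
          rw [map_zero, subquotientMk_eq_zero.2 (by rw [hKout k hs]; exact hx), map_zero])
        rw [hKout k hs] at h1
        simpa using h1
      · have hx' : x ∈ L (outer k) := by rwa [hLout k hs]
        obtain ⟨y, hy⟩ := subquotientMk_surjective _
          (f.app _ (subquotientMk hL hK (outer k) ⟨x, hx'⟩))
        have h1 := hIo _ _ hy.symm
        rw [hKout' k hs, Submodule.mem_bot, sub_eq_zero] at h1
        have h2 : (y : Fin 4 → F) ∈ fourSubspaces F k := (hLout k hs).le y.2
        rwa [← h1] at h2
    rcases eq_zero_or_id_of_fourSubspaces φ hφU (hφ hf) with rfl | rfl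
    · left
      intro i z
      obtain ⟨x, rfl⟩ := subquotientMk_surjective (hL := hL) (hK := hK) _ z
      obtain ⟨y, hy⟩ := subquotientMk_surjective (hL := hL) (hK := hK) _
        (f.app _ (subquotientMk hL hK i x))
      have h1 := hI i _ _ hy.symm
      rw [← hy, subquotientMk_eq_zero]
      simpa using h1
    · right
      intro i z
      obtain ⟨x, rfl⟩ := subquotientMk_surjective (hL := hL) (hK := hK) _ z
      obtain ⟨y, hy⟩ := subquotientMk_surjective (hL := hL) (hK := hK) _
        (f.app _ (subquotientMk hL hK i x))
      have h1 := hI i _ _ hy.symm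
      rw [← hy, eq_comm, subquotientMk_eq]
      simpa using h1
  let N := subquotientEnd hL hK (fourNilpotent F)
    (fun v x hx => by
      simp only [L, Submodule.mem_iInf] at hx ⊢
      exact fun k hk => fourNilpotent_mem k x (hx k hk))
    (fun v => by
      change K v ≤ (K v).comap (fourNilpotent F)
      refine iSup_le fun k => iSup_le fun hk x hx => ?_
      exact (le_iSup₂_of_le (f := fun k (_ : v ∈ B k ∧ Q.s (e k) ∈ C) => U k) k hk le_rfl)
        (fourNilpotent_mem k x hx))
  have hN : ∀ (x : Fin 4 → F) (hx : x ∈ L c) (hx' : fourNilpotent F x ∈ L c),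
      N.app c (subquotientMk hL hK c ⟨x, hx⟩) = subquotientMk hL hK c ⟨fourNilpotent F x, hx'⟩ :=
    fun _ _ _ => rfl
  have htop : ∀ x, x ∈ L c := fun x => by simp [hLC c hc]
  have hiso := h.isIso_of_endo hindec hflei N (N.nonzero_iff.2
    ⟨c, subquotientMk hL hK c ⟨Pi.single 1 1, htop _⟩, by
      rw [hN _ _ (htop _), Ne, hmk]
      intro h0
      simpa [fourNilpotent] using congrFun h0 0⟩)
  have h0 := (hiso c).1 (a₁ := subquotientMk hL hK c ⟨Pi.single 0 1, htop _⟩) (a₂ := 0) (by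
    rw [hN _ _ (htop _), map_zero, hmk]
    ext i
    fin_cases i <;> simp [fourNilpotent])
  rw [hmk] at h0
  simpa using congrFun h0 0

namespace Subrep

variable {F : Type} [Field F] {Q : Quiv} {V B : QRep F Q}

theorem S_injective : Function.Injective (S : Subrep V → ∀ i, Submodule F (V.M i)) := by
  rintro ⟨S, _⟩ ⟨_, _⟩ rfl
  rfl

instance : PartialOrder (Subrep V) := PartialOrder.lift S S_injective

instance : Max (Subrep V) where
  max W X := ⟨fun i => W.S i ⊔ X.S i, fun a x hx => by
    obtain ⟨y, hy, z, hz, rfl⟩ := Submodule.mem_sup.1 hx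
    rw [map_add]
    exact Submodule.add_mem_sup (W.stable a y hy) (X.stable a z hz)⟩

instance : Min (Subrep V) where
  min W X := ⟨fun i => W.S i ⊓ X.S i, fun a x hx => ⟨W.stable a x hx.1, X.stable a x hx.2⟩⟩

instance : Top (Subrep V) where
  top := ⟨fun _ => ⊤, fun _ _ _ => trivial⟩

instance : Bot (Subrep V) where
  bot := ⟨fun _ => ⊥, fun a x hx => by
    rw [Submodule.mem_bot] at hx ⊢
    rw [hx, map_zero]⟩

instance : SupSet (Subrep V) where
  sSup T := ⟨fun i => ⨆ W ∈ T, W.S i, fun a => by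
    change (⨆ W ∈ T, W.S (Q.s a)) ≤ (⨆ W ∈ T, W.S (Q.t a)).comap (V.map a)
    exact iSup₂_le fun W hW x hx =>
      (le_iSup₂_of_le (f := fun (W : Subrep V) (_ : W ∈ T) => W.S (Q.t a)) W hW le_rfl)
        (W.stable a x hx)⟩

instance : InfSet (Subrep V) where
  sInf T := ⟨fun i => ⨅ W ∈ T, W.S i, fun a x hx => by
    simp only [Submodule.mem_iInf] at hx ⊢
    exact fun W hW => W.stable a x (hx W hW)⟩

instance : CompleteLattice (Subrep V) :=
  S_injective.completeLattice S Iff.rfl Iff.rfl (fun _ _ => rfl) (fun _ _ => rfl)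
    (fun T => funext fun i => by simp only [iSup_apply]; rfl)
    (fun T => funext fun i => by simp only [iInf_apply]; rfl) rfl rfl

theorem mem_sup {W X : Subrep V} {i : Q.V} {x : V.M i} :
    x ∈ (W ⊔ X).S i ↔ ∃ y ∈ W.S i, ∃ z ∈ X.S i, y + z = x :=
  Submodule.mem_sup

theorem mem_bot {i : Q.V} {x : V.M i} : x ∈ (⊥ : Subrep V).S i ↔ x = 0 :=
  Submodule.mem_bot F

theorem sSup_S (T : Set (Subrep V)) (i : Q.V) : (sSup T).S i = ⨆ W ∈ T, W.S i := rfl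

theorem mem_sInf {T : Set (Subrep V)} {i : Q.V} {x : V.M i} :
    x ∈ (sInf T).S i ↔ ∀ W ∈ T, x ∈ W.S i := by
  change x ∈ (⨅ W ∈ T, W.S i) ↔ _
  simp only [Submodule.mem_iInf]

instance : IsModularLattice (Subrep V) where
  sup_inf_le_assoc_of_le _ _ h i := IsModularLattice.sup_inf_le_assoc_of_le _ (h i)

/-- The subrepresentation generated by one vector. -/
def cyc {i : Q.V} (x : V.M i) : Subrep V := sInf {W | x ∈ W.S i}

theorem cyc_le {i : Q.V} {x : V.M i} {W : Subrep V} : cyc x ≤ W ↔ x ∈ W.S i :=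
  ⟨fun h => h i (mem_sInf.2 fun _ hX => hX), fun h => sInf_le h⟩

theorem mem_cyc {i : Q.V} (x : V.M i) : x ∈ (cyc x).S i := cyc_le.1 le_rfl

/-- Finitely generated subrepresentations. -/
inductive FG : Subrep V → Prop
  | bot : FG ⊥
  | sup_cyc (W : Subrep V) {i : Q.V} (x : V.M i) : FG W → FG (W ⊔ cyc x)

theorem fg_cyc {i : Q.V} (x : V.M i) : (cyc x).FG := by
  simpa using FG.bot.sup_cyc ⊥ x

theorem FG.sup {W X : Subrep V} (hW : W.FG) (hX : X.FG) : (W ⊔ X).FG := by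
  induction hX with
  | bot => simpa
  | sup_cyc X x _ ih => rw [← sup_assoc]; exact ih.sup_cyc _ x

/-- The image of a subrepresentation under a morphism. -/
def map (f : V.Hom B) (W : Subrep V) : Subrep B :=
  ⟨fun i => (W.S i).map (f.app i), by
    rintro a _ ⟨x, hx, rfl⟩
    exact ⟨_, W.stable a x hx, (f.comm_apply a x).symm⟩⟩

theorem mem_map_of_mem {f : V.Hom B} {W : Subrep V} {i : Q.V} {x : V.M i} (hx : x ∈ W.S i) :
    f.app i x ∈ (W.map f).S i :=
  ⟨x, hx, rfl⟩

/-- The preimage of a subrepresentation under a morphism. -/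
def comap (f : V.Hom B) (W : Subrep B) : Subrep V :=
  ⟨fun i => (W.S i).comap (f.app i), fun a x hx => by
    rw [Submodule.mem_comap, ← f.comm_apply]
    exact W.stable a _ hx⟩

theorem map_le_iff {f : V.Hom B} {W : Subrep V} {X : Subrep B} :
    W.map f ≤ X ↔ W ≤ X.comap f :=
  forall_congr' fun _ => Submodule.map_le_iff_le_comap

theorem map_sup (f : V.Hom B) (W X : Subrep V) : (W ⊔ X).map f = W.map f ⊔ X.map f :=
  S_injective (funext fun _ => Submodule.map_sup _ _ _)

theorem map_bot (f : V.Hom B) : (⊥ : Subrep V).map f = ⊥ :=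
  S_injective (funext fun _ => Submodule.map_bot _)

theorem map_cyc (f : V.Hom B) {i : Q.V} (x : V.M i) : (cyc x).map f = cyc (f.app i x) :=
  le_antisymm (map_le_iff.2 (cyc_le.2 (mem_cyc _))) (cyc_le.2 (mem_map_of_mem (mem_cyc x)))

theorem FG.map (f : V.Hom B) {W : Subrep V} (hW : W.FG) : (W.map f).FG := by
  induction hW with
  | bot => rw [map_bot]; exact .bot
  | sup_cyc X x _ ih => rw [map_sup, map_cyc]; exact ih.sup_cyc _ _

theorem FG.exists_map_eq (f : V.Hom B) {D : Subrep B} (hD : D.FG) (h : D ≤ (⊤ : Subrep V).map f) :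
    ∃ W : Subrep V, W.FG ∧ W.map f = D := by
  induction hD with
  | bot => exact ⟨⊥, .bot, map_bot f⟩
  | @sup_cyc D i x _ ih =>
    obtain ⟨W, hW, rfl⟩ := ih (le_sup_left.trans h)
    obtain ⟨y, -, rfl⟩ := cyc_le.1 (le_sup_right.trans h)
    exact ⟨_, hW.sup_cyc _ y, by rw [map_sup, map_cyc]⟩

theorem FG.exists_le_sup {D W Y : Subrep V} (hD : D.FG) (h : D ≤ W ⊔ Y) :
    ∃ W' ≤ W, W'.FG ∧ D ≤ W' ⊔ Y := by
  induction hD with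
  | bot => exact ⟨⊥, bot_le, .bot, bot_le⟩
  | @sup_cyc D i x _ ih =>
    obtain ⟨W', hW', hfg, hD⟩ := ih (le_sup_left.trans h)
    obtain ⟨w, hw, y, hy, rfl⟩ := mem_sup.1 (cyc_le.1 (le_sup_right.trans h))
    refine ⟨_, sup_le hW' (cyc_le.2 hw), hfg.sup_cyc _ w, sup_le (hD.trans ?_) (cyc_le.2 ?_)⟩
    · exact sup_le_sup_right le_sup_left _
    · exact mem_sup.2 ⟨w, mem_sup.2 ⟨0, zero_mem _, w, mem_cyc w, zero_add w⟩, y, hy, rfl⟩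

theorem mem_sSup_of_directed {T : Set (Subrep V)} (hT : T.Nonempty)
    (hd : DirectedOn (· ≤ ·) T) {i : Q.V} {x : V.M i} :
    x ∈ (sSup T).S i ↔ ∃ W ∈ T, x ∈ W.S i := by
  rw [sSup_S, ← sSup_image, Submodule.mem_sSup_of_directed (hT.image _)]
  · simp
  · rintro _ ⟨W, hW, rfl⟩ _ ⟨X, hX, rfl⟩
    obtain ⟨Y, hY, h1, h2⟩ := hd W hW X hX
    exact ⟨_, ⟨Y, hY, rfl⟩, h1 i, h2 i⟩

theorem FG.exists_le_of_le_sSup {T : Set (Subrep V)} (hT : T.Nonempty)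
    (hd : DirectedOn (· ≤ ·) T) {D : Subrep V} (hD : D.FG) (h : D ≤ sSup T) : ∃ W ∈ T, D ≤ W := by
  induction hD with
  | bot => obtain ⟨W, hW⟩ := hT; exact ⟨W, hW, bot_le⟩
  | @sup_cyc D i x _ ih =>
    obtain ⟨W, hW, h1⟩ := ih (le_sup_left.trans h)
    obtain ⟨X, hX, h2⟩ := (mem_sSup_of_directed hT hd).1 (cyc_le.1 (le_sup_right.trans h))
    obtain ⟨Y, hY, h3, h4⟩ := hd W hW X hX
    exact ⟨Y, hY, sup_le (h1.trans h3) (cyc_le.2 (h4 i h2))⟩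

/-- The inclusion of a subrepresentation. -/
def incl (W : Subrep V) : W.toRep.Hom V :=
  ⟨fun i => (W.S i).subtype, fun _ => rfl⟩

theorem incl_mem (W : Subrep V) {i : Q.V} (x : W.toRep.M i) : W.incl.app i x ∈ W.S i :=
  Subtype.property (p := fun y => y ∈ W.S i) x

theorem incl_injective (W : Subrep V) (i : Q.V) : Function.Injective (W.incl.app i) :=
  Subtype.val_injective

theorem exists_incl_eq (W : Subrep V) {i : Q.V} {y : V.M i} (hy : y ∈ W.S i) :
    ∃ x, W.incl.app i x = y :=
  ⟨⟨y, hy⟩, rfl⟩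

/-- A morphism whose values lie in a subrepresentation, as a morphism into it. -/
def codRestrict (W : Subrep V) (f : B.Hom V) (h : ∀ i x, f.app i x ∈ W.S i) : B.Hom W.toRep :=
  ⟨fun i => (f.app i).codRestrict (W.S i) (h i), fun a =>
    LinearMap.ext fun x => Subtype.ext (f.comm_apply a x)⟩

/-- The quotient morphism. -/
def mkQ (W : Subrep V) : V.Hom W.quot :=
  ⟨fun i => (W.S i).mkQ, fun _ => rfl⟩

theorem mkQ_surjective (W : Subrep V) (i : Q.V) : Function.Surjective (W.mkQ.app i) :=
  (W.S i).mkQ_surjective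

theorem mkQ_eq_zero (W : Subrep V) {i : Q.V} {x : V.M i} : W.mkQ.app i x = 0 ↔ x ∈ W.S i :=
  Submodule.Quotient.mk_eq_zero _

/-- The arrow map `a` restricts to a bijection on `W`. -/
def BijAt (W : Subrep V) (a : Q.A) : Prop :=
  (∀ x ∈ W.S (Q.s a), V.map a x = 0 → x = 0) ∧ ∀ y ∈ W.S (Q.t a), ∃ x ∈ W.S (Q.s a), V.map a x = y

theorem bijective_toRep_map (W : Subrep V) (a : Q.A) :
    Function.Bijective (W.toRep.map a) ↔ W.BijAt a := by
  refine and_congr ?_ ?_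
  · rw [injective_iff_map_eq_zero]
    constructor
    · exact fun h x hx h0 => congrArg Subtype.val (h ⟨x, hx⟩ (Subtype.ext h0))
    · exact fun h x hx => Subtype.ext (h _ x.2 (congrArg Subtype.val hx))
  · constructor
    · intro h y hy
      obtain ⟨x, hx⟩ := h ⟨y, hy⟩
      exact ⟨_, x.2, congrArg Subtype.val hx⟩
    · intro h y
      obtain ⟨x, hx, hxy⟩ := h _ y.2
      exact ⟨⟨x, hx⟩, Subtype.ext hxy⟩

theorem isFLEI_toRep {W : Subrep V} (h : ∀ i, FiniteDimensional F (W.S i))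
    (h' : {a | ¬ W.BijAt a}.Finite) : W.toRep.IsFLEI :=
  ⟨h, by simpa only [bijective_toRep_map] using h'⟩

/-- A locally finite-dimensional subrepresentation all of whose subrepresentations are finitely
generated and restrict to isomorphisms along all but finitely many arrows. -/
def Tame (Y : Subrep V) : Prop :=
  (∀ i, FiniteDimensional F (Y.S i)) ∧ ∀ W ≤ Y, W.FG ∧ {a | ¬ W.BijAt a}.Finite

theorem Tame.isFLEI {Y : Subrep V} (hY : Y.Tame) : Y.toRep.IsFLEI :=
  isFLEI_toRep hY.1 (hY.2 Y le_rfl).2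

theorem tame_bot : (⊥ : Subrep V).Tame := by
  refine ⟨fun i => inferInstanceAs (FiniteDimensional F (⊥ : Submodule F (V.M i))),
    fun W hW => ?_⟩
  obtain rfl := le_bot_iff.1 hW
  refine ⟨.bot, Set.finite_empty.subset fun a ha => ha ⟨fun x hx _ => mem_bot.1 hx, fun y hy => ?_⟩⟩
  exact ⟨0, zero_mem _, by rw [map_zero, mem_bot.1 hy]⟩

theorem Tame.sup {Y C : Subrep V} (hY : Y.Tame) (hC : C.Tame) : (Y ⊔ C).Tame := by
  refine ⟨fun i => ?_, fun W hW => ?_⟩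
  · have := hY.1 i
    have := hC.1 i
    exact Submodule.finiteDimensional_sup _ _
  have hWY := hY.2 (W ⊓ Y) inf_le_right
  have hD := hC.2 (C ⊓ (W ⊔ Y)) inf_le_left
  have hYC := hY.2 (Y ⊓ C) inf_le_left
  have key : ∀ {i} {w : V.M i}, w ∈ W.S i →
      ∃ y ∈ Y.S i, ∃ c ∈ (C ⊓ (W ⊔ Y)).S i, y + c = w := by
    intro i w hw
    obtain ⟨y, hy, c, hc, rfl⟩ := mem_sup.1 (hW i hw)
    exact ⟨y, hy, c, ⟨hc, mem_sup.2 ⟨y + c, hw, -y, neg_mem hy, by abel⟩⟩, rfl⟩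
  constructor
  · obtain ⟨W', hW', hfg, hle⟩ := hD.1.exists_le_sup inf_le_right
    have h1 : W ≤ W' ⊔ Y := fun i w hw => by
      obtain ⟨y, hy, c, hc, rfl⟩ := key hw
      obtain ⟨w', hw', y', hy', rfl⟩ := mem_sup.1 (hle i hc)
      exact mem_sup.2 ⟨w', hw', y' + y, add_mem hy' hy, by abel⟩
    have h2 : W = W' ⊔ (W ⊓ Y) := by
      refine le_antisymm ?_ (sup_le hW' inf_le_left)
      rw [inf_comm, ← sup_inf_assoc_of_le Y hW']
      exact le_inf h1 le_rfl
    rw [h2]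
    exact hfg.sup hWY.1
  · refine ((hWY.2.union hD.2).union hYC.2).subset fun a ha => ?_
    by_contra! hna
    simp only [Set.mem_union, Set.mem_ofPred_eq, not_or, not_not] at hna
    obtain ⟨⟨hb1, hb2⟩, hb3⟩ := hna
    refine ha ⟨fun x hx h0 => ?_, fun w hw => ?_⟩
    · obtain ⟨y, hy, c, hc, rfl⟩ := key hx
      rw [map_add] at h0
      have h1 : V.map a c ∈ (Y ⊓ C).S (Q.t a) := by
        refine ⟨?_, C.stable a c hc.1⟩
        rw [eq_neg_of_add_eq_zero_right h0]
        exact neg_mem (Y.stable a y hy)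
      obtain ⟨z, hz, hzc⟩ := hb3.2 _ h1
      have h2 : c = z := by
        refine sub_eq_zero.1 (hb2.1 _ (sub_mem hc ⟨hz.2, ?_⟩) (by rw [map_sub, hzc, sub_self]))
        exact mem_sup.2 ⟨0, zero_mem _, z, hz.1, zero_add z⟩
      exact hb1.1 _ ⟨hx, add_mem hy (h2 ▸ hz.1)⟩ (by rw [map_add, h0])
    · obtain ⟨y, hy, c, hc, rfl⟩ := key hw
      obtain ⟨c', hc', rfl⟩ := hb2.2 c hc
      obtain ⟨w', hw', y', hy', rfl⟩ := mem_sup.1 hc'.2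
      have h1 : y + V.map a y' ∈ (W ⊓ Y).S (Q.t a) := by
        refine ⟨?_, add_mem hy (Y.stable a y' hy')⟩
        have h2 := sub_mem hw (W.stable a w' hw')
        rwa [map_add, add_sub_assoc, add_sub_cancel_left] at h2
      obtain ⟨x, hx, hxy⟩ := hb1.2 _ h1
      refine ⟨w' + x, add_mem hw' hx.1, ?_⟩
      rw [map_add, hxy, map_add]
      abel

end Subrep

namespace Subrep

variable {F : Type} [Field F] {Q : Quiv} {V : QRep F Q}

/-- The images of `x` along directed paths. -/
inductive Gen {i : Q.V} (x : V.M i) : (Σ j, V.M j) → Prop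
  | base : Gen x ⟨i, x⟩
  | step (a : Q.A) (y : V.M (Q.s a)) : Gen x ⟨_, y⟩ → Gen x ⟨_, V.map a y⟩

theorem Gen.reach {i : Q.V} {x : V.M i} {p : Σ j, V.M j} (h : Gen x p) : Q.Reach i p.1 := by
  induction h with
  | base => exact .refl
  | step a y _ ih => exact ih.step a

theorem Gen.unique (hQ : Q.NoCycles) {i : Q.V} {x : V.M i} {p : Σ j, V.M j} (hp : Gen x p) :
    ∀ q, Gen x q → p.1 = q.1 → p = q := by
  induction hp with
  | base =>
    rintro q (_ | ⟨a, y, hy⟩) h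
    · rfl
    · have h' : i = Q.t a := h
      exact absurd (h' ▸ hy.reach) (hQ.not_reach a)
  | step a y hy ih =>
    rintro q (_ | ⟨b, z, hz⟩) h
    · have h' : Q.t a = i := h
      exact absurd (h' ▸ hy.reach) (hQ.not_reach a)
    · obtain rfl := hQ.eq_of_reach hy.reach hz.reach h
      have := ih _ hz rfl
      rw [Sigma.mk.injEq, heq_eq_eq] at this
      rw [this.2]

/-- In a quiver without cycles a vector has at most one image at each vertex. -/
theorem exists_transport (hQ : Q.NoCycles) {i : Q.V} (x : V.M i) :
    ∃ tr : ∀ j, V.M j, tr i = x ∧ (∀ j, ¬ Q.Reach i j → tr j = 0) ∧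
      ∀ a, Q.Reach i (Q.s a) → tr (Q.t a) = V.map a (tr (Q.s a)) := by
  have hex : ∀ j, ∃ y : V.M j, (Q.Reach i j → Gen x ⟨j, y⟩) ∧ (¬ Q.Reach i j → y = 0) := by
    intro j
    by_cases hj : Q.Reach i j
    · have : ∃ y, Gen x ⟨j, y⟩ := by
        induction hj with
        | refl => exact ⟨x, .base⟩
        | tail _ h ih =>
          obtain ⟨a, rfl, rfl⟩ := h
          obtain ⟨y, hy⟩ := ih
          exact ⟨_, hy.step a y⟩
      exact this.imp fun y hy => ⟨fun _ => hy, fun h => absurd hj h⟩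
    · exact ⟨0, fun h => absurd h hj, fun _ => rfl⟩
  choose tr h1 h2 using hex
  have key : ∀ {j} {y z : V.M j}, Gen x ⟨j, y⟩ → Gen x ⟨j, z⟩ → y = z := fun hy hz => by
    have := hy.unique hQ _ hz rfl
    rwa [Sigma.mk.injEq, heq_eq_eq, and_iff_right rfl] at this
  exact ⟨tr, key (h1 i .refl) .base, h2, fun a ha => key (h1 _ (ha.step a)) ((h1 _ ha).step a _)⟩

theorem exists_fg_of_finite {T : Set (Σ i, V.M i)} (hT : T.Finite) :
    ∃ W : Subrep V, W.FG ∧ ∀ X, W ≤ X ↔ ∀ p ∈ T, p.2 ∈ X.S p.1 := by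
  induction T, hT using Set.Finite.induction_on with
  | empty => exact ⟨⊥, .bot, by simp⟩
  | @insert p T _ _ ih =>
    obtain ⟨W, hW, h⟩ := ih
    exact ⟨_, hW.sup_cyc _ p.2, fun X => by simp [sup_le_iff, h, cyc_le, and_comm]⟩

end Subrep

open QRep in
theorem Quiv.IsTree.boundary_finite_of_reach {F : Type} [Field F] {Q : Quiv} (hQ : Q.IsTree)
    (h : NoChain F Q) {C : Set Q.V} {i : Q.V} (hC : ∀ j ∈ C, Q.Reach i j)
    (hC' : ∀ a, Q.Reach i (Q.s a) → Q.t a ∈ C → Q.s a ∈ C) :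
    {a : Q.A | (Q.t a ∈ C ∧ Q.s a ∉ C) ∨ (Q.s a ∈ C ∧ Q.t a ∉ C)}.Finite := by
  have key : ∀ v, Q.Reach i v → v ∈ C →
      i ∈ C ∧ Relation.ReflTransGen (fun u w => Q.Adj u w ∧ u ∈ C ∧ w ∈ C) i v := by
    intro v hv
    induction hv with
    | refl => exact fun h => ⟨h, .refl⟩
    | tail hu h ih =>
      obtain ⟨a, rfl, rfl⟩ := h
      intro ha
      have h1 := hC' a hu ha
      exact ⟨(ih h1).1, (ih h1).2.tail ⟨⟨a, Or.inl ⟨rfl, rfl⟩⟩, h1, ha⟩⟩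
  by_cases hi : i ∈ C
  · exact hQ.boundary_finite h hi fun v hv => (key v (hC v hv) hv).2
  · refine Set.finite_empty.subset fun a ha => ?_
    rcases ha with ha | ha
    · exact hi (key _ (hC _ ha.1) ha.1).1
    · exact hi (key _ (hC _ ha.1) ha.1).1

namespace Subrep

variable {F : Type} [Field F] {Q : Quiv} {V : QRep F Q}

theorem tame_cyc (hQ : Q.IsTree) (h : QRep.NoChain F Q) {i : Q.V} (x : V.M i) :
    (cyc x).Tame := by
  obtain ⟨tr, htr, htr0, htrs⟩ := exists_transport hQ.2 x
  let X : Subrep V := ⟨fun j => F ∙ tr j, fun a y hy => by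
    obtain ⟨c, rfl⟩ := Submodule.mem_span_singleton.1 hy
    by_cases ha : Q.Reach i (Q.s a)
    · rw [map_smul, ← htrs a ha]
      exact Submodule.smul_mem _ _ (Submodule.mem_span_singleton_self _)
    · rw [htr0 _ ha, smul_zero, map_zero]
      exact zero_mem _⟩
  have hX : cyc x ≤ X := cyc_le.2 (by
    change x ∈ F ∙ tr i
    rw [htr]
    exact Submodule.mem_span_singleton_self _)
  refine ⟨fun j => ?_, fun W hW => ?_⟩
  · have : FiniteDimensional F (X.S j) := inferInstanceAs (FiniteDimensional F (F ∙ tr j))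
    exact Submodule.finiteDimensional_of_le (hX j)
  have hmul : ∀ {j} {w : V.M j}, w ∈ W.S j → w = 0 ∨ tr j ∈ W.S j ∧ ∃ c : F, w = c • tr j := by
    intro j w hw
    obtain ⟨c, rfl⟩ := Submodule.mem_span_singleton.1 (hX j (hW j hw))
    by_cases hc : c = 0
    · simp [hc]
    · exact Or.inr ⟨((W.S j).smul_mem_iff hc).1 hw, c, rfl⟩
  have fT := hQ.boundary_finite_of_reach h (C := {j | Q.Reach i j}) (fun _ h => h)
    (fun a h _ => h)
  have fD := hQ.boundary_finite_of_reach h (i := i) (C := {j | Q.Reach i j ∧ tr j ∉ W.S j})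
    (fun _ h => h.1) (fun a ha hta => ⟨ha, fun hs => hta.2 (htrs a ha ▸ W.stable a _ hs)⟩)
  have fD' := hQ.boundary_finite_of_reach h (i := i) (C := {j | Q.Reach i j ∧ tr j ≠ 0})
    (fun _ h => h.1) (fun a ha hta => ⟨ha, fun hs => hta.2 (by rw [htrs a ha, hs, map_zero])⟩)
  constructor
  · obtain ⟨G, hG, hGle⟩ := exists_fg_of_finite (V := V)
      (T := {p | p = ⟨i, x⟩ ∧ x ∈ W.S i} ∪ (fun a => ⟨Q.t a, tr (Q.t a)⟩) '' {a | Q.Reach i (Q.s a) ∧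
        tr (Q.s a) ∉ W.S (Q.s a) ∧ tr (Q.t a) ∈ W.S (Q.t a)})
      (((Set.finite_singleton _).subset fun p hp => hp.1).union
        ((fD.subset fun a ha => Or.inr ⟨⟨ha.1, ha.2.1⟩, fun h' => h'.2 ha.2.2⟩).image _))
    have hGW : G ≤ W := by
      rw [hGle]
      rintro p (⟨rfl, hp⟩ | ⟨a, ha, rfl⟩)
      · exact hp
      · exact ha.2.2
    have hmem := (hGle G).1 le_rfl
    have htrG : ∀ j, Q.Reach i j → tr j ∈ W.S j → tr j ∈ G.S j := by
      intro j hj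
      induction hj with
      | refl => rw [htr]; exact fun hx => hmem ⟨i, x⟩ (Or.inl ⟨rfl, hx⟩)
      | tail hu h' ih =>
        obtain ⟨a, rfl, rfl⟩ := h'
        intro hta
        by_cases hs : tr (Q.s a) ∈ W.S (Q.s a)
        · rw [htrs a hu]
          exact G.stable a _ (ih hs)
        · exact hmem _ (Or.inr ⟨a, ⟨hu, hs, hta⟩, rfl⟩)
    have : W = G := by
      refine le_antisymm (fun j w hw => ?_) hGW
      rcases hmul hw with rfl | ⟨hj, c, rfl⟩
      · exact zero_mem _
      · refine Submodule.smul_mem _ _ ?_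
        by_cases hr : Q.Reach i j
        · exact htrG j hr hj
        · rw [htr0 j hr]
          exact zero_mem _
    rwa [this]
  · refine ((fT.union fD).union fD').subset fun a ha => ?_
    by_contra! hna
    simp only [Set.mem_union, Set.mem_ofPred_eq, not_or] at hna
    obtain ⟨⟨nT, nD⟩, nD'⟩ := hna
    refine ha ?_
    by_cases hs : Q.Reach i (Q.s a)
    · have ht := hs.step a
      have hst := htrs a hs
      simp only [hs, ht, true_and] at nD nD'
      have e1 : tr (Q.s a) ∈ W.S _ ↔ tr (Q.t a) ∈ W.S _ := by clear * - nD; tauto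
      have e2 : tr (Q.s a) = 0 ↔ tr (Q.t a) = 0 := by clear * - nD'; tauto
      constructor
      · intro y hy h0
        rcases hmul hy with rfl | ⟨hj, c, rfl⟩
        · rfl
        · rw [map_smul, ← hst, smul_eq_zero, ← e2, ← smul_eq_zero] at h0
          exact h0
      · intro y hy
        rcases hmul hy with rfl | ⟨hj, c, rfl⟩
        · exact ⟨0, zero_mem _, map_zero _⟩
        · exact ⟨c • tr (Q.s a), Submodule.smul_mem _ _ (e1.2 hj), by rw [map_smul, hst]⟩
    · have ht : ¬ Q.Reach i (Q.t a) := by clear * - nT hs; tauto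
      constructor
      · intro y hy h0
        rcases hmul hy with rfl | ⟨hj, c, rfl⟩
        · rfl
        · rw [htr0 _ hs, smul_zero]
      · intro y hy
        refine ⟨0, zero_mem _, ?_⟩
        rcases hmul hy with rfl | ⟨hj, c, rfl⟩
        · exact map_zero _
        · rw [htr0 _ ht, smul_zero, map_zero]

theorem FG.tame (hQ : Q.IsTree) (h : QRep.NoChain F Q) {W : Subrep V} (hW : W.FG) : W.Tame := by
  induction hW with
  | bot => exact tame_bot
  | sup_cyc W x _ ih => exact ih.sup (tame_cyc hQ h x)

end Subrep

namespace QRep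

variable {F : Type} [Field F] {Q : Quiv}

theorem eq_zero_of_vanishing (hQ : Q.Connected) {B : QRep F Q} {T : Set Q.V} {v : Q.V}
    (hv : v ∈ T) (hT : ∀ a, ¬ Function.Bijective (B.map a) → Q.s a ∈ T ∧ Q.t a ∈ T)
    (h0 : ∀ u ∈ T, ∀ x : B.M u, x = 0) (w : Q.V) (x : B.M w) : x = 0 := by
  revert x
  induction hQ v w with
  | refl => exact h0 v hv
  | @tail u w _ huw ih =>
    obtain ⟨a, ha⟩ := huw
    by_cases hb : Function.Bijective (B.map a)
    · rcases ha with ⟨rfl, rfl⟩ | ⟨rfl, rfl⟩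
      · intro x
        obtain ⟨y, rfl⟩ := hb.2 x
        rw [ih y, map_zero]
      · exact fun x => hb.1 ((ih _).trans (map_zero _).symm)
    · rcases ha with ⟨rfl, rfl⟩ | ⟨rfl, rfl⟩
      · exact h0 _ (hT a hb).2
      · exact h0 _ (hT a hb).1

theorem bijective_map_of_retract {A Y : QRep F Q} (i : A.Hom Y) (p : Y.Hom A)
    (h : ∀ v x, p.app v (i.app v x) = x) {a : Q.A} (ha : Function.Bijective (Y.map a)) :
    Function.Bijective (A.map a) := by
  constructor
  · rw [injective_iff_map_eq_zero]
    intro x hx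
    have h1 : i.app _ x = 0 := ha.1 (by rw [i.comm_apply, hx, map_zero, map_zero])
    rw [← h _ x, h1, map_zero]
  · intro y
    obtain ⟨z, hz⟩ := ha.2 (i.app _ y)
    exact ⟨p.app _ z, by rw [p.comm_apply, hz, h]⟩

theorem exists_indec_retract_aux (hQ : Q.Connected) {T : Finset Q.V} {v : Q.V} (hv : v ∈ T)
    (n : ℕ) {X Y : QRep F Q} (hfd : ∀ i, FiniteDimensional F (Y.M i))
    (hT : ∀ a, ¬ Function.Bijective (Y.map a) → Q.s a ∈ T ∧ Q.t a ∈ T)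
    (hn : ∑ u ∈ T, Module.finrank F (Y.M u) < n) (f : X.Hom Y) (hf : f.Nonzero) :
    ∃ (Z : QRep F Q) (i : Z.Hom Y) (p : Y.Hom Z), (∀ v x, p.app v (i.app v x) = x) ∧
      Z.Indec ∧ (p.comp f).Nonzero := by
  induction n generalizing Y with
  | zero => simp at hn
  | succ n ih =>
    by_cases hY : Y.Indec
    · exact ⟨Y, Hom.id Y, Hom.id Y, fun _ _ => rfl, hY, hf⟩
    obtain ⟨v, x, hx⟩ := f.nonzero_iff.1 hf
    have hdec : ∃ A B : QRep F Q, A.Nonzero ∧ B.Nonzero ∧ Iso Y (dsum A B) := by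
      by_contra! hne
      exact hY ⟨⟨v, _, hx⟩, hne⟩
    obtain ⟨A, B, hA, hB, φ, hφ⟩ := hdec
    have key : ∀ (A B : QRep F Q) (iA : A.Hom Y) (pA : Y.Hom A) (iB : B.Hom Y) (pB : Y.Hom B),
        (∀ v x, pA.app v (iA.app v x) = x) → (∀ v x, pB.app v (iB.app v x) = x) →
        (∀ v x, pA.app v (iB.app v x) = 0) → B.Nonzero → (pA.comp f).Nonzero →
        ∃ (Z : QRep F Q) (i : Z.Hom Y) (p : Y.Hom Z), (∀ v x, p.app v (i.app v x) = x) ∧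
          Z.Indec ∧ (p.comp f).Nonzero := by
      intro A B iA pA iB pB h1 h2 h3 hB hfA
      have hsurj : ∀ v, Function.Surjective (pA.app v) := fun v x => ⟨_, h1 v x⟩
      have hlt : ∑ u ∈ T, Module.finrank F (A.M u) < ∑ u ∈ T, Module.finrank F (Y.M u) := by
        refine Finset.sum_lt_sum (fun u _ => ?_) ?_
        · have := hfd u
          exact LinearMap.finrank_le_finrank_of_surjective (hsurj u)
        · by_contra! hne
          obtain ⟨w, x, hx⟩ := hB
          refine hx (eq_zero_of_vanishing hQ (T := ↑T) hv (fun a ha => hT a fun hb =>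
            ha (bijective_map_of_retract iB pB h2 hb)) (fun u hu y => ?_) w x)
          have := hfd u
          have h4 := hne u hu
          have h5 := LinearMap.finrank_range_add_finrank_ker (pA.app u)
          rw [LinearMap.range_eq_top.2 (hsurj u), finrank_top] at h5
          have h6 : LinearMap.ker (pA.app u) = ⊥ := Submodule.finrank_eq_zero.1 (by omega)
          rw [← h2 u y, LinearMap.ker_eq_bot'.1 h6 _ (h3 u y), map_zero]
      obtain ⟨Z, i, p, hip, hZ, hpf⟩ := ih (Y := A)
        (fun v => have := hfd v; Module.Finite.of_surjective _ (hsurj v))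
        (fun a ha => hT a fun hb => ha (bijective_map_of_retract iA pA h1 hb)) (by omega)
        (pA.comp f) hfA
      exact ⟨Z, iA.comp i, p.comp pA, fun v x => by simp [h1, hip], hZ, hpf⟩
    by_cases hx1 : (Hom.fst A B).app v (φ.app v (f.app v x)) = 0
    · refine key B A ((φ.inv hφ).comp (.inr A B)) ((Hom.snd A B).comp φ)
        ((φ.inv hφ).comp (.inl A B)) ((Hom.fst A B).comp φ) (by simp) (by simp) (by simp) hA ?_
      refine (Hom.nonzero_iff _).2 ⟨v, x, fun hx2 => hx ((hφ v).1 ?_)⟩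
      exact Hom.dsum_ext (by rw [hx1, map_zero, map_zero]) (hx2.trans (by rw [map_zero, map_zero]))
    · exact key A B ((φ.inv hφ).comp (.inl A B)) ((Hom.fst A B).comp φ)
        ((φ.inv hφ).comp (.inr A B)) ((Hom.snd A B).comp φ) (by simp) (by simp) (by simp) hB
        ((Hom.nonzero_iff _).2 ⟨v, x, hx1⟩)

/-- A nonzero morphism to an FLEI representation is detected by an indecomposable direct
summand of the target. -/
theorem exists_indec_retract (hQ : Q.Connected) {X Y : QRep F Q} (hY : Y.IsFLEI)
    (f : X.Hom Y) (hf : f.Nonzero) :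
    ∃ (Z : QRep F Q) (i : Z.Hom Y) (p : Y.Hom Z), (∀ v x, p.app v (i.app v x) = x) ∧
      Z.Indec ∧ Z.IsFLEI ∧ (p.comp f).Nonzero := by
  classical
  obtain ⟨v, -⟩ := id hf
  obtain ⟨Z, i, p, hip, hZ, hpf⟩ := exists_indec_retract_aux hQ
    (T := insert v (hY.2.toFinset.image Q.s ∪ hY.2.toFinset.image Q.t)) (v := v) (by simp) _
    hY.1 (fun a ha => by
      have : a ∈ hY.2.toFinset := hY.2.mem_toFinset.2 ha
      constructor <;> simp only [Finset.mem_insert, Finset.mem_union, Finset.mem_image]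
      · exact Or.inr (Or.inl ⟨a, this, rfl⟩)
      · exact Or.inr (Or.inr ⟨a, this, rfl⟩)) (Nat.lt_succ_self _) f hf
  refine ⟨Z, i, p, hip, hZ, ⟨fun v => ?_, hY.2.subset fun a ha hb => ha ?_⟩, hpf⟩
  · have := hY.1 v
    exact Module.Finite.of_surjective (p.app v) fun x => ⟨_, hip v x⟩
  · exact bijective_map_of_retract i p hip hb

end QRep

theorem exists_functional_of_finite {F H ι : Type*} [Field F] [AddCommGroup H] [Module F H]
    (v : ι → H) (b : ι → F) (h : ∀ s : Finset ι, ∃ φ : H →ₗ[F] F, ∀ j ∈ s, φ (v j) = b j) :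
    ∃ φ : H →ₗ[F] F, ∀ j, φ (v j) = b j := by
  let f := Finsupp.linearCombination F v
  let g := Finsupp.linearCombination F b
  have hker : LinearMap.ker f ≤ LinearMap.ker g := by
    intro c hc
    obtain ⟨φ, hφ⟩ := h c.support
    rw [LinearMap.mem_ker] at hc ⊢
    have h1 : φ (f c) = g c := by
      simp only [f, g, Finsupp.linearCombination_apply, Finsupp.sum, map_sum, map_smul]
      exact Finset.sum_congr rfl fun j hj => by rw [hφ j hj]
    rw [← h1, hc, map_zero]
  obtain ⟨φ, hφ⟩ := LinearMap.exists_extend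
    ((LinearMap.ker f).liftQ g hker ∘ₗ f.quotKerEquivRange.symm.toLinearMap)
  refine ⟨φ, fun j => ?_⟩
  have h1 := LinearMap.congr_fun hφ (f.quotKerEquivRange (Submodule.Quotient.mk (Finsupp.single j 1)))
  simp only [LinearMap.comp_apply, LinearEquiv.coe_coe, LinearEquiv.symm_apply_apply,
    Submodule.liftQ_apply, Submodule.subtype_apply, LinearMap.quotKerEquivRange_apply_mk] at h1
  simpa [f, g] using h1

namespace QRep

variable {F : Type} [Field F] {Q : Quiv}

open scoped TensorProduct DirectSum in
/-- A morphism from a locally finite-dimensional representation splits as soon as it splits over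
all finitely generated subrepresentations containing its image. -/
theorem exists_retraction {X M : QRep F Q} (hX : ∀ i, FiniteDimensional F (X.M i)) (g : X.Hom M)
    (hg : ((⊤ : Subrep X).map g).FG)
    (H : ∀ Y : Subrep M, Y.FG → (⊤ : Subrep X).map g ≤ Y →
      ∃ r : Y.toRep.Hom X, ∀ i x y, Y.incl.app i y = g.app i x → r.app i y = x) :
    ∃ r : M.Hom X, ∀ i x, r.app i (g.app i x) = x := by
  classical
  let E := ⨁ i, M.M i ⊗[F] Module.Dual F (X.M i)
  let ι := (Σ i, X.M i × Module.Dual F (X.M i)) ⊕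
    (Σ a, M.M (Q.s a) × Module.Dual F (X.M (Q.t a)))
  let δ : ∀ i, M.M i ⊗[F] Module.Dual F (X.M i) →ₗ[F] E := fun i =>
    DirectSum.lof F Q.V (fun i => M.M i ⊗[F] Module.Dual F (X.M i)) i
  let v : ι → E := Sum.elim (fun p => δ p.1 (g.app p.1 p.2.1 ⊗ₜ p.2.2))
    (fun p => δ _ (M.map p.1 p.2.1 ⊗ₜ p.2.2) - δ _ (p.2.1 ⊗ₜ (p.2.2 ∘ₗ X.map p.1)))
  let b : ι → F := Sum.elim (fun p => p.2.2 p.2.1) fun _ => 0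
  let w : ι → Σ i, M.M i := Sum.elim (fun p => ⟨p.1, 0⟩) fun p => ⟨Q.s p.1, p.2.1⟩
  obtain ⟨Λ, hΛ⟩ := exists_functional_of_finite v b fun s => by
    obtain ⟨G, hG, hGle⟩ := Subrep.exists_fg_of_finite (V := M)
      (T := w '' s) (s.finite_toSet.image _)
    have hmem := (hGle G).1 le_rfl
    obtain ⟨r, hr⟩ := H (((⊤ : Subrep X).map g) ⊔ G) (hg.sup hG) le_sup_left
    have hρ : ∀ i, ∃ ρ : M.M i →ₗ[F] X.M i,
        ∀ y, ρ ((((⊤ : Subrep X).map g) ⊔ G).incl.app i y) = r.app i y := fun i => by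
      obtain ⟨ρ, hρ⟩ := LinearMap.exists_extend (V := M.M i)
        (p := (((⊤ : Subrep X).map g) ⊔ G).S i) (r.app i)
      exact ⟨ρ, LinearMap.congr_fun hρ⟩
    choose ρ hρ using hρ
    refine ⟨DirectSum.toModule F _ F fun i => TensorProduct.lift
      (Module.Dual.eval F (X.M i) ∘ₗ ρ i), ?_⟩
    have hδ : ∀ i (m : M.M i) (φ : Module.Dual F (X.M i)),
        DirectSum.toModule F _ F (fun i => TensorProduct.lift
          (Module.Dual.eval F (X.M i) ∘ₗ ρ i)) (δ i (m ⊗ₜ φ)) = φ (ρ i m) := by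
      intro i m φ
      refine (DirectSum.toModule_lof F (M := fun i => M.M i ⊗[F] Module.Dual F (X.M i)) i _).trans ?_
      simp
    rintro (⟨i, x, φ⟩ | ⟨a, m, φ⟩) hj
    · obtain ⟨y, hy⟩ := Subrep.exists_incl_eq (((⊤ : Subrep X).map g) ⊔ G) (i := i)
        ((le_sup_left : (⊤ : Subrep X).map g ≤ _) i (Subrep.mem_map_of_mem (x := x) trivial))
      refine (hδ _ _ _).trans ?_
      rw [← hy, hρ, hr i x y hy]
      rfl
    · have hmG : m ∈ G.S (Q.s a) := hmem ⟨Q.s a, m⟩ ⟨_, hj, rfl⟩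
      obtain ⟨y, hy⟩ := Subrep.exists_incl_eq (((⊤ : Subrep X).map g) ⊔ G)
        ((le_sup_right : G ≤ (⊤ : Subrep X).map g ⊔ G) _ hmG)
      refine (map_sub _ _ _).trans ?_
      refine (congrArg₂ _ (hδ _ _ _) (hδ _ _ _)).trans ?_
      rw [← hy, Hom.comm_apply, hρ, hρ, ← r.comm_apply]
      exact sub_self _
  let ev : ∀ i, X.M i ≃ₗ[F] Module.Dual F (Module.Dual F (X.M i)) := fun i =>
    have := hX i
    Module.evalEquiv F (X.M i)
  let ρ : ∀ i, M.M i →ₗ[F] X.M i := fun i =>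
    (ev i).symm.toLinearMap ∘ₗ TensorProduct.curry (Λ ∘ₗ δ i)
  have hρ : ∀ i (m : M.M i) (φ : Module.Dual F (X.M i)), φ (ρ i m) = Λ (δ i (m ⊗ₜ φ)) := by
    intro i m φ
    have := hX i
    exact Module.apply_evalEquiv_symm_apply (R := F) (M := X.M i) φ _
  have hdual : ∀ i (x y : X.M i), (∀ φ : Module.Dual F (X.M i), φ x = φ y) → x = y :=
    fun i x y h => (ev i).injective (LinearMap.ext h)
  refine ⟨Hom.mk' ρ fun a m => hdual _ _ _ fun φ => ?_, fun i x => hdual _ _ _ fun φ => ?_⟩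
  · rw [hρ]
    have h1 := hΛ (Sum.inr ⟨a, m, φ⟩)
    have h2 : Λ (δ _ (M.map a m ⊗ₜ φ)) = Λ (δ _ (m ⊗ₜ (φ ∘ₗ X.map a))) :=
      sub_eq_zero.1 ((map_sub Λ _ _).symm.trans h1)
    rw [h2, ← hρ]
    rfl
  · exact (hρ i _ φ).trans (hΛ (Sum.inl ⟨i, x, φ⟩))

end QRep

namespace QRep

variable {F : Type} [Field F] {Q : Quiv}

/-- Every nonzero representation has an indecomposable FLEI direct summand. -/
theorem exists_indec_summand (hQ : Q.IsTree) (h : NoChain F Q) {M : QRep F Q} (hM : M.Nonzero) :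
    ∃ (X : QRep F Q) (g : X.Hom M) (r : M.Hom X), X.Indec ∧ X.IsFLEI ∧
      ((⊤ : Subrep X).map g).FG ∧ ∀ i x, r.app i (g.app i x) = x := by
  by_contra! hno
  let P : (Σ X : QRep F Q, X.Hom M) → Prop := fun p =>
    p.1.Indec ∧ p.1.IsFLEI ∧ p.2.Nonzero ∧ ((⊤ : Subrep p.1).map p.2).FG
  have hP : ∀ {Y : Subrep M} (_ : Y.FG) {Z : QRep F Q} (i : Z.Hom Y.toRep) (p : Y.toRep.Hom Z),
      (∀ v x, p.app v (i.app v x) = x) → Z.Indec → Z.IsFLEI → P ⟨Z, Y.incl.comp i⟩ := by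
    intro Y hY Z i p hip hZ hZ'
    refine ⟨hZ, hZ', ?_, ((hY.tame hQ h).2 _ ?_).1⟩
    · obtain ⟨v, z, hz⟩ := hZ.1
      refine (Hom.nonzero_iff _).2 ⟨v, z, fun h0 => hz ?_⟩
      have h1 : i.app v z = 0 := Y.incl_injective v (h0.trans (map_zero _).symm)
      rw [← hip v z, h1, map_zero]
    · rw [Subrep.map_le_iff]
      exact fun v x _ => Y.incl_mem _
  have base : ∃ p, P p := by
    obtain ⟨v, x, hx⟩ := hM
    have hY := Subrep.fg_cyc x
    obtain ⟨y, hy⟩ := (Subrep.cyc x).exists_incl_eq (Subrep.mem_cyc x)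
    obtain ⟨Z, i, p, hip, hZ, hZ', -⟩ := exists_indec_retract hQ.1 (hY.tame hQ h).isFLEI
      (Hom.id _) ((Hom.nonzero_iff _).2 ⟨v, y, fun h0 => hx (by
        rw [← hy, show y = 0 from h0, map_zero])⟩)
    exact ⟨_, hP hY i p hip hZ hZ'⟩
  have step : ∀ p : {p // P p}, ∃ (q : {p // P p}) (f : p.1.1.Hom q.1.1), f.Nonzero ∧ ¬ f.IsIso := by
    rintro ⟨⟨X, g⟩, hX, hX', hg, hfg⟩
    by_contra! hq
    have hr : ∃ r : M.Hom X, ∀ i x, r.app i (g.app i x) = x := by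
      refine exists_retraction hX'.1 g hfg fun Y hY hle => ?_
      let f : X.Hom Y.toRep := Y.codRestrict g fun i x => hle i (Subrep.mem_map_of_mem trivial)
      have hf : f.Nonzero := by
        obtain ⟨i, x, hx⟩ := g.nonzero_iff.1 hg
        refine f.nonzero_iff.2 ⟨i, x, fun h0 => hx ?_⟩
        exact (congrArg (Y.incl.app i) h0).trans (map_zero _)
      obtain ⟨Z, i, p, hip, hZ, hZ', hpf⟩ := exists_indec_retract hQ.1 (hY.tame hQ h).isFLEI f hf
      have hiso := hq ⟨_, hP hY i p hip hZ hZ'⟩ (p.comp f) hpf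
      refine ⟨((p.comp f).inv hiso).comp p, fun j x y hxy => ?_⟩
      obtain rfl : y = f.app j x := Y.incl_injective j hxy
      exact (p.comp f).inv_app_app hiso j x
    obtain ⟨r, hr⟩ := hr
    obtain ⟨i, x, hx⟩ := hno X g r hX hX' hfg
    exact hx (hr i x)
  choose next f hf using step
  obtain ⟨p₀, hp₀⟩ := base
  let W : ℕ → {p // P p} := fun n => Nat.rec ⟨p₀, hp₀⟩ (fun _ => next) n
  exact h ⟨fun n => (W n).1.1, fun n => f (W n), fun n => ⟨(W n).2.1, (W n).2.2.1⟩,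
    fun n => hf (W n)⟩

end QRep

theorem sSupIndep.insert_of_disjoint {α : Type*} [CompleteLattice α] [IsModularLattice α]
    {T : Set α} (hT : sSupIndep T) {z : α} (hz : Disjoint z (sSup T)) : sSupIndep (insert z T) := by
  intro w hw
  by_cases hwz : w = z
  · subst hwz
    refine hz.mono_right (sSup_le_sSup ?_)
    rintro x ⟨rfl | hx, hxw⟩
    · exact absurd rfl hxw
    · exact hx
  · have hwT : w ∈ T := hw.resolve_left hwz
    rw [Set.insert_sdiff_of_notMem _ (fun h => hwz (Set.mem_singleton_iff.1 h).symm), sSup_insert,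
      sup_comm]
    refine (hT hwT).disjoint_sup_right_of_disjoint_sup_left (hz.symm.mono_left ?_)
    exact sup_le (le_sSup hwT) (sSup_le_sSup Set.sdiff_subset)

namespace Subrep

open QRep

variable {F : Type} [Field F] {Q : Quiv} {V : QRep F Q}

instance : IsCompactlyGenerated (Subrep V) where
  exists_sSup_eq W := by
    refine ⟨{X | ∃ i, ∃ x ∈ W.S i, X = cyc x}, ?_, le_antisymm (sSup_le ?_) fun i x hx => ?_⟩
    · rintro _ ⟨i, x, -, rfl⟩
      rw [CompleteLattice.isCompactElement_iff_le_of_directed_sSup_le]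
      exact fun T hT hd hle => (fg_cyc x).exists_le_of_le_sSup hT hd hle
    · rintro _ ⟨i, x, hx, rfl⟩
      exact cyc_le.2 hx
    · exact cyc_le.1 (le_sSup ⟨i, x, hx, rfl⟩)

/-- `N` splits off from `N ⊔ Y` for every finitely generated `Y`. -/
def LocallySplit (N : Subrep V) : Prop :=
  ∀ Y : Subrep V, Y.FG → ∃ Z, Disjoint N Z ∧ N ⊔ Z = N ⊔ Y

theorem locallySplit_bot : (⊥ : Subrep V).LocallySplit := fun Y _ => ⟨Y, disjoint_bot_left, rfl⟩

theorem locallySplit_sSup_of_directed (hQ : Q.IsTree) (h : NoChain F Q) {T : Set (Subrep V)}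
    (hT : T.Nonempty) (hd : DirectedOn (· ≤ ·) T) (hs : ∀ N ∈ T, N.LocallySplit) :
    (sSup T).LocallySplit := by
  intro Y hY
  obtain ⟨N, hN, hYN⟩ := ((hY.tame hQ h).2 (Y ⊓ sSup T) inf_le_left).1.exists_le_of_le_sSup hT hd
    inf_le_right
  obtain ⟨Z, hdis, hZ⟩ := hs N hN Y hY
  have hle : N ≤ sSup T := le_sSup hN
  refine ⟨Z, ?_, ?_⟩
  · rw [disjoint_iff_inf_le, ← hdis.eq_bot]
    refine le_inf ?_ inf_le_right
    calc sSup T ⊓ Z ≤ sSup T ⊓ (N ⊔ Y) := inf_le_inf_left _ (le_sup_right.trans hZ.le)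
      _ = N ⊔ (Y ⊓ sSup T) := by rw [inf_comm, sup_inf_assoc_of_le Y hle]
      _ ≤ N := sup_le le_rfl hYN
  · rw [← sup_eq_left.2 hle, sup_assoc, hZ, sup_assoc]

/-- A proper locally split subrepresentation can be enlarged by an indecomposable FLEI summand. -/
theorem LocallySplit.exists_extension (hQ : Q.IsTree) (h : NoChain F Q) {N : Subrep V}
    (hN : N.LocallySplit) (hne : N ≠ ⊤) :
    ∃ Z : Subrep V, Z.toRep.Indec ∧ Z.toRep.IsFLEI ∧ Disjoint N Z ∧ (N ⊔ Z).LocallySplit := by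
  have hnz : N.quot.Nonzero := by
    by_contra hno
    refine hne (eq_top_iff.2 fun i x _ => N.mkQ_eq_zero.1 ?_)
    by_contra hx
    exact hno ⟨i, _, hx⟩
  obtain ⟨X, g, r, hX, hX', hfg, hrg⟩ := exists_indec_summand hQ h hnz
  obtain ⟨Y, hY, hYg⟩ := hfg.exists_map_eq N.mkQ (fun i y _ => by
    obtain ⟨x, rfl⟩ := N.mkQ_surjective i y
    exact mem_map_of_mem trivial)
  obtain ⟨Z, hdis, hNZ⟩ := hN Y hY
  have hmap : ∀ W : Subrep V, (N ⊔ W).map N.mkQ = W.map N.mkQ := fun W => by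
    rw [map_sup, sup_eq_right]
    refine le_trans ?_ (bot_le : ⊥ ≤ _)
    exact map_le_iff.2 fun i x hx => mem_bot.2 (N.mkQ_eq_zero.2 hx)
  have hZg : Z.map N.mkQ = (⊤ : Subrep X).map g := by rw [← hYg, ← hmap Z, hNZ, hmap]
  let π : V.Hom X := r.comp N.mkQ
  have hπN : ∀ i, ∀ x ∈ N.S i, π.app i x = 0 := fun i x hx => by
    simp [π, N.mkQ_eq_zero.2 hx]
  have hπZ : ∀ i, ∀ z ∈ Z.S i, π.app i z = 0 → z = 0 := by
    intro i z hz h0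
    obtain ⟨x, -, hx⟩ := hZg.le i (mem_map_of_mem hz)
    have h1 : x = 0 := by
      rw [← hrg i x, hx]
      exact h0
    rw [h1, map_zero] at hx
    exact mem_bot.1 (hdis.eq_bot.le i ⟨N.mkQ_eq_zero.1 hx.symm, hz⟩)
  have hφ : (π.comp Z.incl).IsIso := by
    intro i
    constructor
    · rw [injective_iff_map_eq_zero]
      exact fun z hz => Z.incl_injective i
        ((hπZ i _ (Z.incl_mem z) hz).trans (map_zero _).symm)
    · intro x
      obtain ⟨z, hz, hzx⟩ := hZg.ge i (mem_map_of_mem (x := x) trivial)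
      obtain ⟨z, rfl⟩ := Z.exists_incl_eq hz
      exact ⟨z, by simp [π, hzx, hrg]⟩
  have hiso : Iso X Z.toRep := ⟨_, Hom.isIso_inv _ hφ⟩
  refine ⟨Z, hX.of_iso hiso, hX'.of_iso hiso, hdis, fun Y hY => ?_⟩
  let s : X.Hom V := Z.incl.comp ((π.comp Z.incl).inv hφ)
  have hsZ : ∀ i x, s.app i x ∈ Z.S i := fun i x => Z.incl_mem _
  have hπs : ∀ i x, π.app i (s.app i x) = x := fun i x => Hom.app_inv_app _ hφ i x
  let ψ : V.Hom V := (Hom.id V).sub (s.comp π)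
  have hψ : ∀ i x, ψ.app i x = x - s.app i (π.app i x) := fun _ _ => rfl
  obtain ⟨Z', hdis', hZ'⟩ := hN _ (hY.map ψ)
  have hπ' : ∀ i, ∀ z ∈ Z'.S i, π.app i z = 0 := by
    intro i z hz
    obtain ⟨n, hn, y, hy, rfl⟩ := mem_sup.1 (hZ'.le i (mem_sup.2 ⟨0, zero_mem _, z, hz, zero_add z⟩))
    obtain ⟨y, -, rfl⟩ := hy
    rw [map_add, hπN i n hn, hψ, map_sub, hπs, sub_self, add_zero]
  refine ⟨Z', ?_, ?_⟩
  · rw [disjoint_iff_inf_le]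
    rintro i z ⟨hz, hz'⟩
    obtain ⟨n, hn, y, hy, rfl⟩ := mem_sup.1 hz
    have h1 := hπ' i _ hz'
    rw [map_add, hπN i n hn, zero_add] at h1
    obtain rfl := hπZ i y hy h1
    rw [add_zero] at hz' ⊢
    exact hdis'.eq_bot.le i ⟨hn, hz'⟩
  · rw [sup_right_comm, hZ', sup_right_comm]
    refine le_antisymm (sup_le le_sup_left ?_) (sup_le le_sup_left fun i y hy => ?_)
    · rintro i _ ⟨y, hy, rfl⟩
      rw [hψ, sub_eq_neg_add]
      exact mem_sup.2 ⟨_, (le_sup_right : Z ≤ N ⊔ Z) i (neg_mem (hsZ i _)), y, hy, rfl⟩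
    · exact mem_sup.2 ⟨_, (le_sup_right : Z ≤ N ⊔ Z) i (hsZ i (π.app i y)), ψ.app i y,
        mem_map_of_mem hy, by rw [hψ]; abel⟩

theorem exists_decomp (hQ : Q.IsTree) (h : NoChain F Q) (V : QRep F Q) :
    ∃ (J : Type) (W : J → Subrep V),
      (∀ j, (W j).toRep.Indec ∧ (W j).toRep.IsFLEI) ∧ IsDecomp W := by
  obtain ⟨T, -, hT⟩ := zorn_subset_nonempty {T : Set (Subrep V) |
    (∀ W ∈ T, W.toRep.Indec ∧ W.toRep.IsFLEI) ∧ sSupIndep T ∧ (sSup T).LocallySplit}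
    (fun c hc hchain hcne => by
      refine ⟨⋃₀ c, ⟨?_, ?_, ?_⟩, fun _ => Set.subset_sUnion_of_mem⟩
      · rintro W ⟨T, hT, hW⟩
        exact (hc hT).1 W hW
      · exact iSupIndep_sUnion_of_directed hchain.directedOn fun T hT => (hc hT).2.1
      · rw [sSup_sUnion, ← sSup_image]
        refine locallySplit_sSup_of_directed hQ h (hcne.image _) ?_ ?_
        · rw [directedOn_image]
          exact hchain.directedOn.mono @fun s t => sSup_le_sSup
        · rintro _ ⟨T, hT, rfl⟩
          exact (hc hT).2.2) ∅
    ⟨by simp, sSupIndep_empty, by rw [sSup_empty]; exact locallySplit_bot⟩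
  obtain ⟨hT1, hT2, hT3⟩ := hT.prop
  have htop : sSup T = ⊤ := by
    by_contra hne
    obtain ⟨Z, hZ, hZ', hdis, hs⟩ := hT3.exists_extension hQ h hne
    have hmem : Z ∈ T := hT.le_of_ge (y := insert Z T) ⟨?_, ?_, ?_⟩ (Set.subset_insert Z T)
      (Set.mem_insert Z T)
    · obtain ⟨i, z, hz⟩ := hZ.1
      refine hz (Z.incl_injective i ((mem_bot.1 ?_).trans (map_zero _).symm))
      exact hdis.eq_bot.le i ⟨le_sSup hmem i (Z.incl_mem z), Z.incl_mem z⟩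
    · rintro W (rfl | hW)
      · exact ⟨hZ, hZ'⟩
      · exact hT1 W hW
    · exact hT2.insert_of_disjoint hdis.symm
    · rwa [sSup_insert, sup_comm]
  refine ⟨T, Subtype.val, fun j => hT1 j j.2, fun i j => ?_, fun i => ?_⟩
  · rw [disjoint_iff_inf_le]
    refine le_trans (inf_le_inf_left _ ?_) ((hT2 j.2).eq_bot.le i)
    exact iSup₂_le fun k hk => (le_sSup (show k.1 ∈ T \ {j.1} from
      ⟨k.2, fun h' => hk (Subtype.ext h')⟩) : k.1 ≤ _) i
  · rw [iSup_subtype, ← sSup_S, htop]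
    rfl

end Subrep

namespace IsDecomp

open QRep

variable {F : Type} [Field F] {Q : Quiv} {V : QRep F Q} {J : Type} {W : J → Subrep V}

open scoped Classical in
theorem isInternal (hd : IsDecomp W) (i : Q.V) : DirectSum.IsInternal fun j => (W j).S i :=
  DirectSum.isInternal_submodule_of_iSupIndep_of_iSup_eq_top (hd.1 i) (hd.2 i)

open scoped Classical in
/-- The projections of an internal direct sum onto its summands. -/
theorem exists_proj (hd : IsDecomp W) : ∃ p : ∀ j, V.Hom (W j).toRep,
    (∀ j i x, (p j).app i ((W j).incl.app i x) = x) ∧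
    (∀ j k, j ≠ k → ∀ i x, (p j).app i ((W k).incl.app i x) = 0) ∧
    ∀ i x, ∃ s : Finset J, x = ∑ j ∈ s, (W j).incl.app i ((p j).app i x) := by
  let P : ∀ j i, V.M i →ₗ[F] (W j).toRep.M i := fun j i =>
    (DirectSum.component F J (fun j => (W j).S i) j) ∘ₗ
      (LinearEquiv.ofBijective (DirectSum.coeLinearMap fun j => (W j).S i) (hd.isInternal i)).symm.toLinearMap
  have hP1 : ∀ j i x, P j i ((W j).incl.app i x) = x := fun j i x =>
    (hd.isInternal i).ofBijective_coeLinearMap_same (i := j) x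
  have hP2 : ∀ j k, j ≠ k → ∀ i x, P j i ((W k).incl.app i x) = 0 := fun j k hjk i x =>
    (hd.isInternal i).ofBijective_coeLinearMap_of_ne hjk.symm x
  refine ⟨fun j => Hom.mk' (P j) fun a x => ?_, hP1, hP2, fun i x => ?_⟩
  · have hx : x ∈ ⨆ k, (W k).S (Q.s a) := by rw [hd.2]; trivial
    induction hx using Submodule.iSup_induction' with
    | mem k x hx =>
      obtain ⟨y, rfl⟩ := (W k).exists_incl_eq hx
      rw [Hom.comm_apply (W k).incl]
      by_cases hjk : j = k
      · subst hjk
        rw [hP1, hP1]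
      · rw [hP2 _ _ hjk, hP2 _ _ hjk, map_zero]
    | zero => simp
    | add x y _ _ hx hy => rw [map_add, map_add, hx, hy, map_add, map_add]
  · obtain ⟨z, rfl⟩ := (hd.isInternal i).2 x
    refine ⟨z.support, ?_⟩
    have hz : ∀ j, P j i (DirectSum.coeLinearMap (fun j => (W j).S i) z) = z j := fun j =>
      congrArg (fun w : DirectSum J fun j => (W j).S i => w j)
        ((LinearEquiv.ofBijective (DirectSum.coeLinearMap fun j => (W j).S i) (hd.isInternal i)).symm_apply_apply z)
    change DirectSum.coeLinearMap (fun j => (W j).S i) z = _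
    rw [DirectSum.coeLinearMap_eq_dfinsuppSum]
    refine Finset.sum_congr rfl fun j _ => ?_
    exact congrArg Subtype.val (hz j).symm

end IsDecomp

namespace QRep

variable {F : Type} [Field F] {Q : Quiv} {X V : QRep F Q}

/-- The span of the values at a vertex of all morphisms `X → V`. -/
def homSpan (X V : QRep F Q) (v : Q.V) : Submodule F (V.M v) :=
  Submodule.span F {y | ∃ (f : X.Hom V) (x : X.M v), f.app v x = y}

/-- The span of the values at a vertex of the morphisms `X → V` which are annihilated by all
morphisms `V → X`. -/
def radSpan (X V : QRep F Q) (v : Q.V) : Submodule F (V.M v) :=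
  Submodule.span F {y | ∃ (f : X.Hom V) (x : X.M v),
    (∀ g : V.Hom X, ¬ (g.comp f).Nonzero) ∧ f.app v x = y}

theorem radSpan_le_ker (v : Q.V) (g : V.Hom X) : radSpan X V v ≤ LinearMap.ker (g.app v) := by
  refine Submodule.span_le.2 ?_
  rintro _ ⟨f, x, hf, rfl⟩
  by_contra hx
  exact hf g ((g.comp f).nonzero_iff.2 ⟨v, x, hx⟩)

end QRep

namespace IsDecomp

open QRep

variable {F : Type} [Field F] {Q : Quiv} {X V : QRep F Q} {J : Type} {W : J → Subrep V}

/-- The copies of `X` in a decomposition of `V` give a basis of the quotient of `homSpan X V v` by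
`radSpan X V v`. -/
theorem exists_basis (h : NoChain F Q) (hX : X.Indec) (hX' : X.IsFLEI)
    (hW : ∀ j, (W j).toRep.Indec ∧ (W j).toRep.IsFLEI) (hd : IsDecomp W) (v : Q.V) {n : ℕ}
    (b : Module.Basis (Fin n) F (X.M v)) :
    Nonempty (Module.Basis ({j // Iso X (W j).toRep} × Fin n) F
      ((homSpan X V v).map (radSpan X V v).mkQ)) := by
  obtain ⟨p, hp1, hp2, hp3⟩ := hd.exists_proj
  let φ : ∀ j : {j // Iso X (W j).toRep}, X.Hom (W j).toRep := fun j => j.2.choose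
  have hφ : ∀ j, (φ j).IsIso := fun j => j.2.choose_spec
  let u : {j // Iso X (W j).toRep} × Fin n → V.M v ⧸ radSpan X V v := fun m =>
    (radSpan X V v).mkQ ((W m.1).incl.app v ((φ m.1).app v (b m.2)))
  let g : ∀ j : {j // Iso X (W j).toRep}, V.Hom X := fun j => ((φ j).inv (hφ j)).comp (p j)
  have hu : LinearIndependent F u := by
    refine LinearIndependent.of_pairwise_dual_eq_zero_one u
      (fun m => (b.coord m.2) ∘ₗ (radSpan X V v).liftQ ((g m.1).app v) (radSpan_le_ker v _))
      (fun m m' hm => ?_) fun m => ?_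
    · change b.coord m.2 (((φ m.1).inv (hφ m.1)).app v ((p m.1).app v
        ((W m'.1).incl.app v ((φ m'.1).app v (b m'.2))))) = 0
      by_cases hj : m.1 = m'.1
      · obtain ⟨j, k⟩ := m
        obtain ⟨j', k'⟩ := m'
        obtain rfl : j = j' := hj
        rw [hp1, Hom.inv_app_app, Module.Basis.coord_apply, b.repr_self]
        exact Finsupp.single_eq_of_ne fun hk => hm (Prod.ext rfl hk)
      · rw [hp2 _ _ fun hj' => hj (Subtype.ext hj'), map_zero, map_zero]
    · change b.coord m.2 (((φ m.1).inv (hφ m.1)).app v ((p m.1).app v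
        ((W m.1).incl.app v ((φ m.1).app v (b m.2))))) = 1
      rw [hp1, Hom.inv_app_app, Module.Basis.coord_apply, b.repr_self, Finsupp.single_eq_same]
  have hs : Submodule.span F (Set.range u) = (homSpan X V v).map (radSpan X V v).mkQ := by
    refine le_antisymm (Submodule.span_le.2 ?_) ?_
    · rintro _ ⟨m, rfl⟩
      exact Submodule.mem_map_of_mem (Submodule.subset_span ⟨(W m.1).incl.comp (φ m.1), _, rfl⟩)
    · rw [Submodule.map_le_iff_le_comap]
      refine Submodule.span_le.2 ?_
      rintro _ ⟨f, x, rfl⟩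
      obtain ⟨s, hs⟩ := hp3 v (f.app v x)
      rw [hs]
      refine Submodule.sum_mem _ fun j _ => ?_
      by_cases hj : Iso X (W j).toRep
      · obtain ⟨y, hy⟩ := (hφ ⟨j, hj⟩ v).2 ((p j).app v (f.app v x))
        rw [← hy, ← b.sum_repr y]
        simp only [map_sum, map_smul]
        exact Submodule.sum_mem _ fun k _ => Submodule.smul_mem _ _
          (Submodule.subset_span ⟨(⟨j, hj⟩, k), rfl⟩)
      · suffices hr : (W j).incl.app v ((p j).app v (f.app v x)) ∈ radSpan X V v by
          rw [Submodule.mem_comap, Submodule.mkQ_apply, (Submodule.Quotient.mk_eq_zero _).2 hr]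
          exact Submodule.zero_mem _
        refine Submodule.subset_span ⟨(W j).incl.comp ((p j).comp f), x, fun g' hg' => hj ?_, rfl⟩
        obtain ⟨i, z, hz⟩ := Hom.nonzero_iff _ |>.1 hg'
        have h1 : ((p j).comp f).Nonzero := (Hom.nonzero_iff _).2 ⟨i, z, fun h0 => hz (by
          change g'.app i ((W j).incl.app i (((p j).comp f).app i z)) = 0
          rw [h0, map_zero, map_zero])⟩
        have h2 : (g'.comp (W j).incl).Nonzero := (Hom.nonzero_iff _).2 ⟨i, _, hz⟩
        rcases h.isIso_or_isIso hX hX' (hW j).1 (hW j).2 _ _ h1 h2 with h' | h'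
        · exact ⟨_, h'⟩
        · exact Iso.symm ⟨_, h'⟩
  exact ⟨(Module.Basis.span hu).map (LinearEquiv.ofEq _ _ hs)⟩

theorem nonempty_equiv_iso (h : NoChain F Q) (hX : X.Indec) (hX' : X.IsFLEI)
    {J' : Type} {W' : J' → Subrep V}
    (hW : ∀ j, (W j).toRep.Indec ∧ (W j).toRep.IsFLEI) (hd : IsDecomp W)
    (hW' : ∀ j, (W' j).toRep.Indec ∧ (W' j).toRep.IsFLEI) (hd' : IsDecomp W') :
    Nonempty ({j // Iso X (W j).toRep} ≃ {j // Iso X (W' j).toRep}) := by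
  obtain ⟨v, x, hx⟩ := hX.1
  have := hX'.1 v
  have : Nontrivial (X.M v) := ⟨x, 0, hx⟩
  have b := Module.finBasis F (X.M v)
  obtain ⟨b1⟩ := hd.exists_basis h hX hX' hW v b
  obtain ⟨b2⟩ := hd'.exists_basis h hX hX' hW' v b
  have hc := Cardinal.mk_congr (b1.indexEquiv b2)
  rw [Cardinal.mk_prod, Cardinal.mk_prod] at hc
  simp only [Cardinal.lift_id, Cardinal.mk_fin] at hc
  rw [Cardinal.mul_natCast_inj (Module.finrank_pos (R := F)).ne'] at hc
  exact Cardinal.eq.1 hc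

/-- The Krull–Schmidt–Azumaya property of decompositions. -/
theorem exists_equiv (h : NoChain F Q) {J' : Type} {W' : J' → Subrep V}
    (hW : ∀ j, (W j).toRep.Indec ∧ (W j).toRep.IsFLEI) (hd : IsDecomp W)
    (hW' : ∀ j, (W' j).toRep.Indec ∧ (W' j).toRep.IsFLEI) (hd' : IsDecomp W') :
    ∃ e : J ≃ J', ∀ j, Iso (W j).toRep (W' (e j)).toRep := by
  let r : Setoid (QRep F Q) := ⟨Iso, Iso.refl, Iso.symm, Iso.trans⟩
  let c : J → Quotient r := fun j => ⟦(W j).toRep⟧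
  let c' : J' → Quotient r := fun j => ⟦(W' j).toRep⟧
  have key : ∀ q : Quotient r, Nonempty ({j // c j = q} ≃ {j // c' j = q}) := by
    intro q
    induction q using Quotient.inductionOn with | _ X => ?_
    have e1 : ∀ j, c j = ⟦X⟧ ↔ Iso X (W j).toRep := fun j =>
      ⟨fun hj => (Quotient.exact hj : Iso _ _).symm, fun hj => Quotient.sound (s := r) hj.symm⟩
    have e2 : ∀ j, c' j = ⟦X⟧ ↔ Iso X (W' j).toRep := fun j =>
      ⟨fun hj => (Quotient.exact hj : Iso _ _).symm, fun hj => Quotient.sound (s := r) hj.symm⟩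
    by_cases hX : X.Indec ∧ X.IsFLEI
    · obtain ⟨e⟩ := nonempty_equiv_iso h hX.1 hX.2 hW hd hW' hd'
      exact ⟨(Equiv.subtypeEquivRight e1).trans (e.trans (Equiv.subtypeEquivRight e2).symm)⟩
    · have : IsEmpty {j // c j = ⟦X⟧} := ⟨fun j => hX
        ⟨(hW j).1.of_iso ((e1 j).1 j.2).symm, (hW j).2.of_iso ((e1 j).1 j.2).symm⟩⟩
      have : IsEmpty {j // c' j = ⟦X⟧} := ⟨fun j => hX
        ⟨(hW' j).1.of_iso ((e2 j).1 j.2).symm, (hW' j).2.of_iso ((e2 j).1 j.2).symm⟩⟩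
      exact ⟨Equiv.equivOfIsEmpty _ _⟩
  refine ⟨Equiv.ofFiberEquiv fun q => (key q).some, fun j => ?_⟩
  have hj := Equiv.ofFiberEquiv_map (fun q => (key q).some) j
  exact (Quotient.exact hj : Iso _ _).symm

end IsDecomp

/-- Let `Ω` be a tree quiver admitting no infinite sequence of
indecomposable FLEI representations connected by nonzero non-isomorphisms. Then every
representation of `Ω` is an internal direct sum of a family of indecomposable FLEI
subrepresentations, and any two such decompositions admit a bijection between their index
sets matching each summand to an isomorphic one. -/
theorem stmt14 (F : Type) [Field F] (Q : Quiv) (htree : Q.IsTree)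
    (hwf : ¬ ∃ (W : ℕ → QRep F Q) (f : ∀ n : ℕ, QRep.Hom (W n) (W (n + 1))),
        (∀ n, (W n).Indec ∧ (W n).IsFLEI) ∧ (∀ n, (f n).Nonzero ∧ ¬ (f n).IsIso))
    (V : QRep F Q) :
    (∃ (J : Type) (W : J → Subrep V),
      (∀ j, (W j).toRep.Indec ∧ (W j).toRep.IsFLEI) ∧ IsDecomp W) ∧
    (∀ (J J' : Type) (W : J → Subrep V) (W' : J' → Subrep V),
      (∀ j, (W j).toRep.Indec ∧ (W j).toRep.IsFLEI) → IsDecomp W →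
      (∀ j, (W' j).toRep.Indec ∧ (W' j).toRep.IsFLEI) → IsDecomp W' →
      ∃ e : J ≃ J', ∀ j, QRep.Iso (W j).toRep (W' (e j)).toRep) :=
  ⟨Subrep.exists_decomp htree hwf V, fun _ _ _ _ hW hd hW' hd' =>
    IsDecomp.exists_equiv hwf hW hd hW' hd'⟩
end

section
/- Let Ω be a quiver and n an element of the root space of Ω with support Ω^n. Then the net Ω' ↦ ⟨n,n⟩_{Ω'} over the directed set of finite IC subquivers Ω' of Ω converges in ℤ ∪ {±∞} if and only if the net Λ ↦ ⟨n,n⟩_{Λ} over the directed set of finite IC subquivers Λ of Ω^n converges, and in that case the two limits are equal; that is, ⟨n,n⟩_Ω = ⟨n,n⟩_{Ω^n}. -/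
/-- A subquiver: a set of vertices and a set of arrows whose endpoints lie in it. -/
structure Subquiv (Q : Quiv) : Type where
  verts : Set Q.V
  arrows : Set Q.A
  src_mem : ∀ a ∈ arrows, Q.s a ∈ verts
  tgt_mem : ∀ a ∈ arrows, Q.t a ∈ verts

namespace Subquiv

variable {Q : Quiv}

/-- A subquiver is finite if it has finitely many vertices and arrows. -/
def Finite (S : Subquiv Q) : Prop := S.verts.Finite ∧ S.arrows.Finite

/-- Containment of subquivers. -/
def le (S T : Subquiv Q) : Prop := S.verts ⊆ T.verts ∧ S.arrows ⊆ T.arrows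

/-- Adjacency within a subquiver. -/
def Adj (S : Subquiv Q) (i j : Q.V) : Prop :=
  ∃ a ∈ S.arrows, (Q.s a = i ∧ Q.t a = j) ∨ (Q.s a = j ∧ Q.t a = i)

/-- A subquiver is IC ("injective on components") if no connected component of `Ω`
contains two distinct connected components of the subquiver; equivalently, any two
vertices of the subquiver joined by a walk in `Ω` are joined by a walk in the
subquiver. -/
def IsIC (S : Subquiv Q) : Prop :=
  ∀ i ∈ S.verts, ∀ j ∈ S.verts,
    Relation.ReflTransGen Q.Adj i j → Relation.ReflTransGen S.Adj i j

/-- A subquiver regarded as a quiver in its own right. -/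
def toQuiv (S : Subquiv Q) : Quiv where
  V := ↥S.verts
  A := ↥S.arrows
  s a := ⟨Q.s a.1, S.src_mem a.1 a.2⟩
  t a := ⟨Q.t a.1, S.tgt_mem a.1 a.2⟩

end Subquiv

/-- The directed set of finite IC subquivers of `Q`, preordered by inclusion. -/
def FinICSub (Q : Quiv) : Type := {S : Subquiv Q // S.Finite ∧ S.IsIC}

instance (Q : Quiv) : Preorder (FinICSub Q) where
  le S T := S.1.le T.1
  le_refl S := ⟨subset_rfl, subset_rfl⟩
  le_trans S T U h h' := ⟨h.1.trans h'.1, h.2.trans h'.2⟩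

/-- The Tits form of `n` on a (finite) subquiver:
`Σ_{i ∈ Ω'₀} n_i² − Σ_{a ∈ Ω'₁} n_{s(a)} n_{t(a)}`. -/
noncomputable def tits (Q : Quiv) (n : Q.V → ℤ) (S : Subquiv Q) : ℤ :=
  (∑ᶠ i ∈ S.verts, n i ^ 2) - ∑ᶠ a ∈ S.arrows, n (Q.s a) * n (Q.t a)

/-- Membership of `n` in the root space of `Q`: `n` is constant along all but finitely
many arrows. -/
def IsRoot (Q : Quiv) (n : Q.V → ℤ) : Prop := {a : Q.A | n (Q.s a) ≠ n (Q.t a)}.Finite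

/-- The support of `n`: the full subquiver on the vertices where `n` is nonzero. -/
def suppQuiv (Q : Quiv) (n : Q.V → ℤ) : Subquiv Q where
  verts := {i | n i ≠ 0}
  arrows := {a | n (Q.s a) ≠ 0 ∧ n (Q.t a) ≠ 0}
  src_mem _ ha := ha.1
  tgt_mem _ ha := ha.2

/-- The net of values of the Tits form of `n` over the directed set of finite IC
subquivers, viewed in the extended reals `ℤ ∪ {±∞} ⊆ [-∞,∞]`. -/
noncomputable def titsNet (Q : Quiv) (n : Q.V → ℤ) : FinICSub Q → EReal :=
  fun S => (((tits Q n S.1 : ℤ) : ℝ) : EReal)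

/-- A quiver has finitely many connected components. -/
def Quiv.ComponentsFinite (Q : Quiv) : Prop :=
  ∃ s : Set Q.V, s.Finite ∧ ∀ v : Q.V, ∃ w ∈ s, Relation.ReflTransGen Q.Adj w v

/-- A quiver has finitely many cycles: the set of edge sets of cycles is finite. -/
def Quiv.CyclesFinite (Q : Quiv) : Prop :=
  {s : Set Q.A | ∃ (n : ℕ) (e : ℕ → Q.A × Bool),
    Q.IsCycle n e ∧ s = {a | ∃ k < n, a = (e k).1}}.Finite

open Relation Filter

namespace Subquiv

variable {Q : Quiv}

theorem Adj.symm {S : Subquiv Q} {i j : Q.V} : S.Adj i j → S.Adj j i :=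
  fun ⟨a, ha, h⟩ => ⟨a, ha, h.symm⟩

theorem joined_symm {S : Subquiv Q} {i j : Q.V} (h : ReflTransGen S.Adj i j) :
    ReflTransGen S.Adj j i := by
  induction h with
  | refl => exact .refl
  | tail _ hbc ih => exact .head hbc.symm ih

theorem joined_mono {S T : Subquiv Q} (hST : S.arrows ⊆ T.arrows) {i j : Q.V}
    (h : ReflTransGen S.Adj i j) : ReflTransGen T.Adj i j :=
  ReflTransGen.mono (fun _ _ ⟨a, ha, h⟩ => ⟨a, hST ha, h⟩) _ _ h

theorem joined_ambient {S : Subquiv Q} {i j : Q.V} (h : ReflTransGen S.Adj i j) :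
    ReflTransGen Q.Adj i j :=
  ReflTransGen.mono (fun _ _ ⟨a, _, h⟩ => ⟨a, h⟩) _ _ h

end Subquiv

theorem Quiv.joined_symm {Q : Quiv} {i j : Q.V} (h : ReflTransGen Q.Adj i j) :
    ReflTransGen Q.Adj j i := by
  induction h with
  | refl => exact .refl
  | tail _ hbc ih => exact .head (hbc.imp fun _ h => h.symm) ih

namespace Subquiv

variable {Q : Quiv}

/-- Enlarging an IC subquiver preserves IC if every vertex is joined to the original subquiver
or already joined to everything it can be joined to. -/
theorem IsIC.of_le {S T : Subquiv Q} (hS : S.IsIC) (hST : S.le T)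
    (h : ∀ i ∈ T.verts, (∃ k ∈ S.verts, ReflTransGen T.Adj i k) ∨
      ∀ j ∈ T.verts, ReflTransGen Q.Adj i j → ReflTransGen T.Adj i j) : T.IsIC := by
  intro i hi j hj hij
  rcases h i hi with ⟨k, hk, hik⟩ | h'
  · rcases h j hj with ⟨l, hl, hjl⟩ | h'
    · have hkl : ReflTransGen Q.Adj k l :=
        ((Quiv.joined_symm (joined_ambient hik)).trans hij).trans (joined_ambient hjl)
      exact (hik.trans (joined_mono hST.2 (hS k hk l hl hkl))).trans (joined_symm hjl)
    · exact joined_symm (h' i hi (Quiv.joined_symm hij))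
  · exact h' j hj hij

end Subquiv

namespace FinICSub

variable {Q : Quiv}

instance : Nonempty (FinICSub Q) :=
  ⟨⟨⟨∅, ∅, fun _ h => h, fun _ h => h⟩, ⟨Set.finite_empty, Set.finite_empty⟩,
    fun _ h => h.elim⟩⟩

theorem exists_mem_arrows_of_endpoint (S : FinICSub Q) (a : Q.A)
    (ha : Q.s a ∈ S.1.verts ∨ Q.t a ∈ S.1.verts) :
    ∃ T : FinICSub Q, S ≤ T ∧ a ∈ T.1.arrows := by
  let T : Subquiv Q :=
    { verts := insert (Q.s a) (insert (Q.t a) S.1.verts)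
      arrows := insert a S.1.arrows
      src_mem := by
        rintro b (rfl | hb)
        · exact .inl rfl
        · exact .inr (.inr (S.1.src_mem b hb))
      tgt_mem := by
        rintro b (rfl | hb)
        · exact .inr (.inl rfl)
        · exact .inr (.inr (S.1.tgt_mem b hb)) }
  have hST : S.1.le T := ⟨fun _ h => .inr (.inr h), fun _ h => .inr h⟩
  have hst : T.Adj (Q.s a) (Q.t a) := ⟨a, .inl rfl, .inl ⟨rfl, rfl⟩⟩
  refine ⟨⟨T, ⟨(S.2.1.1.insert _).insert _, S.2.1.2.insert _⟩, S.2.2.of_le hST ?_⟩,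
    hST, .inl rfl⟩
  rintro i (rfl | rfl | hi)
  · rcases ha with ha | ha
    · exact .inl ⟨_, ha, .refl⟩
    · exact .inl ⟨_, ha, .single hst⟩
  · rcases ha with ha | ha
    · exact .inl ⟨_, ha, .single hst.symm⟩
    · exact .inl ⟨_, ha, .refl⟩
  · exact .inl ⟨i, hi, .refl⟩

theorem exists_mem_verts_of_joined (S : FinICSub Q) {v w : Q.V} (hv : v ∈ S.1.verts)
    (h : ReflTransGen Q.Adj v w) : ∃ T : FinICSub Q, S ≤ T ∧ w ∈ T.1.verts := by
  induction h with
  | refl => exact ⟨S, le_rfl, hv⟩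
  | tail _ hbc ih =>
    obtain ⟨T, hST, hb⟩ := ih
    obtain ⟨a, ⟨rfl, rfl⟩ | ⟨rfl, rfl⟩⟩ := hbc
    · obtain ⟨U, hTU, ha⟩ := T.exists_mem_arrows_of_endpoint a (.inl hb)
      exact ⟨U, hST.trans hTU, U.1.tgt_mem a ha⟩
    · obtain ⟨U, hTU, ha⟩ := T.exists_mem_arrows_of_endpoint a (.inr hb)
      exact ⟨U, hST.trans hTU, U.1.src_mem a ha⟩

theorem exists_mem_verts (S : FinICSub Q) (w : Q.V) :
    ∃ T : FinICSub Q, S ≤ T ∧ w ∈ T.1.verts := by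
  by_cases h : ∃ v ∈ S.1.verts, ReflTransGen Q.Adj v w
  · obtain ⟨v, hv, hvw⟩ := h
    exact S.exists_mem_verts_of_joined hv hvw
  · let T : Subquiv Q :=
      { verts := insert w S.1.verts
        arrows := S.1.arrows
        src_mem := fun b hb => .inr (S.1.src_mem b hb)
        tgt_mem := fun b hb => .inr (S.1.tgt_mem b hb) }
    have hST : S.1.le T := ⟨fun _ h => .inr h, subset_rfl⟩
    refine ⟨⟨T, ⟨S.2.1.1.insert _, S.2.1.2⟩, S.2.2.of_le hST ?_⟩, hST, .inl rfl⟩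
    rintro i (rfl | hi)
    · right
      rintro j (rfl | hj) hij
      · exact .refl
      · exact absurd ⟨j, hj, Quiv.joined_symm hij⟩ h
    · exact .inl ⟨i, hi, .refl⟩

theorem exists_mem_arrows (S : FinICSub Q) (a : Q.A) :
    ∃ T : FinICSub Q, S ≤ T ∧ a ∈ T.1.arrows := by
  obtain ⟨T, hST, hT⟩ := S.exists_mem_verts (Q.s a)
  obtain ⟨U, hTU, hU⟩ := T.exists_mem_arrows_of_endpoint a (.inl hT)
  exact ⟨U, hST.trans hTU, hU⟩

theorem exists_le_of_finite (S : FinICSub Q) {V : Set Q.V} {A : Set Q.A}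
    (hV : V.Finite) (hA : A.Finite) :
    ∃ T : FinICSub Q, S ≤ T ∧ V ⊆ T.1.verts ∧ A ⊆ T.1.arrows := by
  obtain ⟨T, hST, hT⟩ : ∃ T : FinICSub Q, S ≤ T ∧ V ⊆ T.1.verts := by
    induction V, hV using Set.Finite.induction_on with
    | empty => exact ⟨S, le_rfl, Set.empty_subset _⟩
    | insert _ _ ih =>
      obtain ⟨T, hST, hT⟩ := ih
      obtain ⟨U, hTU, hU⟩ := T.exists_mem_verts _
      exact ⟨U, hST.trans hTU, Set.insert_subset hU (hT.trans hTU.1)⟩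
  obtain ⟨U, hTU, hU⟩ : ∃ U : FinICSub Q, T ≤ U ∧ A ⊆ U.1.arrows := by
    induction A, hA using Set.Finite.induction_on with
    | empty => exact ⟨T, le_rfl, Set.empty_subset _⟩
    | insert _ _ ih =>
      obtain ⟨U, hTU, hU⟩ := ih
      obtain ⟨W, hUW, hW⟩ := U.exists_mem_arrows _
      exact ⟨W, hTU.trans hUW, Set.insert_subset hW (hU.trans hUW.2)⟩
  exact ⟨U, hST.trans hTU, hT.trans hTU.1, hU⟩

instance : IsDirectedOrder (FinICSub Q) where
  directed S T := by
    obtain ⟨U, hSU, hV, hA⟩ := S.exists_le_of_finite T.2.1.1 T.2.1.2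
    exact ⟨U, hSU, hV, hA⟩

end FinICSub

namespace Subquiv

variable {Q : Quiv}

/-- The intersection of a subquiver `S` with `T`, as a subquiver of `T`. -/
def restrict (T S : Subquiv Q) : Subquiv T.toQuiv where
  verts := Subtype.val ⁻¹' S.verts
  arrows := Subtype.val ⁻¹' S.arrows
  src_mem a ha := S.src_mem a.1 ha
  tgt_mem a ha := S.tgt_mem a.1 ha

theorem Finite.restrict {S : Subquiv Q} (hS : S.Finite) (T : Subquiv Q) :
    (T.restrict S).Finite :=
  ⟨hS.1.preimage Subtype.val_injective.injOn, hS.2.preimage Subtype.val_injective.injOn⟩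

/-- The union of a subquiver `S` with a subquiver of `T`. -/
def unionIncl (S : Subquiv Q) {T : Subquiv Q} (R : Subquiv T.toQuiv) : Subquiv Q where
  verts := S.verts ∪ Subtype.val '' R.verts
  arrows := S.arrows ∪ Subtype.val '' R.arrows
  src_mem := by
    rintro a (ha | ⟨b, hb, rfl⟩)
    · exact .inl (S.src_mem a ha)
    · exact .inr ⟨_, R.src_mem b hb, rfl⟩
  tgt_mem := by
    rintro a (ha | ⟨b, hb, rfl⟩)
    · exact .inl (S.tgt_mem a ha)
    · exact .inr ⟨_, R.tgt_mem b hb, rfl⟩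

theorem le_unionIncl (S : Subquiv Q) {T : Subquiv Q} (R : Subquiv T.toQuiv) :
    S.le (S.unionIncl R) :=
  ⟨Set.subset_union_left, Set.subset_union_left⟩

theorem joined_unionIncl (S : Subquiv Q) {T : Subquiv Q} {R : Subquiv T.toQuiv}
    {i j : T.toQuiv.V} (h : ReflTransGen R.Adj i j) :
    ReflTransGen (S.unionIncl R).Adj i.1 j.1 := by
  refine ReflTransGen.lift (p := (S.unionIncl R).Adj) (fun v : T.toQuiv.V => v.1) ?_ _ _ h
  rintro _ _ ⟨a, ha, ⟨rfl, rfl⟩ | ⟨rfl, rfl⟩⟩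
  · exact ⟨a.1, .inr ⟨a, ha, rfl⟩, .inl ⟨rfl, rfl⟩⟩
  · exact ⟨a.1, .inr ⟨a, ha, rfl⟩, .inr ⟨rfl, rfl⟩⟩

theorem eq_of_verts_arrows {S T : Subquiv Q} (hv : S.verts = T.verts)
    (ha : S.arrows = T.arrows) : S = T := by
  cases S
  cases T
  cases hv
  cases ha
  rfl

theorem restrict_unionIncl {T : Subquiv Q} {S : Subquiv Q} {R : Subquiv T.toQuiv}
    (h : (T.restrict S).le R) : T.restrict (S.unionIncl R) = R := by
  have hv : (T.restrict (S.unionIncl R)).verts = R.verts := by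
    ext v
    constructor
    · rintro (hv | ⟨w, hw, hwv⟩)
      · exact h.1 hv
      · rwa [← Subtype.val_injective hwv]
    · exact fun hv => .inr ⟨v, hv, rfl⟩
  have ha : (T.restrict (S.unionIncl R)).arrows = R.arrows := by
    ext v
    constructor
    · rintro (hv | ⟨w, hw, hwv⟩)
      · exact h.2 hv
      · rwa [← Subtype.val_injective hwv]
    · exact fun hv => .inr ⟨v, hv, rfl⟩
  exact eq_of_verts_arrows hv ha

/-- The whole quiver as a subquiver of itself. -/
def univ (Q : Quiv) : Subquiv Q :=
  ⟨Set.univ, Set.univ, fun _ _ => trivial, fun _ _ => trivial⟩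

theorem joined_univ {i j : Q.V} (h : ReflTransGen Q.Adj i j) :
    ReflTransGen (univ Q).Adj i j :=
  ReflTransGen.mono (fun _ _ ⟨a, h⟩ => ⟨a, trivial, h⟩) _ _ h

end Subquiv

/-- The arrows along which `n` is not constant. -/
def jumpArrows (Q : Quiv) (n : Q.V → ℤ) : Set Q.A := {a | n (Q.s a) ≠ n (Q.t a)}

/-- The vertices of the support of `n` that are endpoints of an arrow along which `n` is not
constant. -/
def jumpVerts (Q : Quiv) (n : Q.V → ℤ) : Set (suppQuiv Q n).toQuiv.V :=
  Subtype.val ⁻¹' (Q.s '' jumpArrows Q n ∪ Q.t '' jumpArrows Q n)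

theorem IsRoot.finite_jumpVerts {Q : Quiv} {n : Q.V → ℤ} (hn : IsRoot Q n) :
    (jumpVerts Q n).Finite :=
  ((Set.Finite.image _ hn).union (Set.Finite.image _ hn)).preimage Subtype.val_injective.injOn

theorem mem_verts_of_mem_jumpVerts {Q : Quiv} {n : Q.V → ℤ} {S : Subquiv Q}
    (hS : jumpArrows Q n ⊆ S.arrows) {b : (suppQuiv Q n).toQuiv.V} (hb : b ∈ jumpVerts Q n) :
    b.1 ∈ S.verts := by
  obtain ⟨a, ha, h⟩ | ⟨a, ha, h⟩ := hb
  · exact h ▸ S.src_mem a (hS ha)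
  · exact h ▸ S.tgt_mem a (hS ha)

/-- A walk starting in the support either stays there or first meets a jump vertex. -/
theorem joined_restrict_or_exists_jumpVerts {Q : Quiv} {n : Q.V → ℤ} {S : Subquiv Q} {j : Q.V}
    (i : (suppQuiv Q n).toQuiv.V) (h : ReflTransGen S.Adj i.1 j) :
    (∃ hj : n j ≠ 0, ReflTransGen ((suppQuiv Q n).restrict S).Adj i ⟨j, hj⟩) ∨
      ∃ b ∈ jumpVerts Q n, ReflTransGen ((suppQuiv Q n).restrict S).Adj i b := by
  induction h with
  | refl => exact .inl ⟨i.2, .refl⟩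
  | tail _ hbc ih =>
    rename_i b c _
    rcases ih with ⟨hb, hib⟩ | h
    · by_cases hc : n c = 0
      · refine .inr ⟨_, ?_, hib⟩
        obtain ⟨a, -, ⟨rfl, rfl⟩ | ⟨rfl, rfl⟩⟩ := hbc
        · exact .inl ⟨a, fun h => hb (h.trans hc), rfl⟩
        · exact .inr ⟨a, fun h => hb (h.symm.trans hc), rfl⟩
      · refine .inl ⟨hc, hib.tail ?_⟩
        obtain ⟨a, ha, ⟨rfl, rfl⟩ | ⟨rfl, rfl⟩⟩ := hbc
        · exact ⟨⟨a, hb, hc⟩, ha, .inl ⟨rfl, rfl⟩⟩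
        · exact ⟨⟨a, hc, hb⟩, ha, .inr ⟨rfl, rfl⟩⟩
    · exact .inr h

theorem tits_restrict_suppQuiv (Q : Quiv) (n : Q.V → ℤ) (S : Subquiv Q) :
    tits (suppQuiv Q n).toQuiv (fun i => n i.1) ((suppQuiv Q n).restrict S) = tits Q n S := by
  have hv : ∑ᶠ i ∈ ((suppQuiv Q n).restrict S).verts, n i.1 ^ 2 =
      ∑ᶠ i ∈ S.verts, n i ^ 2 := by
    refine (finsum_mem_image (f := fun i => n i ^ 2) (g := fun v : (suppQuiv Q n).verts => v.1)
      (s := Subtype.val ⁻¹' S.verts) Subtype.val_injective.injOn).symm.trans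
      (finsum_mem_inter_support_eq _ _ _ ?_)
    ext i
    simp +contextual [suppQuiv]
  have ha : ∑ᶠ a ∈ ((suppQuiv Q n).restrict S).arrows, n (Q.s a.1) * n (Q.t a.1) =
      ∑ᶠ a ∈ S.arrows, n (Q.s a) * n (Q.t a) := by
    refine (finsum_mem_image (f := fun a => n (Q.s a) * n (Q.t a))
      (g := fun a : (suppQuiv Q n).arrows => a.1)
      (s := Subtype.val ⁻¹' S.arrows) Subtype.val_injective.injOn).symm.trans
      (finsum_mem_inter_support_eq _ _ _ ?_)
    ext i
    simp +contextual [suppQuiv]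
  exact congrArg₂ (· - ·) hv ha

theorem titsNet_suppQuiv_of_restrict_eq {Q : Quiv} {n : Q.V → ℤ} {S : FinICSub Q}
    {R : FinICSub (suppQuiv Q n).toQuiv} (h : (suppQuiv Q n).restrict S.1 = R.1) :
    titsNet (suppQuiv Q n).toQuiv (fun i => n i.1) R = titsNet Q n S := by
  have key := tits_restrict_suppQuiv Q n S.1
  rw [h] at key
  exact congrArg (fun z : ℤ => ((z : ℝ) : EReal)) key

/-- The restriction of a large finite IC subquiver to the support is IC. -/
theorem IsRoot.exists_restrict_isIC {Q : Quiv} {n : Q.V → ℤ} (hn : IsRoot Q n) :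
    ∃ S₀ : FinICSub Q, jumpArrows Q n ⊆ S₀.1.arrows ∧
      ∀ S ≥ S₀, ((suppQuiv Q n).restrict S.1).IsIC := by
  obtain ⟨T, -, hT, -⟩ := (Classical.arbitrary (FinICSub (suppQuiv Q n).toQuiv)).exists_le_of_finite
    hn.finite_jumpVerts Set.finite_empty
  obtain ⟨S₀, -, -, hS₀⟩ := (Classical.arbitrary (FinICSub Q)).exists_le_of_finite
    Set.finite_empty (Set.Finite.union hn (T.2.1.2.image Subtype.val))
  refine ⟨S₀, Set.subset_union_left.trans hS₀, fun S hS i hi j hj hij => ?_⟩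
  have hTS : T.1.arrows ⊆ ((suppQuiv Q n).restrict S.1).arrows :=
    fun a ha => hS.2 (hS₀ (.inr ⟨a, ha, rfl⟩))
  have hijQ : ReflTransGen Q.Adj i.1 j.1 := by
    refine ReflTransGen.lift (p := Q.Adj) (fun v : (suppQuiv Q n).toQuiv.V => v.1) ?_ _ _ hij
    rintro _ _ ⟨a, ⟨rfl, rfl⟩ | ⟨rfl, rfl⟩⟩
    · exact ⟨a.1, .inl ⟨rfl, rfl⟩⟩
    · exact ⟨a.1, .inr ⟨rfl, rfl⟩⟩
  have hijS := S.2.2 _ hi _ hj hijQ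
  rcases joined_restrict_or_exists_jumpVerts i hijS with ⟨_, h⟩ | ⟨b, hb, hib⟩
  · exact h
  rcases joined_restrict_or_exists_jumpVerts j (Subquiv.joined_symm hijS) with
    ⟨_, h⟩ | ⟨c, hc, hjc⟩
  · exact Subquiv.joined_symm h
  have hbc : ReflTransGen (suppQuiv Q n).toQuiv.Adj b c :=
    ((Quiv.joined_symm (Subquiv.joined_ambient hib)).trans hij).trans
      (Subquiv.joined_ambient hjc)
  exact (hib.trans (Subquiv.joined_mono hTS (T.2.2 b (hT hb) c (hT hc) hbc))).trans
    (Subquiv.joined_symm hjc)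

/-- Gluing a finite IC subquiver of the support onto a finite IC subquiver containing all jump
arrows gives an IC subquiver. -/
theorem isIC_unionIncl {Q : Quiv} {n : Q.V → ℤ} {S : Subquiv Q} (hS : S.IsIC)
    (hjump : jumpArrows Q n ⊆ S.arrows) {R : Subquiv (suppQuiv Q n).toQuiv} (hR : R.IsIC)
    (hSR : ((suppQuiv Q n).restrict S).le R) : (S.unionIncl R).IsIC := by
  refine hS.of_le (S.le_unionIncl R) ?_
  rintro _ (hi | ⟨i, hi, rfl⟩)
  · exact .inl ⟨_, hi, .refl⟩
  by_cases h : ∃ b ∈ jumpVerts Q n, ReflTransGen (suppQuiv Q n).toQuiv.Adj i b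
  · obtain ⟨b, hb, hib⟩ := h
    have hbS := mem_verts_of_mem_jumpVerts hjump hb
    exact .inl ⟨b.1, hbS, S.joined_unionIncl (hR i hi b (hSR.1 hbS) hib)⟩
  · refine .inr fun j hj hij => ?_
    rcases joined_restrict_or_exists_jumpVerts i (Subquiv.joined_univ hij) with
      ⟨hj0, h'⟩ | ⟨b, hb, hib⟩
    · have hjR : (⟨j, hj0⟩ : (suppQuiv Q n).verts) ∈ R.verts := by
        rw [← Subquiv.restrict_unionIncl hSR]
        exact hj
      exact S.joined_unionIncl (hR i hi _ hjR (Subquiv.joined_ambient h'))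
    · exact absurd ⟨b, hb, Subquiv.joined_ambient hib⟩ h

/-- For an element `n` of the root space of `Ω` with support `Ω^n`, the
net of Tits forms over the finite IC subquivers of `Ω` converges (in `ℤ ∪ {±∞}`) iff the
corresponding net over the finite IC subquivers of `Ω^n` converges, and in that case the
limits agree: `⟨n,n⟩_Ω = ⟨n,n⟩_{Ω^n}`. -/
theorem stmt16 (Q : Quiv) (n : Q.V → ℤ) (hn : IsRoot Q n) (L : EReal) :
    Filter.Tendsto (titsNet Q n) Filter.atTop (nhds L) ↔
    Filter.Tendsto (titsNet (suppQuiv Q n).toQuiv (fun i => n i.1))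
      Filter.atTop (nhds L) := by
  obtain ⟨S₀, hjump, hIC⟩ := hn.exists_restrict_isIC
  rw [tendsto_atTop', tendsto_atTop']
  refine forall₂_congr fun U _ => ⟨fun ⟨S, hS⟩ => ?_, fun ⟨R, hR⟩ => ?_⟩
  · obtain ⟨T, hST, hT⟩ := exists_ge_ge S S₀
    refine ⟨⟨(suppQuiv Q n).restrict T.1, T.2.1.restrict _, hIC T hT⟩, fun R hR => ?_⟩
    let W : FinICSub Q := ⟨T.1.unionIncl R.1,
      ⟨T.2.1.1.union (R.2.1.1.image _), T.2.1.2.union (R.2.1.2.image _)⟩,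
      isIC_unionIncl T.2.2 (hjump.trans hT.2) R.2.2 hR⟩
    have hTW : T ≤ W := T.1.le_unionIncl R.1
    rw [titsNet_suppQuiv_of_restrict_eq (S := W) (Subquiv.restrict_unionIncl hR)]
    exact hS W (hST.trans hTW)
  · obtain ⟨T, hT, hV, hA⟩ := S₀.exists_le_of_finite
      (R.2.1.1.image Subtype.val) (R.2.1.2.image Subtype.val)
    refine ⟨T, fun S hS => ?_⟩
    rw [← titsNet_suppQuiv_of_restrict_eq
      (R := ⟨(suppQuiv Q n).restrict S.1, S.2.1.restrict _, hIC S (hT.trans hS)⟩) rfl]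
    exact hR _ ⟨fun v hv => hS.1 (hV ⟨v, hv, rfl⟩), fun a ha => hS.2 (hA ⟨a, ha, rfl⟩)⟩
end

section
/- Let Ω be a quiver and n an element of the root space of Ω with support Ω^n. (1) If Ω^n has finitely many connected components and finitely many cycles, then there exists a finite IC subquiver Ω* of Ω such that ⟨n,n⟩_Ω exists and equals ⟨n,n⟩_{Ω*}. (2) If Ω^n has finitely many cycles but infinitely many connected components, then ⟨n,n⟩_Ω = +∞. (3) If Ω^n has finitely many connected components but infinitely many cycles, then ⟨n,n⟩_Ω = −∞. -/
open Relation

/-- Adjacency through an arrow of the set `U`. -/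
def Quiv.AdjVia (Q : Quiv) (U : Set Q.A) (i j : Q.V) : Prop :=
  ∃ a ∈ U, (Q.s a = i ∧ Q.t a = j) ∨ (Q.s a = j ∧ Q.t a = i)

namespace Quiv

variable {Q : Quiv}

theorem AdjVia.mono {U U' : Set Q.A} (h : U ⊆ U') {i j : Q.V}
    (hij : ReflTransGen (Q.AdjVia U) i j) : ReflTransGen (Q.AdjVia U') i j :=
  ReflTransGen.mono (p := Q.AdjVia U') (fun _ _ ⟨a, ha, h'⟩ => ⟨a, h ha, h'⟩) i j hij

theorem AdjVia.symm {U : Set Q.A} {i j : Q.V}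
    (hij : ReflTransGen (Q.AdjVia U) i j) : ReflTransGen (Q.AdjVia U) j i :=
  haveI : Std.Symm (Q.AdjVia U) := ⟨fun _ _ ⟨a, ha, h⟩ => ⟨a, ha, h.symm⟩⟩
  Std.Symm.symm _ _ hij

theorem AdjVia.of_mem {U : Set Q.A} {a : Q.A} (ha : a ∈ U) :
    ReflTransGen (Q.AdjVia U) (Q.s a) (Q.t a) :=
  .single ⟨a, ha, .inl ⟨rfl, rfl⟩⟩

theorem adjVia_univ : Q.AdjVia Set.univ = Q.Adj := by
  ext i j
  simp [AdjVia, Adj]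

theorem exists_finite_path (U : Set Q.A) {i j : Q.V} (h : ReflTransGen (Q.AdjVia U) i j) :
    ∃ Y ⊆ U, Y.Finite ∧ (∀ b ∈ Y, ReflTransGen (Q.AdjVia Y) i (Q.s b)) ∧
      ReflTransGen (Q.AdjVia Y) i j := by
  induction h with
  | refl => exact ⟨∅, Set.empty_subset _, Set.finite_empty, by simp, .refl⟩
  | @tail k j _ hkj ih =>
    obtain ⟨Y, hYU, hY, hb, hk⟩ := ih
    obtain ⟨a, haU, ha⟩ := hkj
    have hsub : Y ⊆ insert a Y := Set.subset_insert a Y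
    have hk' := AdjVia.mono hsub hk
    have hj : ReflTransGen (Q.AdjVia (insert a Y)) i j :=
      hk'.tail ⟨a, Set.mem_insert a Y, ha⟩
    refine ⟨insert a Y, Set.insert_subset haU hYU, hY.insert a, ?_, hj⟩
    rintro b (rfl | hbY)
    · rcases ha with ⟨h, -⟩ | ⟨h, -⟩
      · rwa [h]
      · rwa [h]
    · exact AdjVia.mono hsub (hb b hbY)

/-- Finite sets of vertices and arrows lie in a finite subquiver that joins any two of its
vertices joined through `U`. -/
theorem exists_finite_hull (U : Set Q.A) {F : Set Q.V} (hF : F.Finite) {Y₀ : Set Q.A}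
    (hY₀ : Y₀.Finite) (hU : Y₀ ⊆ U) :
    ∃ S : Subquiv Q, S.Finite ∧ F ⊆ S.verts ∧ Y₀ ⊆ S.arrows ∧ S.arrows ⊆ U ∧
      ∀ i ∈ S.verts, ∀ j ∈ S.verts, ReflTransGen (Q.AdjVia U) i j →
        ReflTransGen (Q.AdjVia S.arrows) i j := by
  have key (i j : Q.V) : ∃ Y ⊆ U, Y.Finite ∧ (∀ b ∈ Y, ReflTransGen (Q.AdjVia Y) i (Q.s b)) ∧
      (ReflTransGen (Q.AdjVia U) i j → ReflTransGen (Q.AdjVia Y) i j) := by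
    by_cases h : ReflTransGen (Q.AdjVia U) i j
    · obtain ⟨Y, h₁, h₂, h₃, h₄⟩ := exists_finite_path U h
      exact ⟨Y, h₁, h₂, h₃, fun _ => h₄⟩
    · exact ⟨∅, Set.empty_subset _, Set.finite_empty, by simp, fun h' => absurd h' h⟩
  choose p hpU hpfin hps hp using key
  let F₀ : Set Q.V := F ∪ (Q.s '' Y₀ ∪ Q.t '' Y₀)
  have hF₀ : F₀.Finite := hF.union ((hY₀.image _).union (hY₀.image _))
  let Y : Set Q.A := Y₀ ∪ ⋃ i ∈ F₀, ⋃ j ∈ F₀, p i j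
  have hY : Y.Finite := hY₀.union (hF₀.biUnion fun i _ => hF₀.biUnion fun j _ => hpfin i j)
  have hpY {i j : Q.V} (hi : i ∈ F₀) (hj : j ∈ F₀) : p i j ⊆ Y := fun b hb =>
    .inr (Set.mem_biUnion hi (Set.mem_biUnion hj hb))
  have hYs : ∀ a ∈ Y, ∃ i ∈ F₀, ReflTransGen (Q.AdjVia Y) i (Q.s a) := by
    rintro a (ha | ha)
    · exact ⟨Q.s a, .inr (.inl ⟨a, ha, rfl⟩), .refl⟩
    · simp only [Set.mem_iUnion] at ha
      obtain ⟨i, hi, j, hj, ha⟩ := ha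
      exact ⟨i, hi, AdjVia.mono (hpY hi hj) (hps i j a ha)⟩
  have hX : ∀ x ∈ F₀ ∪ (Q.s '' Y ∪ Q.t '' Y), ∃ i ∈ F₀, ReflTransGen (Q.AdjVia Y) i x := by
    rintro x (hx | ⟨a, ha, rfl⟩ | ⟨a, ha, rfl⟩)
    · exact ⟨x, hx, .refl⟩
    · exact hYs a ha
    · obtain ⟨i, hi, h⟩ := hYs a ha
      exact ⟨i, hi, h.trans (AdjVia.of_mem ha)⟩
  have hYU : Y ⊆ U := by
    refine Set.union_subset hU ?_
    simp only [Set.iUnion_subset_iff]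
    exact fun i _ j _ => hpU i j
  refine ⟨⟨F₀ ∪ (Q.s '' Y ∪ Q.t '' Y), Y, fun a ha => .inr (.inl ⟨a, ha, rfl⟩),
    fun a ha => .inr (.inr ⟨a, ha, rfl⟩)⟩, ⟨hF₀.union ((hY.image _).union (hY.image _)), hY⟩,
    fun x hx => .inl (.inl hx), fun x hx => .inl hx, hYU, ?_⟩
  intro i hi j hj hij
  obtain ⟨i₀, hi₀, hi'⟩ := hX i hi
  obtain ⟨j₀, hj₀, hj'⟩ := hX j hj
  have h₀ : ReflTransGen (Q.AdjVia U) i₀ j₀ :=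
    ((AdjVia.mono hYU hi').trans hij).trans (AdjVia.symm (AdjVia.mono hYU hj'))
  exact ((AdjVia.symm hi').trans (AdjVia.mono (hpY hi₀ hj₀) (hp i₀ j₀ h₀))).trans hj'

/-- Finite sets of vertices and arrows lie in a finite IC subquiver. -/
theorem exists_finite_isIC {F : Set Q.V} (hF : F.Finite) {Y₀ : Set Q.A} (hY₀ : Y₀.Finite) :
    ∃ S : Subquiv Q, S.Finite ∧ S.IsIC ∧ F ⊆ S.verts ∧ Y₀ ⊆ S.arrows := by
  obtain ⟨S, hS, hFS, hYS, -, h⟩ := exists_finite_hull Set.univ hF hY₀ (Set.subset_univ _)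
  rw [adjVia_univ] at h
  exact ⟨S, hS, h, hFS, hYS⟩

/-- The list of oriented edges `l` is a walk from `i` to `j`. -/
def IsWalk (Q : Quiv) : List (Q.A × Bool) → Q.V → Q.V → Prop
  | [], i, j => i = j
  | p :: l, i, j => Q.esrc p = i ∧ Q.IsWalk l (Q.etgt p) j

theorem IsWalk.of_append {l₁ l₂ : List (Q.A × Bool)} {i j : Q.V} (h : Q.IsWalk (l₁ ++ l₂) i j) :
    ∃ k, Q.IsWalk l₂ k j := by
  induction l₁ generalizing i with
  | nil => exact ⟨i, h⟩
  | cons p l ih => exact ih h.2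

theorem IsWalk.etgt_getD {l : List (Q.A × Bool)} {i j : Q.V} (h : Q.IsWalk l i j)
    (d : Q.A × Bool) {k : ℕ} (hk : k < l.length) :
    Q.etgt (l.getD k d) = if k + 1 < l.length then Q.esrc (l.getD (k + 1) d) else j := by
  induction l generalizing i k with
  | nil => simp at hk
  | cons p l ih =>
    cases k with
    | succ k => simpa using ih h.2 (by simpa using hk)
    | zero =>
      cases l with
      | nil => simpa [IsWalk] using h.2
      | cons q l => simpa using h.2.1.symm

theorem exists_trail (U : Set Q.A) {i j : Q.V} (h : ReflTransGen (Q.AdjVia U) i j) :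
    ∃ l, Q.IsWalk l i j ∧ (l.map Prod.fst).Nodup ∧ ∀ p ∈ l, p.1 ∈ U := by
  induction h using ReflTransGen.head_induction_on with
  | refl => exact ⟨[], rfl, by simp, by simp⟩
  | @head i k hik _ ih =>
    obtain ⟨l, hl, hnd, hU⟩ := ih
    obtain ⟨a, haU, ha⟩ := hik
    obtain ⟨p, rfl, hps, hpt⟩ : ∃ p : Q.A × Bool, p.1 = a ∧ Q.esrc p = i ∧ Q.etgt p = k := by
      rcases ha with ha | ha
      · exact ⟨(a, true), rfl, ha.1, ha.2⟩
      · exact ⟨(a, false), rfl, ha.2, ha.1⟩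
    by_cases hp : p.1 ∈ l.map Prod.fst
    · obtain ⟨q, hq, hqp⟩ := List.mem_map.1 hp
      obtain ⟨l₁, l₂, rfl⟩ := List.append_of_mem hq
      obtain ⟨k', hk'⟩ := hl.of_append
      rw [List.map_append, List.nodup_append] at hnd
      have hnd' := hnd.2.1
      have hcase : Q.esrc q = i ∨ Q.etgt q = i := by
        obtain ⟨b, β⟩ := p
        obtain ⟨c, γ⟩ := q
        simp only at hqp
        subst hqp
        cases β <;> cases γ <;> simp_all [esrc, etgt]
      rcases hcase with hc | hc
      · refine ⟨q :: l₂, ⟨hc, hk'.2⟩, hnd', fun r hr => hU r ?_⟩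
        exact List.mem_append_right _ hr
      · refine ⟨l₂, hc ▸ hk'.2, ?_, fun r hr => hU r ?_⟩
        · exact (List.nodup_cons.1 hnd').2
        · exact List.mem_append_right _ (List.mem_cons_of_mem _ hr)
    · refine ⟨p :: l, ⟨hps, hpt ▸ hl⟩, List.nodup_cons.2 ⟨hp, hnd⟩, ?_⟩
      intro r hr
      rcases List.mem_cons.1 hr with rfl | hr
      · exact haU
      · exact hU r hr

/-- An arrow whose endpoints are joined through other arrows lies on a cycle. -/
theorem exists_isCycle {U : Set Q.A} {a : Q.A} (ha : a ∉ U)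
    (h : ReflTransGen (Q.AdjVia U) (Q.s a) (Q.t a)) :
    ∃ m e, Q.IsCycle m e ∧ ∃ k < m, a = (e k).1 := by
  obtain ⟨l, hl, hnd, hU⟩ := exists_trail U (AdjVia.symm h)
  let d : Q.A × Bool := (a, true)
  have hw : Q.IsWalk (d :: l) (Q.s a) (Q.s a) := ⟨rfl, hl⟩
  have hnd' : ((d :: l).map Prod.fst).Nodup := by
    refine List.nodup_cons.2 ⟨fun hmem => ?_, hnd⟩
    obtain ⟨q, hq, hqa⟩ := List.mem_map.1 hmem
    exact ha ((show q.1 = a from hqa) ▸ hU q hq)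
  refine ⟨(d :: l).length, fun k => (d :: l).getD k d, ⟨by simp, fun k hk => ?_, ?_⟩,
    0, by simp, rfl⟩
  · have := hw.etgt_getD d hk
    beta_reduce
    rw [this]
    split_ifs with hk'
    · rw [Nat.mod_eq_of_lt hk']
    · rw [show k + 1 = (d :: l).length by omega, Nat.mod_self]
      rfl
  · intro j hj k hk hjk
    beta_reduce at hjk
    rw [List.getD_eq_getElem _ _ hj, List.getD_eq_getElem _ _ hk] at hjk
    refine (hnd'.getElem_inj_iff (hi := by simpa using hj) (hj := by simpa using hk)).1 ?_
    simpa only [List.getElem_map] using hjk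

/-- Removing an arrow from a cycle leaves its endpoints joined through the rest. -/
theorem IsCycle.joined {m : ℕ} {e : ℕ → Q.A × Bool} (h : Q.IsCycle m e) {k : ℕ} (hk : k < m) :
    ReflTransGen (Q.AdjVia {a | (∃ l < m, a = (e l).1) ∧ a ≠ (e k).1})
      (Q.s (e k).1) (Q.t (e k).1) := by
  obtain ⟨hm, hstep, hinj⟩ := h
  have key : ∀ r, r < m → ReflTransGen (Q.AdjVia {a | (∃ l < m, a = (e l).1) ∧ a ≠ (e k).1})
      (Q.etgt (e k)) (Q.esrc (e ((k + r + 1) % m))) := by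
    intro r
    induction r with
    | zero => intro _; rw [hstep k hk]
    | succ r ih =>
      intro hr
      have hlt : (k + r + 1) % m < m := Nat.mod_lt _ hm
      have hne : (k + r + 1) % m ≠ k := by
        intro heq
        have h1 : (k + (r + 1)) ≡ k + 0 [MOD m] := by
          rw [Nat.ModEq, ← add_assoc, heq, add_zero, Nat.mod_eq_of_lt hk]
        have h2 := Nat.ModEq.add_left_cancel' k h1
        rw [Nat.ModEq, Nat.mod_eq_of_lt hr, Nat.zero_mod] at h2
        omega
      refine (ih (by omega)).tail ⟨(e ((k + r + 1) % m)).1, ⟨⟨_, hlt, rfl⟩,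
        fun heq => hne (hinj _ hlt _ hk heq)⟩, ?_⟩
      have := hstep _ hlt
      rw [Nat.mod_add_mod] at this
      rw [show k + (r + 1) + 1 = k + r + 1 + 1 by ring, ← this]
      rcases e ((k + r + 1) % m) with ⟨b, _ | _⟩ <;> simp [esrc, etgt]
  have h' := key (m - 1) (by omega)
  rw [show k + (m - 1) + 1 = k + m by omega, Nat.add_mod_right, Nat.mod_eq_of_lt hk] at h'
  have hends : (Q.s (e k).1 = Q.etgt (e k) ∧ Q.t (e k).1 = Q.esrc (e k)) ∨
      (Q.t (e k).1 = Q.etgt (e k) ∧ Q.s (e k).1 = Q.esrc (e k)) := by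
    rcases e k with ⟨b, _ | _⟩ <;> simp [esrc, etgt]
  rcases hends with ⟨hs, ht⟩ | ⟨ht, hs⟩
  · rw [hs, ht]
    exact h'
  · rw [hs, ht]
    exact AdjVia.symm h'

end Quiv

namespace Subquiv

variable {Q : Quiv}

theorem exists_joined_toQuiv (S : Subquiv Q) {U : Set Q.A} (hU : U ⊆ S.arrows) {i j : Q.V}
    (h : ReflTransGen (Q.AdjVia U) i j) (hi : i ∈ S.verts) :
    ∃ hj : j ∈ S.verts,
      ReflTransGen (S.toQuiv.AdjVia (Subtype.val ⁻¹' U)) ⟨i, hi⟩ ⟨j, hj⟩ := by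
  induction h with
  | refl => exact ⟨hi, .refl⟩
  | @tail k j _ hkj ih =>
    obtain ⟨hk, h'⟩ := ih
    obtain ⟨a, haU, ha⟩ := hkj
    have hj : j ∈ S.verts := by
      rcases ha with ⟨-, rfl⟩ | ⟨rfl, -⟩
      · exact S.tgt_mem a (hU haU)
      · exact S.src_mem a (hU haU)
    refine ⟨hj, h'.tail ⟨⟨a, hU haU⟩, haU, ?_⟩⟩
    exact ha.imp (fun h => ⟨Subtype.ext h.1, Subtype.ext h.2⟩)
      (fun h => ⟨Subtype.ext h.1, Subtype.ext h.2⟩)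

theorem joined_of_toQuiv (S : Subquiv Q) {i j : S.toQuiv.V}
    (h : ReflTransGen S.toQuiv.Adj i j) :
    ReflTransGen (Q.AdjVia S.arrows) i.1 j.1 := by
  refine ReflTransGen.lift (p := Q.AdjVia S.arrows) Subtype.val (fun i j hij => ?_) i j h
  obtain ⟨a, ha⟩ := hij
  refine ⟨a.1, a.2, ?_⟩
  exact ha.imp (fun h => ⟨congrArg Subtype.val h.1, congrArg Subtype.val h.2⟩)
    (fun h => ⟨congrArg Subtype.val h.1, congrArg Subtype.val h.2⟩)

theorem exists_isCycle_toQuiv (S : Subquiv Q) {U : Set Q.A} (hU : U ⊆ S.arrows) {a : Q.A}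
    (haS : a ∈ S.arrows) (ha : a ∉ U) (h : ReflTransGen (Q.AdjVia U) (Q.s a) (Q.t a)) :
    ∃ m e, S.toQuiv.IsCycle m e ∧ ∃ k < m, a = (e k).1.1 := by
  obtain ⟨hj, h'⟩ := S.exists_joined_toQuiv hU h (S.src_mem a haS)
  obtain ⟨m, e, he, k, hk, hak⟩ :=
    Quiv.exists_isCycle (Q := S.toQuiv) (U := Subtype.val ⁻¹' U) (a := ⟨a, haS⟩) ha h'
  exact ⟨m, e, he, k, hk, congrArg Subtype.val hak⟩

end Subquiv

section Tits

variable {Q : Quiv} {n : Q.V → ℤ}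

theorem tits_eq_add {S T : Subquiv Q} (hS : S.Finite) (h : T.le S) :
    tits Q n S = tits Q n T + ((∑ᶠ i ∈ S.verts \ T.verts, n i ^ 2) -
      ∑ᶠ a ∈ S.arrows \ T.arrows, n (Q.s a) * n (Q.t a)) := by
  rw [tits, tits, ← finsum_mem_add_sdiff h.1 hS.1, ← finsum_mem_add_sdiff h.2 hS.2]
  ring

theorem eq_of_joined {U : Set Q.A} (hU : ∀ a ∈ U, n (Q.s a) = n (Q.t a)) {i j : Q.V}
    (h : ReflTransGen (Q.AdjVia U) i j) : n i = n j := by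
  induction h with
  | refl => rfl
  | tail _ hkj ih =>
    obtain ⟨a, ha, ⟨rfl, rfl⟩ | ⟨rfl, rfl⟩⟩ := hkj
    · exact ih.trans (hU a ha)
    · exact ih.trans (hU a ha).symm

/-- A finite subquiver that carries all arrows along which `n` changes and all cycles of the
support, and joins any two of its vertices that are joined in the support. -/
structure IsTitsCore (Q : Quiv) (n : Q.V → ℤ) (T : Subquiv Q) : Prop where
  finite : T.Finite
  ne_subset : {a : Q.A | n (Q.s a) ≠ n (Q.t a)} ⊆ T.arrows
  cycle_mem : ∀ m e, (suppQuiv Q n).toQuiv.IsCycle m e → ∀ k < m, (e k).1.1 ∈ T.arrows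
  joined : ∀ i ∈ T.verts, ∀ j ∈ T.verts,
    ReflTransGen (Q.AdjVia (suppQuiv Q n).arrows) i j →
      ReflTransGen (Q.AdjVia ((suppQuiv Q n).arrows ∩ T.arrows)) i j

theorem IsTitsCore.exists_sum_eq {S T : Subquiv Q} (hT : IsTitsCore Q n T) (F : Finset Q.A)
    (hF : ∀ a ∈ F, a ∈ S.arrows ∧ a ∉ T.arrows ∧ a ∈ (suppQuiv Q n).arrows) :
    ∃ W : Finset Q.V, (∀ v ∈ W, v ∈ S.verts ∧ v ∉ T.verts) ∧
      ∑ a ∈ F, n (Q.s a) * n (Q.t a) = ∑ v ∈ W, n v ^ 2 ∧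
      ∀ v ∈ S.verts, ∃ r ∈ S.verts, r ∉ W ∧ ReflTransGen (Q.AdjVia F) v r := by
  classical
  induction F using Finset.induction_on with
  | empty => exact ⟨∅, by simp, by simp, fun v hv => ⟨v, hv, by simp, .refl⟩⟩
  | insert a F haF ih =>
    obtain ⟨W, hW, hsum, hrep⟩ := ih fun b hb => hF b (Finset.mem_insert_of_mem hb)
    obtain ⟨haS, haT, hasupp⟩ := hF a (Finset.mem_insert_self a F)
    have hconst : ∀ b, b ∉ T.arrows → n (Q.s b) = n (Q.t b) := fun b hb =>
      not_not.1 fun h => hb (hT.ne_subset h)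
    have hFn {i j : Q.V} (h : ReflTransGen (Q.AdjVia F) i j) : n i = n j :=
      eq_of_joined (fun b hb => hconst b (hF b (Finset.mem_insert_of_mem hb)).2.1) h
    have hsub : (F : Set Q.A) ⊆ ↑(insert a F) := by simp
    have step : ∀ x y rx ry : Q.V, rx ∈ S.verts → ry ∈ S.verts → rx ∉ W → ry ∉ W →
        ReflTransGen (Q.AdjVia F) x rx → ReflTransGen (Q.AdjVia F) y ry →
        Q.AdjVia (insert a F : Finset Q.A) y x → n (Q.s a) * n (Q.t a) = n y ^ 2 →
        rx ≠ ry → ry ∉ T.verts → ∃ W : Finset Q.V, (∀ v ∈ W, v ∈ S.verts ∧ v ∉ T.verts) ∧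
          ∑ a ∈ insert a F, n (Q.s a) * n (Q.t a) = ∑ v ∈ W, n v ^ 2 ∧
          ∀ v ∈ S.verts, ∃ r ∈ S.verts, r ∉ W ∧
            ReflTransGen (Q.AdjVia (insert a F : Finset Q.A)) v r := by
      intro x y rx ry hrxS hryS hrxW hryW hx hy hyx hn hne hryT
      refine ⟨insert ry W, ?_, ?_, fun v hv => ?_⟩
      · intro v hv
        rcases Finset.mem_insert.1 hv with rfl | hv
        · exact ⟨hryS, hryT⟩
        · exact hW v hv
      · rw [Finset.sum_insert haF, Finset.sum_insert hryW, hsum, hn, hFn hy]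
      · obtain ⟨r, hrS, hrW, hr⟩ := hrep v hv
        have hr' := Quiv.AdjVia.mono hsub hr
        by_cases h : r = ry
        · subst h
          refine ⟨rx, hrxS, by simp [hne, hrxW], ?_⟩
          exact ((hr'.trans (Quiv.AdjVia.symm (Quiv.AdjVia.mono hsub hy))).tail hyx).trans
            (Quiv.AdjVia.mono hsub hx)
        · exact ⟨r, hrS, by simp [h, hrW], hr'⟩
    obtain ⟨r₁, hr₁S, hr₁W, hr₁⟩ := hrep _ (S.src_mem a haS)
    obtain ⟨r₂, hr₂S, hr₂W, hr₂⟩ := hrep _ (S.tgt_mem a haS)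
    have hacyc : ¬ ReflTransGen (Q.AdjVia (F ∪ ((suppQuiv Q n).arrows ∩ T.arrows)))
        (Q.s a) (Q.t a) := by
      intro h
      obtain ⟨m, e, he, k, hk, hak⟩ := (suppQuiv Q n).exists_isCycle_toQuiv
        (Set.union_subset (fun b hb => (hF b (Finset.mem_insert_of_mem hb)).2.2)
          Set.inter_subset_left) hasupp (by
          rintro (h | h)
          · exact haF h
          · exact haT h.2) h
      exact haT (hak ▸ hT.cycle_mem m e he k hk)
    have hF_joined {i j : Q.V} (h : ReflTransGen (Q.AdjVia F) i j) :
        ReflTransGen (Q.AdjVia (F ∪ ((suppQuiv Q n).arrows ∩ T.arrows))) i j :=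
      Quiv.AdjVia.mono Set.subset_union_left h
    have hne : r₁ ≠ r₂ := by
      rintro rfl
      exact hacyc (hF_joined (hr₁.trans (Quiv.AdjVia.symm hr₂)))
    have ha := hconst a haT
    have hamem : a ∈ (↑(insert a F) : Set Q.A) := by simp
    by_cases h₂ : r₂ ∈ T.verts
    · by_cases h₁ : r₁ ∈ T.verts
      · have hFs : (F : Set Q.A) ⊆ (suppQuiv Q n).arrows := fun b hb =>
          (hF b (Finset.mem_insert_of_mem hb)).2.2
        have hs : ReflTransGen (Q.AdjVia (suppQuiv Q n).arrows) r₁ r₂ :=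
          ((Quiv.AdjVia.symm (Quiv.AdjVia.mono hFs hr₁)).trans
            (Quiv.AdjVia.of_mem hasupp)).trans (Quiv.AdjVia.mono hFs hr₂)
        exact absurd (((hF_joined hr₁).trans (Quiv.AdjVia.mono Set.subset_union_right
          (hT.joined r₁ h₁ r₂ h₂ hs))).trans (hF_joined (Quiv.AdjVia.symm hr₂))) hacyc
      · exact step (Q.t a) (Q.s a) r₂ r₁ hr₂S hr₁S hr₂W hr₁W hr₂ hr₁
          ⟨a, hamem, .inl ⟨rfl, rfl⟩⟩ (by rw [← ha, sq]) hne.symm h₁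
    · exact step (Q.s a) (Q.t a) r₁ r₂ hr₁S hr₂S hr₁W hr₂W hr₁ hr₂
        ⟨a, hamem, .inr ⟨rfl, rfl⟩⟩ (by rw [ha, sq]) hne h₂

theorem IsTitsCore.tits_le {S T : Subquiv Q} (hT : IsTitsCore Q n T) (hS : S.Finite)
    (h : T.le S) : tits Q n T ≤ tits Q n S := by
  classical
  have hV : (S.verts \ T.verts).Finite := hS.1.sdiff
  have hA : (S.arrows \ T.arrows).Finite := hS.2.sdiff
  rw [tits_eq_add hS h, finsum_mem_eq_finite_toFinset_sum _ hV,
    finsum_mem_eq_finite_toFinset_sum _ hA]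
  obtain ⟨W, hW, hsum, -⟩ := hT.exists_sum_eq (S := S)
    {a ∈ hA.toFinset | a ∈ (suppQuiv Q n).arrows} (by simp +contextual)
  rw [Finset.sum_filter_of_ne (p := fun a => a ∈ (suppQuiv Q n).arrows)
    fun a _ ha => mul_ne_zero_iff.1 ha] at hsum
  have hle : ∑ v ∈ W, n v ^ 2 ≤ ∑ v ∈ hV.toFinset, n v ^ 2 :=
    Finset.sum_le_sum_of_subset_of_nonneg (fun v hv => by simpa using hW v hv)
      fun v _ _ => sq_nonneg _
  linarith

theorem exists_crossing {r : Q.V → Q.V → Prop} {X : Set Q.V} {i j : Q.V}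
    (h : ReflTransGen r i j) (hi : i ∈ X) (hj : j ∉ X) : ∃ x ∈ X, ∃ y ∉ X, r x y := by
  induction h with
  | refl => exact absurd hi hj
  | @tail k l _ hkl ih =>
    by_cases hk : k ∈ X
    · exact ⟨k, hk, l, hj, hkl⟩
    · exact ih hk

/-- A finite subquiver that carries all arrows along which `n` changes and meets every
component on which `n` does not vanish. -/
structure IsTitsCover (Q : Quiv) (n : Q.V → ℤ) (T : Subquiv Q) : Prop where
  finite : T.Finite
  ne_subset : {a : Q.A | n (Q.s a) ≠ n (Q.t a)} ⊆ T.arrows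
  exists_joined : ∀ v, n v ≠ 0 → ∃ w ∈ T.verts, ReflTransGen Q.Adj w v

theorem IsTitsCover.mono {S T : Subquiv Q} (hT : IsTitsCover Q n T) (hS : S.Finite)
    (h : T.le S) : IsTitsCover Q n S where
  finite := hS
  ne_subset := hT.ne_subset.trans h.2
  exists_joined v hv := (hT.exists_joined v hv).imp fun _ hw => ⟨h.1 hw.1, hw.2⟩

theorem IsTitsCover.tits_le {S T : Subquiv Q} (hT : IsTitsCover Q n T) (hS : S.Finite)
    (hIC : S.IsIC) (h : T.le S) : tits Q n S ≤ tits Q n T := by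
  induction hm : (S.verts \ T.verts).ncard using Nat.strong_induction_on generalizing T with
  | _ m ih =>
  have hconst : ∀ b, b ∉ T.arrows → n (Q.s b) = n (Q.t b) := fun b hb =>
    not_not.1 fun h => hb (hT.ne_subset h)
  by_cases hv : ∃ v ∈ S.verts \ T.verts, n v ≠ 0
  · obtain ⟨v, ⟨hvS, hvT⟩, hv⟩ := hv
    obtain ⟨w, hwT, hw⟩ := hT.exists_joined v hv
    obtain ⟨x, hx, y, hy, a, haS, ha⟩ :=
      exists_crossing (hIC w (h.1 hwT) v hvS hw) hwT hvT
    have haT : a ∉ T.arrows := by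
      intro haT
      rcases ha with ⟨-, rfl⟩ | ⟨rfl, -⟩
      · exact hy (T.tgt_mem a haT)
      · exact hy (T.src_mem a haT)
    have hyS : y ∈ S.verts := by
      rcases ha with ⟨-, rfl⟩ | ⟨rfl, -⟩
      · exact S.tgt_mem a haS
      · exact S.src_mem a haS
    have hends : Q.s a ∈ insert y T.verts ∧ Q.t a ∈ insert y T.verts := by
      rcases ha with ⟨rfl, rfl⟩ | ⟨rfl, rfl⟩
      · exact ⟨.inr hx, .inl rfl⟩
      · exact ⟨.inl rfl, .inr hx⟩
    let T' : Subquiv Q :=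
      { verts := insert y T.verts
        arrows := insert a T.arrows
        src_mem := by
          rintro b (rfl | hb)
          · exact hends.1
          · exact .inr (T.src_mem b hb)
        tgt_mem := by
          rintro b (rfl | hb)
          · exact hends.2
          · exact .inr (T.tgt_mem b hb) }
    have hTT' : T.le T' := ⟨Set.subset_insert _ _, Set.subset_insert _ _⟩
    have hT'S : T'.le S := ⟨Set.insert_subset hyS h.1, Set.insert_subset haS h.2⟩
    have hT' : T'.Finite := ⟨hT.finite.1.insert y, hT.finite.2.insert a⟩
    have hlt : (S.verts \ T'.verts).ncard < m := by
      rw [← hm]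
      refine Set.ncard_lt_ncard ⟨Set.sdiff_subset_sdiff_right hTT'.1, fun hle => ?_⟩ hS.1.sdiff
      exact (hle ⟨hyS, hy⟩).2 (.inl rfl)
    refine (ih _ hlt (hT.mono hT' hTT') hT'S rfl).trans_eq ?_
    have hd₁ : T'.verts \ T.verts = {y} := Set.insert_sdiff_eq_singleton hy
    have hd₂ : T'.arrows \ T.arrows = {a} := Set.insert_sdiff_eq_singleton haT
    have hay : n (Q.s a) * n (Q.t a) = n y ^ 2 := by
      rcases ha with ⟨-, rfl⟩ | ⟨rfl, -⟩
      · rw [hconst a haT, sq]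
      · rw [← hconst a haT, sq]
    rw [tits_eq_add hT' hTT', hd₁, hd₂, finsum_mem_singleton, finsum_mem_singleton, hay,
      sub_self, add_zero]
  · push Not at hv
    rw [tits_eq_add hS h, finsum_mem_eq_zero_of_forall_eq_zero fun v hv' => by
      rw [hv v hv', sq, zero_mul], finsum_mem_eq_finite_toFinset_sum _ hS.2.sdiff]
    have : 0 ≤ ∑ a ∈ (hS.2.sdiff (t := T.arrows)).toFinset, n (Q.s a) * n (Q.t a) := by
      refine Finset.sum_nonneg fun a ha => ?_
      rw [hconst a (by simpa using (Set.Finite.mem_toFinset _).1 ha |>.2)]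
      exact mul_self_nonneg _
    linarith

theorem exists_isTitsCore (hn : IsRoot Q n) (hcyc : (suppQuiv Q n).toQuiv.CyclesFinite)
    {G : Set Q.V} (hG : G.Finite) : ∃ T : Subquiv Q, IsTitsCore Q n T ∧ G ⊆ T.verts := by
  let B : Set Q.A := {a | n (Q.s a) ≠ n (Q.t a)}
  let C : Set (suppQuiv Q n).toQuiv.A := ⋃₀ {s | ∃ (m : ℕ) (e : ℕ → _ × Bool),
    (suppQuiv Q n).toQuiv.IsCycle m e ∧ s = {a | ∃ k < m, a = (e k).1}}
  have hC : C.Finite := by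
    refine Set.Finite.sUnion hcyc ?_
    rintro _ ⟨m, e, -, rfl⟩
    refine ((Set.finite_lt_nat m).image fun k => (e k).1).subset ?_
    rintro _ ⟨k, hk, rfl⟩
    exact ⟨k, hk, rfl⟩
  obtain ⟨R, hR, hGR, hCR, hRU, hjoin⟩ := Quiv.exists_finite_hull (suppQuiv Q n).arrows
    (F := G ∪ (Q.s '' B ∪ Q.t '' B)) (hG.union ((hn.image _).union (hn.image _)))
    (hC.image Subtype.val) (by rintro _ ⟨a, -, rfl⟩; exact a.2)
  refine ⟨⟨R.verts, R.arrows ∪ B, ?_, ?_⟩, ⟨⟨hR.1, hR.2.union hn⟩, Set.subset_union_right,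
    fun m e he k hk => .inl (hCR ⟨_, ?_, rfl⟩), fun i hi j hj hij => ?_⟩, fun v hv => hGR (.inl hv)⟩
  · rintro a (ha | ha)
    · exact R.src_mem a ha
    · exact hGR (.inr (.inl ⟨a, ha, rfl⟩))
  · rintro a (ha | ha)
    · exact R.tgt_mem a ha
    · exact hGR (.inr (.inr ⟨a, ha, rfl⟩))
  · exact ⟨_, ⟨m, e, he, rfl⟩, k, hk, rfl⟩
  · exact Quiv.AdjVia.mono (Set.subset_inter hRU Set.subset_union_left) (hjoin i hi j hj hij)

theorem exists_joined_of_componentsFinite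
    (hcomp : (suppQuiv Q n).toQuiv.ComponentsFinite) :
    ∃ G : Set Q.V, G.Finite ∧ ∀ v, n v ≠ 0 → ∃ w ∈ G, ReflTransGen Q.Adj w v := by
  obtain ⟨s, hs, h⟩ := hcomp
  refine ⟨Subtype.val '' s, hs.image _, fun v hv => ?_⟩
  obtain ⟨w, hw, hwv⟩ := h ⟨v, hv⟩
  refine ⟨w.1, ⟨w, hw, rfl⟩, ?_⟩
  rw [← Quiv.adjVia_univ]
  exact Quiv.AdjVia.mono (Set.subset_univ _) (Subquiv.joined_of_toQuiv _ hwv)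

theorem exists_isTitsCover (hn : IsRoot Q n)
    (hcomp : (suppQuiv Q n).toQuiv.ComponentsFinite) : ∃ T, IsTitsCover Q n T := by
  obtain ⟨G, hG, hGv⟩ := exists_joined_of_componentsFinite hcomp
  obtain ⟨T, hT, -, hGT, hBT⟩ := Quiv.exists_finite_isIC hG hn
  exact ⟨T, hT, hBT, fun v hv => (hGv v hv).imp fun w hw => ⟨hGT hw.1, hw.2⟩⟩

theorem IsTitsCore.exists_tits_add_one_le {T : Subquiv Q} (hT : IsTitsCore Q n T)
    (hcomp : ¬ (suppQuiv Q n).toQuiv.ComponentsFinite) :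
    ∃ T', IsTitsCore Q n T' ∧ tits Q n T + 1 ≤ tits Q n T' := by
  obtain ⟨v, hv⟩ : ∃ v : (suppQuiv Q n).toQuiv.V, ∀ w ∈ Subtype.val ⁻¹' T.verts,
      ¬ ReflTransGen (suppQuiv Q n).toQuiv.Adj w v := by
    by_contra! h
    exact hcomp ⟨_, hT.finite.1.preimage Subtype.val_injective.injOn, h⟩
  have hv' : ∀ j ∈ T.verts, ¬ ReflTransGen (Q.AdjVia (suppQuiv Q n).arrows) v.1 j := by
    intro j hj h
    obtain ⟨hj', h'⟩ := Subquiv.exists_joined_toQuiv _ subset_rfl h v.2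
    refine hv ⟨j, hj'⟩ hj ?_
    rw [← Quiv.adjVia_univ]
    exact Quiv.AdjVia.symm (Quiv.AdjVia.mono (Set.subset_univ _) h')
  have hvT : v.1 ∉ T.verts := fun h => hv' _ h .refl
  let T' : Subquiv Q := ⟨insert v.1 T.verts, T.arrows, fun a ha => .inr (T.src_mem a ha),
    fun a ha => .inr (T.tgt_mem a ha)⟩
  have hT' : T'.Finite := ⟨hT.finite.1.insert _, hT.finite.2⟩
  refine ⟨T', ⟨hT', hT.ne_subset, hT.cycle_mem, ?_⟩, ?_⟩
  · rintro i (rfl | hi) j (rfl | hj) hij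
    · exact .refl
    · exact absurd hij (hv' j hj)
    · exact absurd (Quiv.AdjVia.symm hij) (hv' i hi)
    · exact hT.joined i hi j hj hij
  · have hd₁ : T'.verts \ T.verts = {v.1} := Set.insert_sdiff_eq_singleton hvT
    have hd₂ : T'.arrows \ T.arrows = ∅ := Set.sdiff_self
    rw [tits_eq_add hT' ⟨Set.subset_insert _ _, subset_rfl⟩, hd₁, hd₂, finsum_mem_singleton,
      finsum_mem_empty]
    have : 0 < n v.1 ^ 2 := sq_pos_of_ne_zero v.2
    linarith

theorem IsTitsCover.exists_tits_add_one_le {T : Subquiv Q} (hT : IsTitsCover Q n T)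
    (hcyc : ¬ (suppQuiv Q n).toQuiv.CyclesFinite) :
    ∃ T', IsTitsCover Q n T' ∧ tits Q n T' + 1 ≤ tits Q n T := by
  obtain ⟨m, e, he, k, hk, hkT⟩ : ∃ m e, (suppQuiv Q n).toQuiv.IsCycle m e ∧
      ∃ k < m, (e k).1.1 ∉ T.arrows := by
    by_contra! h
    refine hcyc (Set.Finite.subset
      (hT.finite.2.preimage Subtype.val_injective.injOn).finite_subsets ?_)
    rintro _ ⟨m, e, he, rfl⟩ _ ⟨k, hk, rfl⟩
    exact h m e he k hk
  set a : Q.A := (e k).1.1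
  let C : Set (suppQuiv Q n).toQuiv.A := {b | ∃ l < m, b = (e l).1}
  have hC : C.Finite := by
    refine ((Set.finite_lt_nat m).image fun k => (e k).1).subset ?_
    rintro _ ⟨k, hk, rfl⟩
    exact ⟨k, hk, rfl⟩
  obtain ⟨S, hS, hIC, hTS, hYS⟩ := Quiv.exists_finite_isIC hT.finite.1
    (hT.finite.2.union (hC.image Subtype.val))
  have haS : a ∈ S.arrows := hYS (.inr ⟨_, ⟨k, hk, rfl⟩, rfl⟩)
  let S' : Subquiv Q := ⟨S.verts, S.arrows \ {a}, fun b hb => S.src_mem b hb.1,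
    fun b hb => S.tgt_mem b hb.1⟩
  have hS' : S'.Finite := ⟨hS.1, hS.2.sdiff⟩
  have hS'S : S'.le S := ⟨subset_rfl, Set.sdiff_subset⟩
  have hTS' : T.le S' := ⟨hTS, fun b hb => ⟨hYS (.inl hb), fun h => hkT (h ▸ hb)⟩⟩
  have hround : ReflTransGen S'.Adj (Q.s a) (Q.t a) := by
    refine ReflTransGen.lift (p := S'.Adj) Subtype.val (fun i j hij => ?_) _ _ (he.joined hk)
    obtain ⟨b, ⟨hb, hne⟩, h⟩ := hij
    refine ⟨b.1, ⟨hYS (.inr ⟨b, hb, rfl⟩), fun h => hne (Subtype.ext h)⟩, ?_⟩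
    exact h.imp (fun h => ⟨congrArg Subtype.val h.1, congrArg Subtype.val h.2⟩)
      (fun h => ⟨congrArg Subtype.val h.1, congrArg Subtype.val h.2⟩)
  have hIC' : S'.IsIC := by
    intro i hi j hj hij
    refine ReflTransGen.lift' (p := S'.Adj) id (fun x y hxy => ?_) i j (hIC i hi j hj hij)
    obtain ⟨b, hb, h⟩ := hxy
    by_cases hba : b = a
    · subst hba
      rcases h with ⟨rfl, rfl⟩ | ⟨rfl, rfl⟩
      · exact hround
      · exact Quiv.AdjVia.symm (U := S'.arrows) hround
    · exact .single ⟨b, ⟨hb, hba⟩, h⟩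
  refine ⟨S, hT.mono hS ⟨hTS, hTS'.2.trans hS'S.2⟩, ?_⟩
  have hle := hT.tits_le hS' hIC' hTS'
  have hd₁ : S.verts \ S'.verts = ∅ := Set.sdiff_self
  have hd₂ : S.arrows \ S'.arrows = {a} := by
    rw [Set.sdiff_sdiff_cancel_left (Set.singleton_subset_iff.2 haS)]
  have heq : n (Q.s a) = n (Q.t a) := not_not.1 fun h => hkT (hT.ne_subset h)
  rw [tits_eq_add hS hS'S, hd₁, hd₂, finsum_mem_singleton, finsum_mem_empty, heq]
  have : 0 < n (Q.t a) * n (Q.t a) := mul_self_pos.2 (e k).1.2.2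
  linarith

theorem eventually_le_finICSub {T : Subquiv Q} (hT : T.Finite) :
    ∀ᶠ S : FinICSub Q in Filter.atTop, T.le S.1 := by
  obtain ⟨S, hS, hIC, h₁, h₂⟩ := Quiv.exists_finite_isIC hT.1 hT.2
  let S₀ : FinICSub Q := ⟨S, hS, hIC⟩
  filter_upwards [Filter.eventually_ge_atTop S₀] with S' hS'
  exact ⟨h₁.trans hS'.1, h₂.trans hS'.2⟩

end Tits

/-- Let `n` be an element of the root space of `Ω` with support `Ω^n`.
(1) If `Ω^n` has finitely many components and finitely many cycles, then the Tits net of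
`n` converges to the value `⟨n,n⟩_{Ω*}` for some finite IC subquiver `Ω*` of `Ω`.
(2) If `Ω^n` has finitely many cycles but infinitely many components, then
`⟨n,n⟩_Ω = +∞`. (3) If `Ω^n` has finitely many components but infinitely many cycles,
then `⟨n,n⟩_Ω = −∞`. -/
theorem stmt17 (Q : Quiv) (n : Q.V → ℤ) (hn : IsRoot Q n) :
    ((suppQuiv Q n).toQuiv.ComponentsFinite → (suppQuiv Q n).toQuiv.CyclesFinite →
      ∃ S : FinICSub Q,
        Filter.Tendsto (titsNet Q n) Filter.atTop (nhds ((tits Q n S.1 : ℤ) : ℝ))) ∧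
    ((suppQuiv Q n).toQuiv.CyclesFinite → ¬ (suppQuiv Q n).toQuiv.ComponentsFinite →
      Filter.Tendsto (titsNet Q n) Filter.atTop (nhds (⊤ : EReal))) ∧
    ((suppQuiv Q n).toQuiv.ComponentsFinite → ¬ (suppQuiv Q n).toQuiv.CyclesFinite →
      Filter.Tendsto (titsNet Q n) Filter.atTop (nhds (⊥ : EReal))) := by
  refine ⟨fun hcomp hcyc => ?_, fun hcyc hcomp => ?_, fun hcomp hcyc => ?_⟩
  · obtain ⟨G, hG, hGv⟩ := exists_joined_of_componentsFinite hcomp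
    obtain ⟨T, hT, hGT⟩ := exists_isTitsCore hn hcyc hG
    have hT' : IsTitsCover Q n T :=
      ⟨hT.finite, hT.ne_subset, fun v hv => (hGv v hv).imp fun w hw => ⟨hGT hw.1, hw.2⟩⟩
    have heq (S : FinICSub Q) (hS : T.le S.1) : tits Q n S.1 = tits Q n T :=
      (hT'.tits_le S.2.1 S.2.2 hS).antisymm (hT.tits_le S.2.1 hS)
    obtain ⟨S, hS, hIC, h₁, h₂⟩ := Quiv.exists_finite_isIC hT.finite.1 hT.finite.2
    refine ⟨⟨S, hS, hIC⟩, tendsto_const_nhds.congr' ?_⟩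
    filter_upwards [eventually_le_finICSub hT.finite] with S' hS'
    rw [titsNet, heq S' hS', heq ⟨S, hS, hIC⟩ ⟨h₁, h₂⟩]
  · obtain ⟨T₀, hT₀, -⟩ := exists_isTitsCore hn hcyc Set.finite_empty
    have key (k : ℕ) : ∃ T, IsTitsCore Q n T ∧ tits Q n T₀ + k ≤ tits Q n T := by
      induction k with
      | zero => exact ⟨T₀, hT₀, by simp⟩
      | succ k ih =>
        obtain ⟨T, hT, hk⟩ := ih
        obtain ⟨T', hT', h⟩ := hT.exists_tits_add_one_le hcomp
        exact ⟨T', hT', by push_cast; linarith⟩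
    refine EReal.tendsto_nhds_top_iff_real.2 fun x => ?_
    obtain ⟨k, hk⟩ := exists_nat_gt (x - tits Q n T₀)
    obtain ⟨T, hT, hle⟩ := key k
    filter_upwards [eventually_le_finICSub hT.finite] with S hS
    have hle' : ((tits Q n T₀ + k : ℤ) : ℝ) ≤ (tits Q n S.1 : ℤ) :=
      Int.cast_le.2 (hle.trans (hT.tits_le S.2.1 hS))
    push_cast at hle'
    exact EReal.coe_lt_coe_iff.2 (by linarith)
  · obtain ⟨T₀, hT₀⟩ := exists_isTitsCover hn hcomp
    have key (k : ℕ) : ∃ T, IsTitsCover Q n T ∧ tits Q n T + k ≤ tits Q n T₀ := by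
      induction k with
      | zero => exact ⟨T₀, hT₀, by simp⟩
      | succ k ih =>
        obtain ⟨T, hT, hk⟩ := ih
        obtain ⟨T', hT', h⟩ := hT.exists_tits_add_one_le hcyc
        exact ⟨T', hT', by push_cast; linarith⟩
    refine EReal.tendsto_nhds_bot_iff_real.2 fun x => ?_
    obtain ⟨k, hk⟩ := exists_nat_gt (tits Q n T₀ - x)
    obtain ⟨T, hT, hle⟩ := key k
    filter_upwards [eventually_le_finICSub hT.finite] with S hS
    have hle' : ((tits Q n S.1 + k : ℤ) : ℝ) ≤ (tits Q n T₀ : ℤ) :=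
      Int.cast_le.2 ((add_le_add_left (hT.tits_le S.2.1 S.2.2 hS) _).trans hle)
    push_cast at hle'
    exact EReal.coe_lt_coe_iff.2 (by linarith)
end
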